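/- For all integers k ≥ 4 and 1 ≤ ℓ < k/2 and every γ > 0 there exists n₀ such that every k-uniform hypergraph H = (V,E) on n ≥ n₀ vertices with n divisible by k−ℓ and δ_{k−2}(H) ≥ ((4(k−ℓ)−1)/(4(k−ℓ)²) + γ)·C(n,2) contains a Hamiltonian ℓ-cycle. -/

import Mathlib

open Finset

/-- Number of edges of the hypergraph `E` containing the vertex set `S`. -/
def degH {n : ℕ} (E : Finset (Finset (Fin n))) (S : Finset (Fin n)) : ℕ :=
  (E.filter fun e => S ⊆ e).card

/-- `E` contains a Hamiltonian ℓ-cycle: there is a cyclic ordering of all vertices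
(a list `vs` without repetitions containing every vertex) such that for every
`i < |vs|/(k-ℓ)` the set of `k` cyclically consecutive vertices starting at position
`i·(k-ℓ)` is an edge of `E`; consecutive such edges share exactly `ℓ` vertices and
every vertex lies in an edge. -/
def HasHamCycle {n : ℕ} (k l : ℕ) (E : Finset (Finset (Fin n))) : Prop :=
  ∃ vs : List (Fin n), vs.Nodup ∧ (∀ v, v ∈ vs) ∧ 1 ≤ vs.length / (k - l) ∧
    ∀ i < vs.length / (k - l), ((vs.rotate (i * (k - l))).take k).toFinset ∈ E

set_option linter.unusedSectionVars false

namespace HamCycle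

/-- A list of vertices traversing an `l`-path whose edges are windows of `m + l` consecutive
vertices, each shifted by `m`. -/
inductive LPath {V : Type*} [DecidableEq V] (E : Finset (Finset V)) (l m : ℕ) : List V → Prop
  | base (X : List V) : X.length = l → LPath E l m X
  | step (A vs : List V) : A.length = m → (A ++ vs.take l).toFinset ∈ E →
      LPath E l m vs → LPath E l m (A ++ vs)

section Paths

variable {V : Type*} [DecidableEq V] {E : Finset (Finset V)} {l m : ℕ}

theorem LPath.exists_length {vs : List V} (h : LPath E l m vs) :
    ∃ T, vs.length = m * T + l := by
  induction h with
  | base X hX => exact ⟨0, by simpa using hX⟩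
  | step A vs hA _ _ ih =>
    obtain ⟨T, hT⟩ := ih
    exact ⟨T + 1, by rw [List.length_append, hA, hT]; ring⟩

theorem LPath.le_length {vs : List V} (h : LPath E l m vs) : l ≤ vs.length := by
  obtain ⟨T, hT⟩ := h.exists_length
  omega

theorem LPath.glue {p X q : List V} (h : LPath E l m (p ++ X)) (hX : X.length = l)
    (h2 : LPath E l m (X ++ q)) : LPath E l m (p ++ X ++ q) := by
  generalize hw : p ++ X = w at h
  induction h generalizing p with
  | base Y hY =>
    have hp : p = [] := by
      have := congrArg List.length hw
      rw [List.length_append] at this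
      exact List.length_eq_zero_iff.mp (by omega)
    subst hp
    simp only [List.nil_append] at hw
    rw [← hw]
    exact h2
  | step A vs hA hE hvs ih =>
    have hl := hvs.le_length
    have hlen := congrArg List.length hw
    simp only [List.length_append] at hlen
    rcases List.append_eq_append_iff.mp hw with ⟨a, ha1, ha2⟩ | ⟨a, ha1, ha2⟩
    · have : a = [] := by
        have := congrArg List.length ha1
        have h3 := congrArg List.length ha2
        simp only [List.length_append] at this h3
        exact List.length_eq_zero_iff.mp (by omega)
      subst this
      simp only [List.append_nil, List.nil_append] at ha1 ha2
      subst ha1 ha2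
      rw [List.append_assoc]
      refine LPath.step A _ hA ?_ h2
      rwa [List.take_append_of_le_length hl]
    · subst ha2
      have h3 := ih (p := a) rfl
      rw [List.append_assoc]
      refine LPath.step A _ hA ?_ h3
      rwa [List.take_append_of_le_length hl]

theorem LPath.window {vs : List V} (h : LPath E l m vs) (i : ℕ)
    (hi : i * m + m + l ≤ vs.length) (hm : 0 < m) :
    ((vs.drop (i * m)).take (m + l)).toFinset ∈ E := by
  induction h generalizing i with
  | base X hX => omega
  | step A vs hA hE hvs ih =>
    cases i with
    | zero =>
      simp only [zero_mul, List.drop_zero]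
      rwa [← hA, List.take_length_add_append]
    | succ j =>
      have e : (j + 1) * m = A.length + j * m := by rw [hA]; ring
      rw [e, ← List.drop_drop, List.drop_left]
      apply ih
      rw [List.length_append, e] at hi
      omega

/-- The concatenation of a sequence of path–connector pairs. -/
def flat (bs : List (List V × List V)) : List V := bs.flatMap fun b => b.1 ++ b.2

/-- The first `l` vertices of a sequence of path–connector pairs followed by `Y`. -/
def start (l : ℕ) (bs : List (List V × List V)) (Y : List V) : List V :=
  match bs with
  | [] => Y
  | b :: _ => b.1.take l

/-- The last `l` elements of a list. -/
def last (l : ℕ) (q : List V) : List V := q.drop (q.length - l)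

/-- A sequence of paths, each joined to the next one by its connector; the last one is joined
to `Y`. -/
def Chain (E : Finset (Finset V)) (l m : ℕ) : List (List V × List V) → List V → Prop
  | [], _ => True
  | b :: bs, Y => LPath E l m b.1 ∧ LPath E l m (last l b.1 ++ b.2 ++ start l bs Y) ∧
      Chain E l m bs Y

theorem length_last {q : List V} (h : l ≤ q.length) : (last l q).length = l := by
  simp only [last, List.length_drop]; omega

theorem take_append_last (q : List V) :
    q.take (q.length - l) ++ last l q = q := List.take_append_drop _ _

theorem last_sublist (q : List V) : (last l q).Sublist q := List.drop_sublist _ _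

theorem exists_flat (l : ℕ) (bs : List (List V × List V)) (Y : List V) :
    ∃ r, flat bs ++ Y = start l bs Y ++ r := by
  cases bs with
  | nil => exact ⟨[], by simp [flat, start]⟩
  | cons b bs =>
    refine ⟨b.1.drop l ++ b.2 ++ flat bs ++ Y, ?_⟩
    simp only [start, flat, List.flatMap_cons, List.append_assoc]
    rw [← List.append_assoc (b.1.take l), List.take_append_drop]

theorem Chain.length_start {bs : List (List V × List V)} {Y : List V} (h : Chain E l m bs Y)
    (hY : Y.length = l) : (start l bs Y).length = l := by
  cases bs with
  | nil => exact hY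
  | cons b bs =>
    have := h.1.le_length
    simp only [start, List.length_take]; omega

theorem Chain.lpath {bs : List (List V × List V)} {Y : List V} (h : Chain E l m bs Y)
    (hY : Y.length = l) : LPath E l m (flat bs ++ Y) := by
  induction bs with
  | nil => exact LPath.base _ (by simpa [flat] using hY)
  | cons b bs ih =>
    obtain ⟨h1, h2, h3⟩ := h
    have h4 := ih h3
    obtain ⟨r, hr⟩ := exists_flat l bs Y
    have hs := h3.length_start hY
    rw [hr] at h4
    have h5 := LPath.glue h2 hs h4
    rw [← take_append_last (l := l) b.1] at h1
    have h6 := LPath.glue (q := b.2 ++ start l bs Y ++ r) h1 (length_last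
      (by rw [take_append_last] at h1; exact h1.le_length)) (by simpa using h5)
    rw [take_append_last] at h6
    have : flat (b :: bs) ++ Y = b.1 ++ (b.2 ++ start l bs Y ++ r) := by
      rw [List.append_assoc, ← hr]; simp [flat]
    rwa [this]

theorem start_append (bs cs : List (List V × List V)) (Y : List V) :
    start l (bs ++ cs) Y = start l bs (start l cs Y) := by
  cases bs <;> rfl

theorem chain_append {bs cs : List (List V × List V)} {Y : List V} :
    Chain E l m (bs ++ cs) Y ↔ Chain E l m bs (start l cs Y) ∧ Chain E l m cs Y := by
  induction bs with
  | nil => simp [Chain]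
  | cons b bs ih =>
    simp only [List.cons_append, Chain, ih, start_append, and_assoc]

theorem flat_append (bs cs : List (List V × List V)) : flat (bs ++ cs) = flat bs ++ flat cs := by
  simp [flat]

theorem chain_replace {bs cs : List (List V × List V)} {Y q q' c : List V}
    (h : Chain E l m (bs ++ (q, c) :: cs) Y) (hq : LPath E l m q') (h1 : q'.take l = q.take l)
    (h2 : last l q' = last l q) : Chain E l m (bs ++ (q', c) :: cs) Y := by
  rw [chain_append] at h ⊢
  refine ⟨?_, hq, ?_, h.2.2.2⟩
  · simpa [start, h1] using h.1
  · simpa [h2] using h.2.2.1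

/-- The path `L i, I i, L (i+1), …, L (i+T)`. -/
def zig (L I : ℕ → List V) : ℕ → ℕ → List V
  | i, 0 => L i
  | i, T + 1 => L i ++ I i ++ zig L I (i + 1) T

theorem zig_eq (L I : ℕ → List V) (i T : ℕ) :
    zig L I i T = (List.range' i T).flatMap (fun j => L j ++ I j) ++ L (i + T) := by
  induction T generalizing i with
  | zero => simp [zig]
  | succ T ih =>
    simp [zig, ih, List.range'_succ, Nat.add_assoc, Nat.add_comm 1 T]

theorem zig_take (L I : ℕ → List V) (i T : ℕ) (hL : (L i).length = l) :
    (zig L I i T).take l = L i := by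
  cases T with
  | zero => simp [zig, ← hL]
  | succ T => rw [zig, List.append_assoc, List.take_append_of_le_length (by omega), ← hL,
      List.take_length]

theorem zig_lpath (L I : ℕ → List V) (i T : ℕ)
    (hL : ∀ j, i ≤ j → j ≤ i + T → (L j).length = l)
    (hLI : ∀ j, i ≤ j → j < i + T → (L j ++ I j).length = m)
    (hE : ∀ j, i ≤ j → j < i + T → (L j ++ I j ++ L (j + 1)).toFinset ∈ E) :
    LPath E l m (zig L I i T) := by
  induction T generalizing i with
  | zero => exact LPath.base _ (hL i le_rfl (by omega))
  | succ T ih =>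
    refine LPath.step _ _ (hLI i le_rfl (by omega)) ?_ (ih _ ?_ ?_ ?_)
    · rw [zig_take _ _ _ _ (hL (i + 1) (by omega) (by omega))]
      exact hE i le_rfl (by omega)
    · exact fun j h1 h2 => hL j (by omega) (by omega)
    · exact fun j h1 h2 => hLI j (by omega) (by omega)
    · exact fun j h1 h2 => hE j (by omega) (by omega)

theorem zig_nodup (L I : ℕ → List V) (T : ℕ)
    (h1 : ∀ j < T, (L j ++ I j).Nodup) (h2 : (L T).Nodup)
    (h3 : ∀ i j, i < j → j < T → List.Disjoint (L i ++ I i) (L j ++ I j))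
    (h4 : ∀ i < T, List.Disjoint (L i ++ I i) (L T)) : (zig L I 0 T).Nodup := by
  rw [zig_eq, Nat.zero_add, ← List.range_eq_range']
  rw [List.nodup_append', List.nodup_flatMap]
  refine ⟨⟨fun x hx => h1 x (List.mem_range.mp hx), ?_⟩, h2, ?_⟩
  · have := List.pairwise_lt_range (n := T)
    refine (List.Pairwise.imp_of_mem ?_ this)
    intro a b ha hb hab
    exact h3 a b hab (List.mem_range.mp hb)
  · intro x hx
    obtain ⟨i, hi, hx⟩ := List.mem_flatMap.mp hx
    exact h4 i (List.mem_range.mp hi) hx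

end Paths

/-- The number of ordered pairs of vertices that extend `S` to an edge. -/
def pairDeg {V : Type*} [Fintype V] [DecidableEq V] (E : Finset (Finset V)) (S : Finset V) : ℕ :=
  #{p : V × V | insert p.1 (insert p.2 S) ∈ E}

section Counting

variable {ι κ V : Type*} [Fintype ι] [DecidableEq ι] [Fintype κ] [DecidableEq κ]
  [Fintype V] [DecidableEq V]

theorem sum_update (f : (ι → V) → ℝ) (i : ι) :
    ∑ x : ι → V, ∑ u : V, f (Function.update x i u) = Fintype.card V * ∑ x, f x := by
  have h : ∑ p : (ι → V) × V, f (Function.update p.1 i p.2) = ∑ p : (ι → V) × V, f p.1 := by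
    refine Finset.sum_nbij' (fun p => (Function.update p.1 i p.2, p.1 i))
      (fun p => (Function.update p.1 i p.2, p.1 i)) ?_ ?_ ?_ ?_ ?_ <;> simp
  rw [Fintype.sum_prod_type, Fintype.sum_prod_type] at h
  rw [h]
  simp [Finset.mul_sum]

theorem card_eq_coord (i : ι) (φ : (ι → V) → V)
    (hφ : ∀ x u, φ (Function.update x i u) = φ x) :
    (Fintype.card V : ℝ) * #{x : ι → V | x i = φ x} = (Fintype.card V : ℝ) ^ Fintype.card ι := by
  have h := sum_update (fun x : ι → V => if x i = φ x then (1 : ℝ) else 0) i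
  simp only [Function.update_self, hφ, Finset.sum_ite_eq', Finset.mem_univ, if_true,
    Finset.sum_boole, Finset.sum_const, nsmul_eq_mul, mul_one, Finset.card_univ,
    Fintype.card_fun] at h
  rw [← h]
  simp

theorem card_mem_coord (i : ι) (W : Finset V) :
    (Fintype.card V : ℝ) * #{x : ι → V | x i ∈ W} =
      #W * (Fintype.card V : ℝ) ^ Fintype.card ι := by
  have h := sum_update (fun x : ι → V => if x i ∈ W then (1 : ℝ) else 0) i
  simp only [Function.update_self, Finset.sum_boole, Finset.sum_const, nsmul_eq_mul,
    Finset.card_univ, Fintype.card_fun] at h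
  rw [← h]
  simp [mul_comm]

theorem card_hits (W : Finset V) :
    (Fintype.card V : ℝ) * #{x : ι → V | ∃ i, x i ∈ W} ≤
      Fintype.card ι * #W * (Fintype.card V : ℝ) ^ Fintype.card ι := by
  have h : (#{x : ι → V | ∃ i, x i ∈ W} : ℝ) ≤ ∑ i : ι, (#{x : ι → V | x i ∈ W} : ℝ) := by
    norm_cast
    refine le_trans (Finset.card_le_card ?_) Finset.card_biUnion_le
    intro x
    simp
  calc _ ≤ (Fintype.card V : ℝ) * ∑ i : ι, (#{x : ι → V | x i ∈ W} : ℝ) := by gcongr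
    _ = _ := by
      rw [Finset.mul_sum, Finset.sum_congr rfl fun i _ => card_mem_coord i W]
      simp [mul_assoc]

theorem card_not_injective (y : κ → V) (hy : Function.Injective y) :
    (Fintype.card V : ℝ) * #{x : ι → V | ¬ Function.Injective (Sum.elim x y)} ≤
      (Fintype.card ι * (Fintype.card ι + Fintype.card κ) : ℕ) *
        (Fintype.card V : ℝ) ^ Fintype.card ι := by
  let B : ι → ι ⊕ κ → Finset (ι → V) := fun i j =>
    Sum.elim (fun j => if i = j then ∅ else Finset.univ.filter fun x : ι → V => x i = x j)
      (fun j => Finset.univ.filter fun x : ι → V => x i = y j) j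
  have h : (#{x : ι → V | ¬ Function.Injective (Sum.elim x y)} : ℝ) ≤
      ∑ i : ι, ∑ j : ι ⊕ κ, (#(B i j) : ℝ) := by
    norm_cast
    rw [← Finset.sum_product']
    refine le_trans (Finset.card_le_card ?_) Finset.card_biUnion_le
    intro x hx
    simp only [Finset.mem_filter, Finset.mem_univ, true_and] at hx
    simp only [Finset.mem_biUnion, Finset.mem_product, Finset.mem_univ, true_and, Prod.exists]
    by_contra hc
    push Not at hc
    apply hx
    have h1 : ∀ i j, x i = x j → i = j := by
      intro i j hij
      by_contra hne
      exact hc i (Sum.inl j) (by simp [B, hne, hij])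
    have h2 : ∀ i j, x i ≠ y j := by
      intro i j hij
      exact hc i (Sum.inr j) (by simp [B, hij])
    exact Function.Injective.sumElim h1 hy h2
  have hB : ∀ i j, (Fintype.card V : ℝ) * #(B i j) ≤
      (Fintype.card V : ℝ) ^ Fintype.card ι := by
    intro i j
    rcases j with j | j
    · by_cases hij : i = j
      · simp [B, hij]
      · have := card_eq_coord (V := V) i (fun x => x j) (fun x u => by
          simp [Function.update_of_ne (Ne.symm hij)])
        simp only [B, Sum.elim_inl, if_neg hij]
        exact this.le
    · exact (card_eq_coord (V := V) i (fun _ => y j) (fun _ _ => rfl)).le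
  calc _ ≤ (Fintype.card V : ℝ) * ∑ i : ι, ∑ j : ι ⊕ κ, (#(B i j) : ℝ) := by gcongr
    _ = ∑ i : ι, ∑ j : ι ⊕ κ, (Fintype.card V : ℝ) * (#(B i j) : ℝ) := by
      simp only [Finset.mul_sum]
    _ ≤ ∑ i : ι, ∑ j : ι ⊕ κ, (Fintype.card V : ℝ) ^ Fintype.card ι := by
      gcongr with i _ j _
      exact hB i j
    _ = _ := by simp; ring

/-- Tuples with all the prescribed edges. -/
def realize (E : Finset (Finset V)) (y : κ → V) (es : List (ι × ι × Finset (ι ⊕ κ))) :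
    Finset (ι → V) :=
  {x | ∀ e ∈ es, insert (x e.1) (insert (x e.2.1) (e.2.2.image (Sum.elim x y))) ∈ E}

/-- A list of prospective edges, each of which has two coordinates that do not occur in the
later members of the list. -/
def Fresh (K : ℕ) : List (ι × ι × Finset (ι ⊕ κ)) → Prop
  | [] => True
  | (p, q, S) :: es => p ≠ q ∧ #S = K ∧ Sum.inl p ∉ S ∧ Sum.inl q ∉ S ∧
      (∀ e ∈ es, p ≠ e.1 ∧ p ≠ e.2.1 ∧ Sum.inl p ∉ e.2.2 ∧
        q ≠ e.1 ∧ q ≠ e.2.1 ∧ Sum.inl q ∉ e.2.2) ∧ Fresh K es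

theorem realize_update {E : Finset (Finset V)} {y : κ → V} {es : List (ι × ι × Finset (ι ⊕ κ))}
    {p : ι} (h : ∀ e ∈ es, p ≠ e.1 ∧ p ≠ e.2.1 ∧ Sum.inl p ∉ e.2.2) (x : ι → V) (u : V) :
    Function.update x p u ∈ realize E y es ↔ x ∈ realize E y es := by
  simp only [realize, Finset.mem_filter, Finset.mem_univ, true_and]
  refine forall₂_congr fun e he => ?_
  obtain ⟨h1, h2, h3⟩ := h e he
  rw [Function.update_of_ne h1.symm, Function.update_of_ne h2.symm]
  have : e.2.2.image (Sum.elim (Function.update x p u) y) = e.2.2.image (Sum.elim x y) := by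
    apply Finset.image_congr
    intro j hj
    rcases j with j | j
    · have : j ≠ p := fun h => h3 (h ▸ hj)
      simp [Function.update_of_ne this]
    · rfl
  rw [this]

theorem image_update {y : κ → V} {p : ι} {S : Finset (ι ⊕ κ)} (h3 : Sum.inl p ∉ S)
    (x : ι → V) (u : V) :
    S.image (Sum.elim (Function.update x p u) y) = S.image (Sum.elim x y) := by
  apply Finset.image_congr
  intro j hj
  rcases j with j | j
  · have : j ≠ p := fun h => h3 (h ▸ hj)
    simp [Function.update_of_ne this]
  · rfl

theorem card_realize {E : Finset (Finset V)} {y : κ → V} {K : ℕ}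
    {d : ℝ} (hd0 : 0 < d) (hd1 : d ≤ 1) (hV : 0 < Fintype.card V)
    (hE : ∀ S : Finset V, #S = K → d * (Fintype.card V : ℝ) ^ 2 ≤ pairDeg E S)
    {es : List (ι × ι × Finset (ι ⊕ κ))} (hes : Fresh K es) :
    d ^ es.length * (Fintype.card V : ℝ) ^ Fintype.card ι -
        es.length * #{x : ι → V | ¬ Function.Injective (Sum.elim x y)} ≤
      #(realize E y es) := by
  classical
  induction es with
  | nil => simp [realize]
  | cons e es ih =>
    obtain ⟨p, q, S⟩ := e
    obtain ⟨hpq, hS, hpS, hqS, hf, hes⟩ := hes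
    specialize ih hes
    set NI : Finset (ι → V) := {x : ι → V | ¬ Function.Injective (Sum.elim x y)}
    set n : ℝ := (Fintype.card V : ℝ)
    have hn : 0 < n := by simpa [n] using hV
    let F : Finset (ι → V) := {x ∈ realize E y es | #(S.image (Sum.elim x y)) = K}
    have hF : (#(realize E y es) : ℝ) - #NI ≤ #F := by
      rw [sub_le_iff_le_add]
      norm_cast
      refine le_trans (Finset.card_le_card ?_) (Finset.card_union_le _ _)
      intro x hx
      simp only [F, NI, Finset.mem_union, Finset.mem_filter, Finset.mem_univ, true_and]
      by_cases hi : Function.Injective (Sum.elim x y)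
      · left
        exact ⟨hx, by rw [Finset.card_image_of_injective _ hi, hS]⟩
      · exact Or.inr hi
    let G : (ι → V) → ℝ := fun x => if x ∈ F ∧
      insert (x p) (insert (x q) (S.image (Sum.elim x y))) ∈ E then 1 else 0
    have hFu : ∀ x u, (Function.update x p u ∈ F ↔ x ∈ F) := by
      intro x u
      simp only [F, Finset.mem_filter]
      rw [realize_update (fun e he => ⟨(hf e he).1, (hf e he).2.1, (hf e he).2.2.1⟩),
        image_update hpS]
    have hFv : ∀ x u, (Function.update x q u ∈ F ↔ x ∈ F) := by
      intro x u
      simp only [F, Finset.mem_filter]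
      rw [realize_update (fun e he => (hf e he).2.2.2), image_update hqS]
    have key : ∑ x : ι → V, ∑ u : V, ∑ v : V,
        G (Function.update (Function.update x p u) q v) = n * (n * ∑ x, G x) := by
      rw [← sum_update G q, ← sum_update _ p]
    have hlow : ∀ x ∈ F, d * n ^ 2 ≤ ∑ u : V, ∑ v : V,
        G (Function.update (Function.update x p u) q v) := by
      intro x hx
      have h1 := hE (S.image (Sum.elim x y)) (Finset.mem_filter.mp hx).2
      refine h1.trans (le_of_eq ?_)
      rw [pairDeg, Finset.card_filter, Nat.cast_sum, Fintype.sum_prod_type]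
      refine Finset.sum_congr rfl fun u _ => Finset.sum_congr rfl fun v _ => ?_
      simp only [G, hFv, hFu, hx, true_and, image_update hqS, image_update hpS,
        Function.update_self, Function.update_of_ne hpq]
      split_ifs <;> simp
    have hsum : #F * (d * n ^ 2) ≤ n * (n * ∑ x, G x) := by
      rw [← key]
      calc (#F : ℝ) * (d * n ^ 2) = ∑ x ∈ F, d * n ^ 2 := by simp
        _ ≤ ∑ x ∈ F, ∑ u : V, ∑ v : V, G (Function.update (Function.update x p u) q v) :=
          Finset.sum_le_sum hlow
        _ ≤ _ := by
          refine Finset.sum_le_sum_of_subset_of_nonneg (Finset.subset_univ _) ?_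
          intro x _ _
          refine Finset.sum_nonneg fun u _ => Finset.sum_nonneg fun v _ => ?_
          simp only [G]; split_ifs <;> norm_num
    have hG : ∑ x, G x ≤ #(realize E y ((p, q, S) :: es)) := by
      simp only [G, Finset.sum_boole]
      norm_cast
      refine Finset.card_le_card ?_
      intro x
      simp only [F, realize, Finset.mem_filter, Finset.mem_univ, true_and, List.mem_cons,
        forall_eq_or_imp]
      tauto
    have h2 : #F * d ≤ ∑ x, G x := by
      have : n ^ 2 * (#F * d) ≤ n ^ 2 * ∑ x, G x := by nlinarith
      exact le_of_mul_le_mul_left this (by positivity)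
    have h3 : (d ^ es.length * n ^ Fintype.card ι - es.length * #NI - #NI) * d ≤ #F * d := by
      gcongr
      linarith
    have h4 : (es.length * #NI + #NI : ℝ) * d ≤ es.length * #NI + #NI :=
      mul_le_of_le_one_right (by positivity) hd1
    rw [List.length_cons, pow_succ]
    push_cast
    nlinarith

/-- A fresh pattern occurs in a positive proportion of all tuples. -/
theorem exists_pattern_count (K : ℕ) {d : ℝ} (hd0 : 0 < d) (hd1 : d ≤ 1)
    (es : List (ι × ι × Finset (ι ⊕ κ))) (hes : Fresh K es) :
    ∃ c > (0 : ℝ), ∃ n₀ : ℕ, ∀ (V : Type) [Fintype V] [DecidableEq V], n₀ ≤ Fintype.card V →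
      ∀ E : Finset (Finset V),
      (∀ S : Finset V, #S = K → d * (Fintype.card V : ℝ) ^ 2 ≤ pairDeg E S) →
      ∀ y : κ → V, Function.Injective y →
      c * (Fintype.card V : ℝ) ^ Fintype.card ι ≤
        #{x ∈ realize E y es | Function.Injective (Sum.elim x y)} := by
  set C : ℕ := Fintype.card ι * (Fintype.card ι + Fintype.card κ)
  obtain ⟨n₀, hn₀⟩ := exists_nat_ge (2 * (es.length + 1) * C / d ^ es.length)
  refine ⟨d ^ es.length / 2, by positivity, n₀ + 1, ?_⟩
  intro V _ _ hV E hE y hy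
  have h1 := card_realize (y := y) hd0 hd1 (by omega) hE hes
  have h2 := card_not_injective (ι := ι) y hy
  set NI : Finset (ι → V) := {x : ι → V | ¬ Function.Injective (Sum.elim x y)}
  set n : ℝ := (Fintype.card V : ℝ)
  have hn : (n₀ : ℝ) + 1 ≤ n := by
    have : ((n₀ + 1 : ℕ) : ℝ) ≤ (Fintype.card V : ℝ) := by exact_mod_cast hV
    simpa [n] using this
  have hn0 : 0 < n := by linarith [n₀.cast_nonneg (α := ℝ)]
  have h3 : (#(realize E y es) : ℝ) ≤
      #{x ∈ realize E y es | Function.Injective (Sum.elim x y)} + #NI := by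
    norm_cast
    refine le_trans (Finset.card_le_card ?_) (Finset.card_union_le _ _)
    intro x hx
    simp only [NI, Finset.mem_union, Finset.mem_filter, Finset.mem_univ, true_and, hx]
    tauto
  have h4 : 2 * (es.length + 1) * C ≤ d ^ es.length * n := by
    rw [div_le_iff₀ (by positivity)] at hn₀
    nlinarith [pow_pos hd0 es.length]
  have h5 : (es.length + 1) * (#NI : ℝ) ≤ d ^ es.length / 2 * n ^ Fintype.card ι := by
    have : n * (2 * ((es.length + 1) * (#NI : ℝ))) ≤ n * (d ^ es.length * n ^ Fintype.card ι) := by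
      calc n * (2 * ((es.length + 1) * (#NI : ℝ))) = 2 * (es.length + 1) * (n * #NI) := by ring
        _ ≤ 2 * (es.length + 1) * (C * n ^ Fintype.card ι) := by gcongr
        _ = (2 * (es.length + 1) * C) * n ^ Fintype.card ι := by ring
        _ ≤ (d ^ es.length * n) * n ^ Fintype.card ι := by gcongr
        _ = _ := by ring
    have := le_of_mul_le_mul_left this hn0
    linarith
  linarith

end Counting

section Blowup

variable {ι V : Type*} [Fintype ι] [DecidableEq ι] [Fintype V] [DecidableEq V]

/-- Replace the coordinates in `s` by a choice among their copies. -/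
def mix {t : ℕ} (s : Finset ι) (x : ι → V) (y : ι → Fin t → V) (σ : ι → Fin t) : ι → V :=
  fun i => if i ∈ s then y i (σ i) else x i

theorem mix_empty {t : ℕ} (x : ι → V) (y : ι → Fin t → V) (σ : ι → Fin t) :
    mix ∅ x y σ = x := by
  funext i; simp [mix]

theorem mix_univ {t : ℕ} (x : ι → V) (y : ι → Fin t → V) (σ : ι → Fin t) :
    mix Finset.univ x y σ = fun i => y i (σ i) := by
  funext i; simp [mix]

/-- Indicator of the event that all choices of copies for coordinates in `s` lie in `F`. -/
noncomputable def mixInd {t : ℕ} (F : Finset (ι → V)) (s : Finset ι) (x : ι → V)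
    (y : ι → Fin t → V) : ℝ :=
  open Classical in if ∀ σ, mix s x y σ ∈ F then 1 else 0

theorem mixInd_nonneg {t : ℕ} (F : Finset (ι → V)) (s : Finset ι) (x : ι → V)
    (y : ι → Fin t → V) : 0 ≤ mixInd F s x y := by
  unfold mixInd; split_ifs <;> norm_num

theorem mixInd_insert {t : ℕ} (F : Finset (ι → V)) {s : Finset ι} {a : ι} (ha : a ∉ s)
    (x : ι → V) (y : ι → Fin t → V) (w : Fin t → V) :
    mixInd F (insert a s) x (Function.update y a w) =
      ∏ τ : Fin t, mixInd F s (Function.update x a (w τ)) y := by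
  have h : ∀ σ, mix (insert a s) x (Function.update y a w) σ =
      mix s (Function.update x a (w (σ a))) y σ := by
    intro σ
    funext i
    by_cases hi : i = a
    · subst hi; simp [mix, ha]
    · simp [mix, hi]
  have h2 : ∀ σ τ, mix s (Function.update x a (w τ)) y σ =
      mix s (Function.update x a (w τ)) y (Function.update σ a τ) := by
    intro σ τ
    funext i
    by_cases hi : i = a
    · subst hi; simp [mix, ha]
    · simp [mix, Function.update_of_ne hi]
  have h3 : (∀ σ, mix (insert a s) x (Function.update y a w) σ ∈ F) ↔
      ∀ τ σ, mix s (Function.update x a (w τ)) y σ ∈ F := by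
    constructor
    · intro H τ σ
      rw [h2]
      have := H (Function.update σ a τ)
      rwa [h, Function.update_self] at this
    · intro H σ
      rw [h]
      exact H _ _
  classical
  simp only [mixInd, h3]
  rw [Finset.prod_ite_zero]
  simp

theorem mixInd_step {t : ℕ} (F : Finset (ι → V)) {s : Finset ι} {a : ι} (ha : a ∉ s)
    (hV : 0 < Fintype.card V) (M : ℝ)
    (hM : M = (Fintype.card V : ℝ) ^ Fintype.card ι *
      ((Fintype.card V : ℝ) ^ (t + 1)) ^ Fintype.card ι) :
    ((∑ x : ι → V, ∑ y : ι → Fin (t + 1) → V, mixInd F s x y) / M) ^ (t + 1) ≤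
      (∑ x : ι → V, ∑ y : ι → Fin (t + 1) → V, mixInd F (insert a s) x y) / M := by
  set n : ℝ := (Fintype.card V : ℝ) with hn
  have hn0 : 0 < n := by simpa [n] using hV
  have hM0 : 0 < M := by rw [hM]; positivity
  set A := ∑ x : ι → V, ∑ y : ι → Fin (t + 1) → V, mixInd F s x y
  set B := ∑ x : ι → V, ∑ y : ι → Fin (t + 1) → V, mixInd F (insert a s) x y
  let h : (ι → V) × (ι → Fin (t + 1) → V) → ℝ :=
    fun p => ∑ w : V, mixInd F s (Function.update p.1 a w) p.2
  have e1 : n ^ (t + 1) * B = ∑ p, h p ^ (t + 1) := by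
    rw [Fintype.sum_prod_type, Finset.mul_sum]
    refine Finset.sum_congr rfl fun x _ => ?_
    have := sum_update (fun y : ι → Fin (t + 1) → V => mixInd F (insert a s) x y) a
    rw [Fintype.card_fun, Fintype.card_fin] at this
    push_cast at this
    rw [← hn] at this
    rw [← this]
    refine Finset.sum_congr rfl fun y _ => ?_
    rw [Fintype.sum_pow]
    exact Finset.sum_congr rfl fun w _ => mixInd_insert F ha x y w
  have e2 : ∑ p, h p = n * A := by
    rw [Fintype.sum_prod_type_right]
    simp only [h, A]
    rw [Finset.sum_comm (s := (Finset.univ : Finset (ι → V))), Finset.mul_sum]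
    exact Finset.sum_congr rfl fun y _ => sum_update (fun x => mixInd F s x y) a
  have j := pow_sum_div_card_le_sum_pow (s := Finset.univ) (f := h) (n := t)
    (fun p _ => Finset.sum_nonneg fun w _ => mixInd_nonneg _ _ _ _)
  have hc : ((#(Finset.univ : Finset ((ι → V) × (ι → Fin (t + 1) → V))) : ℕ) : ℝ) = M := by
    rw [hM]; simp [Finset.card_univ, hn]
  rw [hc, e2, ← e1, mul_pow] at j
  have j2 : A ^ (t + 1) / M ^ t ≤ B := by
    rw [mul_div_assoc] at j
    exact le_of_mul_le_mul_left j (by positivity)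
  rw [div_pow, pow_succ M, ← div_div]
  gcongr

/-- A dense family of tuples contains many blow-ups. -/
theorem card_blowup {t : ℕ} (F : Finset (ι → V)) (hV : 0 < Fintype.card V) :
    (#F / (Fintype.card V : ℝ) ^ Fintype.card ι) ^ ((t + 1) ^ Fintype.card ι) *
      ((Fintype.card V : ℝ) ^ (t + 1)) ^ Fintype.card ι ≤
      #{y : ι → Fin (t + 1) → V | ∀ σ : ι → Fin (t + 1), (fun i => y i (σ i)) ∈ F} := by
  set n : ℝ := (Fintype.card V : ℝ) with hn
  have hn0 : 0 < n := by simpa [n] using hV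
  obtain ⟨M, hM⟩ : ∃ M, M = n ^ Fintype.card ι * (n ^ (t + 1)) ^ Fintype.card ι := ⟨_, rfl⟩
  have hM0 : 0 < M := by rw [hM]; positivity
  have key : ∀ s : Finset ι, (#F / n ^ Fintype.card ι) ^ ((t + 1) ^ #s) ≤
      (∑ x : ι → V, ∑ y : ι → Fin (t + 1) → V, mixInd F s x y) / M := by
    intro s
    induction s using Finset.induction_on with
    | empty =>
      have : ∑ x : ι → V, ∑ y : ι → Fin (t + 1) → V, mixInd F ∅ x y =
          #F * (n ^ (t + 1)) ^ Fintype.card ι := by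
        simp only [mixInd, mix_empty, forall_const]
        rw [Finset.sum_comm]
        simp [hn, mul_comm]
      rw [this, hM]
      simp only [Finset.card_empty, pow_zero, pow_one]
      rw [mul_div_mul_right _ _ (by positivity)]
    | insert a s ha ih =>
      refine le_trans ?_ (mixInd_step F ha hV M hM)
      rw [Finset.card_insert_of_notMem ha, pow_succ, pow_mul]
      gcongr
  have h := key Finset.univ
  have e : ∑ x : ι → V, ∑ y : ι → Fin (t + 1) → V, mixInd F Finset.univ x y =
      n ^ Fintype.card ι *
      #{y : ι → Fin (t + 1) → V | ∀ σ : ι → Fin (t + 1), (fun i => y i (σ i)) ∈ F} := by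
    simp only [mixInd, mix_univ]
    simp [hn]
  rw [e, hM, mul_div_mul_left _ _ (by positivity), le_div_iff₀ (by positivity)] at h
  simpa using h

/-- A dense family of tuples contains many blow-ups with pairwise distinct entries. -/
theorem exists_blowup_count (ι : Type) [Fintype ι] [DecidableEq ι] (t : ℕ) {c : ℝ} (hc : 0 < c) :
    ∃ c' > (0 : ℝ), ∃ n₀ : ℕ, ∀ (V : Type) [Fintype V] [DecidableEq V], n₀ ≤ Fintype.card V →
      ∀ F : Finset (ι → V), c * (Fintype.card V : ℝ) ^ Fintype.card ι ≤ #F →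
      c' * (Fintype.card V : ℝ) ^ (Fintype.card (ι × Fin (t + 1))) ≤
        #{y : ι × Fin (t + 1) → V | Function.Injective y ∧
          ∀ σ : ι → Fin (t + 1), (fun i => y (i, σ i)) ∈ F} := by
  set D := c ^ ((t + 1) ^ Fintype.card ι) with hD
  have hD0 : 0 < D := by positivity
  set C : ℕ := Fintype.card (ι × Fin (t + 1)) * (Fintype.card (ι × Fin (t + 1)) + 0)
  obtain ⟨n₀, hn₀⟩ := exists_nat_ge (2 * C / D)
  refine ⟨D / 2, by positivity, n₀ + 1, ?_⟩
  intro V _ _ hV F hF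
  have h1 := card_blowup (t := t) F (by omega)
  have h2 := card_not_injective (ι := ι × Fin (t + 1)) (V := V) (κ := Empty) Empty.elim
    (fun a => a.elim)
  simp only [Fintype.card_empty] at h2
  set n : ℝ := (Fintype.card V : ℝ)
  have hn : (n₀ : ℝ) + 1 ≤ n := by
    have : ((n₀ + 1 : ℕ) : ℝ) ≤ (Fintype.card V : ℝ) := by exact_mod_cast hV
    simpa [n] using this
  have hn0 : 0 < n := by linarith [n₀.cast_nonneg (α := ℝ)]
  set N := Fintype.card (ι × Fin (t + 1)) with hN
  have hN' : N = (t + 1) * Fintype.card ι := by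
    rw [hN, Fintype.card_prod, Fintype.card_fin, mul_comm]
  have h3 : D * n ^ N ≤ #{y : ι × Fin (t + 1) → V |
      ∀ σ : ι → Fin (t + 1), (fun i => y (i, σ i)) ∈ F} := by
    have e : #{y : ι × Fin (t + 1) → V | ∀ σ : ι → Fin (t + 1), (fun i => y (i, σ i)) ∈ F} =
        #{y : ι → Fin (t + 1) → V | ∀ σ : ι → Fin (t + 1), (fun i => y i (σ i)) ∈ F} := by
      refine Finset.card_equiv (Equiv.curry _ _ _) ?_
      intro y
      simp [Function.curry]
    rw [e]
    refine le_trans ?_ h1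
    rw [hN', ← pow_mul]
    rw [hD]
    gcongr
    rwa [le_div_iff₀ (by positivity)]
  set NI : Finset (ι × Fin (t + 1) → V) :=
    {x : ι × Fin (t + 1) → V | ¬ Function.Injective (Sum.elim x Empty.elim)}
  have h4 : (#{y : ι × Fin (t + 1) → V |
      ∀ σ : ι → Fin (t + 1), (fun i => y (i, σ i)) ∈ F} : ℝ) ≤
      #{y : ι × Fin (t + 1) → V | Function.Injective y ∧
          ∀ σ : ι → Fin (t + 1), (fun i => y (i, σ i)) ∈ F} + #NI := by
    norm_cast
    refine le_trans (Finset.card_le_card ?_) (Finset.card_union_le _ _)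
    intro x hx
    simp only [Finset.mem_filter, Finset.mem_univ, true_and] at hx
    simp only [NI, Finset.mem_union, Finset.mem_filter, Finset.mem_univ, true_and]
    by_cases hi : Function.Injective x
    · exact Or.inl ⟨hi, hx⟩
    · right
      intro hh
      exact hi (hh.comp Sum.inl_injective)
  have h5 : (#NI : ℝ) ≤ D / 2 * n ^ N := by
    have h6 : 2 * C ≤ D * n := by
      rw [div_le_iff₀ (by positivity)] at hn₀
      nlinarith
    have : n * (2 * (#NI : ℝ)) ≤ n * (D * n ^ N) := by
      calc n * (2 * (#NI : ℝ)) = 2 * (n * #NI) := by ring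
        _ ≤ 2 * (C * n ^ N) := by gcongr
        _ = (2 * C) * n ^ N := by ring
        _ ≤ (D * n) * n ^ N := by gcongr
        _ = _ := by ring
    have := le_of_mul_le_mul_left this hn0
    linarith
  linarith

end Blowup

section Selection

variable {ι V : Type*} [Fintype ι] [DecidableEq ι] [Fintype V] [DecidableEq V]

theorem card_avoid {c : ℝ} (hV : 0 < Fintype.card V) (A : Finset (ι → V)) (W : Finset V)
    (hA : c * (Fintype.card V : ℝ) ^ Fintype.card ι ≤ #A)
    (hW : 2 * Fintype.card ι * #W ≤ c * Fintype.card V) :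
    c / 2 * (Fintype.card V : ℝ) ^ Fintype.card ι ≤ #{x ∈ A | ∀ i, x i ∉ W} := by
  have h := card_hits (ι := ι) W
  set n : ℝ := (Fintype.card V : ℝ)
  have hn0 : 0 < n := by simpa [n] using hV
  have h1 : (#A : ℝ) ≤ #{x ∈ A | ∀ i, x i ∉ W} + #{x : ι → V | ∃ i, x i ∈ W} := by
    norm_cast
    refine le_trans (Finset.card_le_card ?_) (Finset.card_union_le _ _)
    intro x hx
    simp only [Finset.mem_union, Finset.mem_filter, Finset.mem_univ, true_and, hx]
    by_cases h : ∃ i, x i ∈ W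
    · exact Or.inr h
    · push Not at h; exact Or.inl h
  have h2 : (#{x : ι → V | ∃ i, x i ∈ W} : ℝ) ≤ c / 2 * n ^ Fintype.card ι := by
    refine le_of_mul_le_mul_left (h.trans ?_) hn0
    calc _ ≤ (c * n / 2) * n ^ Fintype.card ι := by gcongr; linarith
      _ = _ := by ring
  linarith

theorem exists_avoid {c : ℝ} (hc : 0 < c) (hV : 0 < Fintype.card V) (A : Finset (ι → V))
    (W : Finset V) (hA : c * (Fintype.card V : ℝ) ^ Fintype.card ι ≤ #A)
    (hW : 2 * Fintype.card ι * #W ≤ c * Fintype.card V) : ∃ x ∈ A, ∀ i, x i ∉ W := by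
  have h := card_avoid hV A W hA hW
  have hV' : (0 : ℝ) < Fintype.card V := by exact_mod_cast hV
  have : (0 : ℝ) < #{x ∈ A | ∀ i, x i ∉ W} := lt_of_lt_of_le (by positivity) h
  obtain ⟨x, hx⟩ := Finset.card_pos.mp (by exact_mod_cast this)
  exact ⟨x, by simpa using hx⟩

/-- The set of all entries of the tuples in a list. -/
def support (L : List (ι → V)) : Finset V := L.toFinset.biUnion fun x => Finset.univ.image x

theorem mem_support {L : List (ι → V)} {v : V} : v ∈ support L ↔ ∃ x ∈ L, ∃ i, x i = v := by
  simp [support]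

theorem card_support (L : List (ι → V)) : #(support L) ≤ L.length * Fintype.card ι := by
  refine Finset.card_biUnion_le.trans ?_
  refine (Finset.sum_le_card_nsmul _ _ (Fintype.card ι) fun x _ =>
    Finset.card_image_le.trans (by simp)).trans ?_
  rw [smul_eq_mul]
  exact Nat.mul_le_mul_right _ (List.toFinset_card_le L)

theorem exists_greedy {Γ : Type*} [Fintype Γ] [Nonempty Γ] {c α : ℝ} (hc : 0 < c)
    (hα : α * Fintype.card ι ^ 2 * 4 ≤ c) (hV : 0 < Fintype.card V)
    (A : Γ → Finset (ι → V))
    (hA : ∀ γ, c * (Fintype.card V : ℝ) ^ Fintype.card ι ≤ #(A γ)) (W : Finset V)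
    (hW : 4 * Fintype.card ι * #W ≤ c * Fintype.card V) (j : ℕ)
    (hj : j ≤ α * Fintype.card V) :
    ∃ L : List (ι → V), L.length = j ∧ L.Pairwise (fun x y => ∀ i j, x i ≠ y j) ∧
      (∀ x ∈ L, ∀ i, x i ∉ W) ∧ (∀ x ∈ L, ∃ γ, x ∈ A γ) ∧
      ∑ γ, (1 / 2 : ℝ) ^ L.countP (· ∈ A γ) ≤ Fintype.card Γ * (1 - c / 4) ^ j := by
  set n : ℝ := (Fintype.card V : ℝ)
  have hn0 : 0 < n := by simpa [n] using hV
  have hs : (0 : ℝ) ≤ Fintype.card ι := by positivity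
  have hc1 : c ≤ 1 := by
    obtain ⟨γ⟩ := ‹Nonempty Γ›
    have h1 : (#(A γ) : ℝ) ≤ n ^ Fintype.card ι := by
      have := Finset.card_le_univ (A γ)
      rw [Fintype.card_fun] at this
      have h2 : (#(A γ) : ℝ) ≤ ((Fintype.card V ^ Fintype.card ι : ℕ) : ℝ) := by
        exact_mod_cast this
      simpa [n] using h2
    have := (hA γ).trans h1
    exact le_of_mul_le_mul_right (by linarith) (by positivity : 0 < n ^ Fintype.card ι)
  induction j with
  | zero => exact ⟨[], by simp⟩
  | succ j ih =>
    push_cast at hj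
    obtain ⟨L, hL, hP, hLW, hLA, hΦ⟩ := ih (by linarith)
    set W' := W ∪ support L
    have hW' : 2 * Fintype.card ι * #W' ≤ c * n := by
      have h1 : (#W' : ℝ) ≤ #W + j * Fintype.card ι := by
        have := (Finset.card_union_le W (support L)).trans
          (Nat.add_le_add_left (card_support L) _)
        rw [hL] at this
        exact_mod_cast this
      have h2 : (j : ℝ) * Fintype.card ι ^ 2 ≤ α * n * Fintype.card ι ^ 2 := by
        gcongr; linarith
      have h3 : 4 * (α * n * Fintype.card ι ^ 2) ≤ c * n := by
        calc _ = (α * Fintype.card ι ^ 2 * 4) * n := by ring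
          _ ≤ _ := by gcongr
      have h4 : 2 * Fintype.card ι * (#W' : ℝ) ≤
          2 * Fintype.card ι * (#W + j * Fintype.card ι) := by
        gcongr
      nlinarith
    set w : Γ → ℝ := fun γ => (1 / 2 : ℝ) ^ L.countP (· ∈ A γ)
    have hw : ∀ γ, 0 < w γ := fun γ => by positivity
    set A' : Γ → Finset (ι → V) := fun γ => {x ∈ A γ | ∀ i, x i ∉ W'}
    have hA' : ∀ γ, c / 2 * n ^ Fintype.card ι ≤ #(A' γ) := fun γ =>
      card_avoid hV _ _ (hA γ) hW'
    have avg : ∑ x : ι → V, c / 2 * ∑ γ, w γ ≤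
        ∑ x : ι → V, ∑ γ, if x ∈ A' γ then w γ else 0 := by
      rw [Finset.sum_comm]
      simp only [Finset.sum_ite_mem, Finset.sum_const, Finset.univ_inter, Finset.card_univ,
        Fintype.card_fun, nsmul_eq_mul, Finset.mul_sum]
      refine Finset.sum_le_sum fun γ _ => ?_
      have := mul_le_mul_of_nonneg_right (hA' γ) (hw γ).le
      push_cast
      refine le_trans (le_of_eq ?_) this
      simp only [n]; ring
    obtain ⟨x, -, hx⟩ := Finset.exists_le_of_sum_le
      (by rw [Finset.univ_nonempty_iff]; exact ⟨fun _ => Classical.choice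
        (Fintype.card_pos_iff.mp hV)⟩) avg
    have hpos : 0 < ∑ γ, w γ := Finset.sum_pos (fun γ _ => hw γ) Finset.univ_nonempty
    have hxA : ∃ γ, x ∈ A' γ := by
      by_contra hcon
      push Not at hcon
      simp only [hcon, if_false, Finset.sum_const_zero] at hx
      have : 0 < c / 2 * ∑ γ, w γ := by positivity
      linarith
    obtain ⟨γ₀, hγ₀⟩ := hxA
    simp only [A', Finset.mem_filter] at hγ₀
    refine ⟨x :: L, by simp [hL], ?_, ?_, ?_, ?_⟩
    · rw [List.pairwise_cons]
      refine ⟨fun y hy i j hij => hγ₀.2 i ?_, hP⟩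
      exact Finset.mem_union_right _ (mem_support.mpr ⟨y, hy, j, hij.symm⟩)
    · intro y hy
      rcases List.mem_cons.mp hy with rfl | hy
      · exact fun i hi => hγ₀.2 i (Finset.mem_union_left _ hi)
      · exact hLW y hy
    · intro y hy
      rcases List.mem_cons.mp hy with rfl | hy
      · exact ⟨γ₀, hγ₀.1⟩
      · exact hLA y hy
    · have h1 : ∑ γ, (1 / 2 : ℝ) ^ (x :: L).countP (· ∈ A γ) ≤
          ∑ γ, (w γ - 1 / 2 * if x ∈ A' γ then w γ else 0) := by
        refine Finset.sum_le_sum fun γ _ => ?_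
        rw [List.countP_cons]
        by_cases h : x ∈ A γ
        · simp only [h, decide_true, if_true, pow_succ]
          change w γ * (1 / 2) ≤ _
          split_ifs <;> linarith [hw γ]
        · have h' : x ∉ A' γ := fun hh => h (Finset.mem_filter.mp hh).1
          simp [h, h', w]
      refine h1.trans ?_
      rw [Finset.sum_sub_distrib, ← Finset.mul_sum, pow_succ]
      have : (1 - c / 4) * ∑ γ, w γ ≤ (1 - c / 4) * (Fintype.card Γ * (1 - c / 4) ^ j) := by
        gcongr
        linarith
      linarith

/-- If every member of a polynomially large index set has a positive proportion of all tuples,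
then a linear number of disjoint tuples serves every index linearly often. -/
theorem exists_selection (ι : Type) [Fintype ι] [DecidableEq ι] (D : ℕ) {c α : ℝ} (hc : 0 < c)
    (hα0 : 0 < α) (hα : α * Fintype.card ι ^ 2 * 4 ≤ c) :
    ∃ n₀ : ℕ, ∀ (V : Type) [Fintype V] [DecidableEq V], n₀ ≤ Fintype.card V →
      ∀ (Γ : Type) [Fintype Γ], (Fintype.card Γ : ℝ) ≤ (Fintype.card V : ℝ) ^ D →
      ∀ A : Γ → Finset (ι → V),
      (∀ γ, c * (Fintype.card V : ℝ) ^ Fintype.card ι ≤ #(A γ)) → ∀ W : Finset V,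
      4 * Fintype.card ι * #W ≤ c * Fintype.card V →
      ∃ L : List (ι → V), L.length ≤ α * Fintype.card V ∧
        L.Pairwise (fun x y => ∀ i j, x i ≠ y j) ∧
        (∀ x ∈ L, ∀ i, x i ∉ W) ∧ (∀ x ∈ L, ∃ γ, x ∈ A γ) ∧
        ∀ γ, c * α / 8 * Fintype.card V ≤ L.countP (· ∈ A γ) := by
  have hlim : Filter.Tendsto (fun n : ℕ => (n : ℝ) ^ D * Real.exp (-(c * α / 8 * n)))
      Filter.atTop (nhds 0) := by
    have hb : 0 < c * α / 8 := by positivity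
    have h1 := (Real.tendsto_pow_mul_exp_neg_atTop_nhds_zero D).comp
      ((tendsto_natCast_atTop_atTop (R := ℝ)).const_mul_atTop hb)
    have h2 := h1.const_mul ((c * α / 8)⁻¹ ^ D)
    rw [mul_zero] at h2
    refine h2.congr fun n => ?_
    simp only [Function.comp]
    rw [← mul_assoc, ← mul_pow, inv_mul_cancel_left₀ hb.ne']
  have hev := hlim.eventually (gt_mem_nhds (Real.exp_pos (-(c / 4))))
  obtain ⟨n₀, hn₀⟩ := Filter.eventually_atTop.mp hev
  refine ⟨n₀ + 1, ?_⟩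
  intro V _ _ hV Γ _ hΓ A hA W hW
  have hV0 : 0 < Fintype.card V := by omega
  rcases isEmpty_or_nonempty Γ with hE | hE
  · exact ⟨[], by simp; positivity⟩
  have hn0 : (0 : ℝ) < Fintype.card V := by exact_mod_cast hV0
  obtain ⟨L, h1, h2, h3, h4, h5⟩ := exists_greedy hc hα hV0 A hA W hW ⌊α * Fintype.card V⌋₊
    (Nat.floor_le (by positivity))
  refine ⟨L, ?_, h2, h3, h4, ?_⟩
  · rw [h1]; exact Nat.floor_le (by positivity)
  intro γ
  by_contra hcon
  push Not at hcon
  set n : ℝ := (Fintype.card V : ℝ)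
  have hfl : α * n - 1 < ⌊α * n⌋₊ := Nat.sub_one_lt_floor _
  have hlow : Real.exp (-(c * α / 8 * n)) ≤ (1 / 2 : ℝ) ^ L.countP (· ∈ A γ) := by
    calc Real.exp (-(c * α / 8 * n)) ≤ Real.exp (-(L.countP (· ∈ A γ) : ℝ)) := by
          rw [Real.exp_le_exp]; linarith
      _ = Real.exp (-1) ^ L.countP (· ∈ A γ) := by
          rw [← Real.exp_nat_mul]; ring_nf
      _ ≤ _ := by
          gcongr
          rw [Real.exp_neg, one_div]
          gcongr
          linarith [Real.add_one_le_exp 1]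
  have hc4 : (1 - c / 4) ≤ Real.exp (-(c / 4)) := by
    linarith [Real.add_one_le_exp (-(c / 4))]
  have hc1 : 0 ≤ 1 - c / 4 := by
    have h1 : (#(A γ) : ℝ) ≤ n ^ Fintype.card ι := by
      have := Finset.card_le_univ (A γ)
      rw [Fintype.card_fun] at this
      have h2 : (#(A γ) : ℝ) ≤ ((Fintype.card V ^ Fintype.card ι : ℕ) : ℝ) := by
        exact_mod_cast this
      simpa [n] using h2
    have := (hA γ).trans h1
    have := le_of_mul_le_mul_right (a := n ^ Fintype.card ι) (b := c) (c := 1) (by linarith)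
      (by positivity)
    linarith
  have hup : (1 / 2 : ℝ) ^ L.countP (· ∈ A γ) ≤
      n ^ D * (Real.exp (-(c * α / 4 * n)) * Real.exp (c / 4)) := by
    calc (1 / 2 : ℝ) ^ L.countP (· ∈ A γ) ≤ ∑ γ, (1 / 2 : ℝ) ^ L.countP (· ∈ A γ) :=
          Finset.single_le_sum (f := fun γ => (1 / 2 : ℝ) ^ L.countP (· ∈ A γ))
            (fun _ _ => by positivity) (Finset.mem_univ γ)
      _ ≤ _ := h5
      _ ≤ n ^ D * Real.exp (-(c / 4)) ^ ⌊α * n⌋₊ := by gcongr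
      _ = n ^ D * Real.exp (-(c / 4) * ⌊α * n⌋₊) := by
          rw [← Real.exp_nat_mul]; ring_nf
      _ ≤ _ := by
          rw [← Real.exp_add]
          gcongr
          nlinarith
  have hfin := hn₀ (Fintype.card V) (by omega)
  have h6 : Real.exp (-(c * α / 4 * n)) =
      Real.exp (-(c * α / 8 * n)) * Real.exp (-(c * α / 8 * n)) := by
    rw [← Real.exp_add]; ring_nf
  rw [h6] at hup
  have h7 := hlow.trans hup
  have h8 : n ^ D * (Real.exp (-(c * α / 8 * n)) * Real.exp (-(c * α / 8 * n)) *
      Real.exp (c / 4)) < Real.exp (-(c * α / 8 * n)) := by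
    have hh : (n ^ D * Real.exp (-(c * α / 8 * n))) *
        (Real.exp (-(c * α / 8 * n)) * Real.exp (c / 4)) <
        Real.exp (-(c / 4)) * (Real.exp (-(c * α / 8 * n)) * Real.exp (c / 4)) := by
      gcongr
    have h9 : Real.exp (-(c / 4)) * Real.exp (c / 4) = 1 := by
      rw [← Real.exp_add]; simp
    calc _ = (n ^ D * Real.exp (-(c * α / 8 * n))) *
        (Real.exp (-(c * α / 8 * n)) * Real.exp (c / 4)) := by ring
      _ < _ := hh
      _ = Real.exp (-(c * α / 8 * n)) * (Real.exp (-(c / 4)) * Real.exp (c / 4)) := by ring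
      _ = _ := by rw [h9, mul_one]
  linarith

end Selection

section Patterns

variable {ι κ : Type} [Fintype ι] [DecidableEq ι] [Fintype κ] [DecidableEq κ]

/-- A list of prospective edges, each of which has two free coordinates that do not occur in the
later members of the list. -/
def FreshList (K : ℕ) : List (List (ι ⊕ κ)) → Prop
  | [] => True
  | L :: Ls => (L.Nodup ∧ L.length = K + 2 ∧
      ∃ p q : ι, p ≠ q ∧ Sum.inl p ∈ L ∧ Sum.inl q ∈ L ∧
        ∀ L' ∈ Ls, Sum.inl p ∉ L' ∧ Sum.inl q ∉ L') ∧ FreshList K Ls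

theorem FreshList.map_append {K : ℕ} {α : Type*} (f : α → List (ι ⊕ κ)) {is : List α}
    (his : is.Nodup) {Ls : List (List (ι ⊕ κ))} (hLs : FreshList K Ls)
    (hf : ∀ i, (f i).Nodup ∧ (f i).length = K + 2 ∧
      ∃ p q : ι, p ≠ q ∧ Sum.inl p ∈ f i ∧ Sum.inl q ∈ f i ∧
        (∀ L' ∈ Ls, Sum.inl p ∉ L' ∧ Sum.inl q ∉ L') ∧
        ∀ j, j ≠ i → Sum.inl p ∉ f j ∧ Sum.inl q ∉ f j) :
    FreshList K (is.map f ++ Ls) := by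
  induction is with
  | nil => simpa using hLs
  | cons i is ih =>
    rw [List.nodup_cons] at his
    obtain ⟨h1, h2, p, q, h3, h4, h5, h6, h7⟩ := hf i
    refine ⟨⟨h1, h2, p, q, h3, h4, h5, ?_⟩, ih his.2⟩
    intro L' hL'
    rcases List.mem_append.mp hL' with h | h
    · obtain ⟨j, hj, rfl⟩ := List.mem_map.mp h
      exact h7 j (fun hji => his.1 (hji ▸ hj))
    · exact h6 L' h

theorem FreshList.exists_fresh {K : ℕ} {Ls : List (List (ι ⊕ κ))} (h : FreshList K Ls) :
    ∃ es : List (ι × ι × Finset (ι ⊕ κ)), Fresh K es ∧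
      (∀ e ∈ es, ∃ L ∈ Ls, ∀ z ∈ insert (Sum.inl e.1) (insert (Sum.inl e.2.1) e.2.2), z ∈ L) ∧
      ∀ L ∈ Ls, ∃ e ∈ es, L.toFinset = insert (Sum.inl e.1) (insert (Sum.inl e.2.1) e.2.2) := by
  induction Ls with
  | nil => exact ⟨[], trivial, by simp, by simp⟩
  | cons L Ls ih =>
    obtain ⟨⟨hnd, hlen, p, q, hpq, hp, hq, hnew⟩, hLs⟩ := h
    obtain ⟨es, h1, h2, h3⟩ := ih hLs
    have hins : insert (Sum.inl p) (insert (Sum.inl q)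
        ((L.toFinset.erase (Sum.inl p)).erase (Sum.inl q))) = L.toFinset := by
      rw [Finset.insert_erase, Finset.insert_erase]
      · simpa using hp
      · simp [hq, hpq.symm]
    refine ⟨(p, q, (L.toFinset.erase (Sum.inl p)).erase (Sum.inl q)) :: es,
      ⟨hpq, ?_, by simp, by simp, ?_, h1⟩, ?_, ?_⟩
    · rw [Finset.card_erase_of_mem (by simp [hq, hpq.symm]),
        Finset.card_erase_of_mem (by simpa using hp), List.toFinset_card_of_nodup hnd]
      omega
    · intro e he
      obtain ⟨L', hL', hz⟩ := h2 e he
      obtain ⟨n1, n2⟩ := hnew L' hL'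
      simp only [Finset.mem_insert, forall_eq_or_imp] at hz
      refine ⟨?_, ?_, fun h => n1 (hz.2.2 _ h), ?_, ?_, fun h => n2 (hz.2.2 _ h)⟩
      · rintro rfl; exact n1 hz.1
      · rintro rfl; exact n1 hz.2.1
      · rintro rfl; exact n2 hz.1
      · rintro rfl; exact n2 hz.2.1
    · intro e he
      rcases List.mem_cons.mp he with rfl | he
      · refine ⟨L, by simp, ?_⟩
        rw [hins]
        simp
      · obtain ⟨L', hL', hz⟩ := h2 e he
        exact ⟨L', by simp [hL'], hz⟩
    · intro L' hL'
      rcases List.mem_cons.mp hL' with rfl | hL'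
      · exact ⟨_, List.mem_cons_self, hins.symm⟩
      · obtain ⟨e, he, h⟩ := h3 L' hL'
        exact ⟨e, List.mem_cons_of_mem _ he, h⟩

open Classical in
/-- A pattern given by a fresh list of edges occurs in a positive proportion of all tuples. -/
theorem FreshList.exists_count {K : ℕ} {d : ℝ} (hd0 : 0 < d) (hd1 : d ≤ 1)
    {Ls : List (List (ι ⊕ κ))} (h : FreshList K Ls) :
    ∃ c > (0 : ℝ), ∃ n₀ : ℕ, ∀ (V : Type) [Fintype V] [DecidableEq V], n₀ ≤ Fintype.card V →
      ∀ E : Finset (Finset V),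
      (∀ S : Finset V, #S = K → d * (Fintype.card V : ℝ) ^ 2 ≤ pairDeg E S) →
      ∀ y : κ → V, Function.Injective y →
      c * (Fintype.card V : ℝ) ^ Fintype.card ι ≤
        #{x : ι → V | Function.Injective (Sum.elim x y) ∧
          ∀ L ∈ Ls, (L.map (Sum.elim x y)).toFinset ∈ E} := by
  obtain ⟨es, h1, -, h3⟩ := h.exists_fresh
  obtain ⟨c, hc, n₀, H⟩ := exists_pattern_count K hd0 hd1 es h1
  refine ⟨c, hc, n₀, fun V _ _ hV E hE y hy => (H V hV E hE y hy).trans ?_⟩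
  norm_cast
  refine Finset.card_le_card ?_
  intro x hx
  simp only [Finset.mem_filter, realize, Finset.mem_univ, true_and] at hx ⊢
  refine ⟨hx.2, fun L hL => ?_⟩
  obtain ⟨e, he, hLe⟩ := h3 L hL
  have e1 : (L.map (Sum.elim x y)).toFinset = L.toFinset.image (Sum.elim x y) := by
    ext; simp
  rw [e1, hLe, Finset.image_insert, Finset.image_insert]
  exact hx.1 e he

end Patterns

section Absorbers

/-- The tuple `x`, listed along `pos`, is a path that can absorb `T`. -/
def IsAbsorber {V ι : Type*} [DecidableEq V] (E : Finset (Finset V)) (l m : ℕ) (pos : List ι)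
    (T : List V) (x : ι → V) : Prop :=
  Function.Injective x ∧ (∀ i, x i ∉ T) ∧ LPath E l m (pos.map x) ∧
    ∃ q, LPath E l m q ∧ q.Perm (pos.map x ++ T) ∧ q.take l = (pos.map x).take l ∧
      last l q = last l (pos.map x)

/-- Free coordinates of the absorber pattern. -/
abbrev AbsPos (h c : ℕ) : Type :=
  (Fin 2 × Fin (h + 1)) ⊕ (Fin 3 × Fin c) ⊕ (Fin 2 × Fin h) ⊕ Fin 5

/-- Roots of the absorber pattern. -/
abbrev AbsRoot (h c : ℕ) : Type := Fin h ⊕ Fin (c + 1) ⊕ Unit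

variable {h c : ℕ}

/-- The two end blocks of the absorber pattern. -/
def absEnd (u : Fin 2) : List (AbsPos h c ⊕ AbsRoot h c) :=
  List.ofFn fun i => Sum.inl (Sum.inl (u, i))

/-- The three filling blocks of the absorber pattern. -/
def absFill (u : Fin 3) : List (AbsPos h c ⊕ AbsRoot h c) :=
  List.ofFn fun i => Sum.inl (Sum.inr (Sum.inl (u, i)))

/-- The two kernel blocks of the absorber pattern. -/
def absKer (u : Fin 2) : List (AbsPos h c ⊕ AbsRoot h c) :=
  List.ofFn fun i => Sum.inl (Sum.inr (Sum.inr (Sum.inl (u, i))))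

/-- The five special coordinates of the absorber pattern. -/
def absPt (u : Fin 5) : AbsPos h c ⊕ AbsRoot h c :=
  Sum.inl (Sum.inr (Sum.inr (Sum.inr u)))

/-- The first block of roots. -/
def absT1 : List (AbsPos h c ⊕ AbsRoot h c) := List.ofFn fun i => Sum.inr (Sum.inl i)

/-- The second block of roots. -/
def absT2 : List (AbsPos h c ⊕ AbsRoot h c) := List.ofFn fun i => Sum.inr (Sum.inr (Sum.inl i))

/-- The last root. -/
def absT3 : AbsPos h c ⊕ AbsRoot h c := Sum.inr (Sum.inr (Sum.inr ()))

theorem absorber_fresh (hhc : 1 ≤ 2 * h + c) :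
    FreshList (2 * h + c + 1)
      [absKer 1 ++ [absPt 2] ++ absFill 2 ++ [absPt 3] ++ absEnd 1,
        absEnd 0 ++ absFill 0 ++ [absPt 0] ++ absKer 0 ++ [absPt 1],
        absKer 0 ++ [absPt 1] ++ [absPt 4] ++ absFill 1 ++ absKer 1 ++ [absPt 3],
        absT1 ++ [absPt 4] ++ [absT3] ++ absFill 1 ++ absKer 1 ++ [absPt 2],
        (absKer 0 ++ [absPt 0] ++ absT2 ++ absT1 ++ [absPt 4] :
          List (AbsPos h c ⊕ AbsRoot h c))] := by
  have two : (∃ i j : Fin (h + 1), i ≠ j) ∨ 0 < c := by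
    rcases Nat.eq_zero_or_pos h with h0 | h0
    · right; omega
    · left; exact ⟨0, ⟨1, by omega⟩, by simp [Fin.ext_iff]⟩
  refine ⟨⟨?_, ?_, ?_⟩, ⟨?_, ?_, ?_⟩, ⟨?_, ?_, ?_⟩, ⟨?_, ?_, ?_⟩, ⟨?_, ?_, ?_⟩, trivial⟩
  all_goals try
    simp [absEnd, absFill, absKer, absPt, absT1, absT2, absT3, List.nodup_append,
      List.nodup_ofFn, Function.Injective]
    done
  all_goals try
    simp only [absEnd, absFill, absKer, absPt, absT1, absT2, absT3, List.length_append,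
      List.length_ofFn, List.length_singleton]
    omega
  · rcases two with ⟨i, j, hij⟩ | hc
    · exact ⟨Sum.inl (1, i), Sum.inl (1, j), by simp [hij], by
        simp [absEnd, absFill, absKer, absPt, absT1, absT2, absT3]; tauto⟩
    · exact ⟨Sum.inl (1, 0), Sum.inr (Sum.inl (2, ⟨0, hc⟩)), by simp,
        by simp [absEnd, absFill, absKer, absPt, absT1, absT2, absT3]⟩
  · rcases two with ⟨i, j, hij⟩ | hc
    · exact ⟨Sum.inl (0, i), Sum.inl (0, j), by simp [hij], by
        simp [absEnd, absFill, absKer, absPt, absT1, absT2, absT3]; tauto⟩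
    · exact ⟨Sum.inl (0, 0), Sum.inr (Sum.inl (0, ⟨0, hc⟩)), by simp,
        by simp [absEnd, absFill, absKer, absPt, absT1, absT2, absT3]⟩
  · exact ⟨Sum.inr (Sum.inr (Sum.inr 1)), Sum.inr (Sum.inr (Sum.inr 3)), by simp,
      by simp [absFill, absKer, absPt, absT1, absT2, absT3]⟩
  · rcases Nat.eq_zero_or_pos h with h0 | h0
    · exact ⟨Sum.inr (Sum.inr (Sum.inr 2)), Sum.inr (Sum.inl (1, ⟨0, by omega⟩)), by simp,
        by simp [absFill, absKer, absPt, absT1, absT2, absT3]⟩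
    · exact ⟨Sum.inr (Sum.inr (Sum.inr 2)), Sum.inr (Sum.inr (Sum.inl (1, ⟨0, h0⟩))), by simp,
        by simp [absFill, absKer, absPt, absT1, absT2, absT3]⟩
  · exact ⟨Sum.inr (Sum.inr (Sum.inr 0)), Sum.inr (Sum.inr (Sum.inr 4)), by simp,
      by simp [absKer, absPt, absT1, absT2]⟩

/-- Two steps of a list along an `l`-path. -/
theorem lpath_of_edges {V : Type*} [DecidableEq V] {E : Finset (Finset V)} {l m : ℕ}
    {A B R : List V} (hA : A.length + B.length = m) (hB : (A ++ B ++ R.take l).toFinset ∈ E)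
    (hR : LPath E l m R) : LPath E l m (A ++ B ++ R) :=
  LPath.step (A ++ B) R (by rw [List.length_append, hA]) hB hR

theorem absorber_lists {V : Type*} [DecidableEq V] {E : Finset (Finset V)} {h c : ℕ}
    {P Q F0 F1 F2 K0 K1 T1 T2 : List V} {a a' b b' u t : V} (lE0 : P.length = h + 1)
    (lE1 : Q.length = h + 1) (lF0 : F0.length = c) (lF1 : F1.length = c) (lF2 : F2.length = c)
    (lK0 : K0.length = h) (lK1 : K1.length = h) (lT1 : T1.length = h) (lT2 : T2.length = c + 1)
    (h3 : (K1 ++ [b] ++ F2 ++ [b'] ++ Q).toFinset ∈ E)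
    (h1 : (P ++ F0 ++ [a] ++ K0 ++ [a']).toFinset ∈ E)
    (h2 : (K0 ++ [a'] ++ [u] ++ F1 ++ K1 ++ [b']).toFinset ∈ E)
    (hf2 : (T1 ++ [u] ++ [t] ++ F1 ++ K1 ++ [b]).toFinset ∈ E)
    (hf1 : (K0 ++ [a] ++ T2 ++ T1 ++ [u]).toFinset ∈ E) :
    LPath E (h + 1) (h + c + 2) (P ++ (F0 ++ [a]) ++ ((K0 ++ [a']) ++ ([u] ++ F1) ++
      ((K1 ++ [b']) ++ (F2 ++ [b]) ++ Q))) ∧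
    ∃ q, LPath E (h + 1) (h + c + 2) q ∧
      q.Perm ((P ++ (F0 ++ [a]) ++ ((K0 ++ [a']) ++ ([u] ++ F1) ++
        ((K1 ++ [b']) ++ (F2 ++ [b]) ++ Q))) ++ (T1 ++ T2 ++ [t])) ∧
      q.take (h + 1) = (P ++ (F0 ++ [a]) ++ ((K0 ++ [a']) ++ ([u] ++ F1) ++
        ((K1 ++ [b']) ++ (F2 ++ [b]) ++ Q))).take (h + 1) ∧
      last (h + 1) q = last (h + 1) (P ++ (F0 ++ [a]) ++ ((K0 ++ [a']) ++ ([u] ++ F1) ++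
        ((K1 ++ [b']) ++ (F2 ++ [b]) ++ Q))) := by
  have tk : ∀ (A : List V) (B : List V), A.length = h + 1 → (A ++ B).take (h + 1) = A :=
    fun A B hA => by rw [← hA, List.take_left]
  have lst : ∀ (A : List V) (B : List V), B.length = h + 1 → last (h + 1) (A ++ B) = B :=
    fun A B hB => by rw [last, List.length_append, hB, Nat.add_sub_cancel, List.drop_left]
  have lc : ∀ (A : List V) (v : V), A.length = h → (A ++ [v]).length = h + 1 :=
    fun A v hA => by rw [List.length_append, hA]; rfl
  have edge : ∀ {L L' : List V}, L'.toFinset = L.toFinset → L.toFinset ∈ E → L'.toFinset ∈ E :=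
    fun h hL => h ▸ hL
  refine ⟨?_, ?_⟩
  · refine lpath_of_edges (by simp only [List.length_append, List.length_singleton]; omega) ?_
      (lpath_of_edges (by simp only [List.length_append, List.length_singleton]; omega) ?_
        (lpath_of_edges (by simp only [List.length_append, List.length_singleton]; omega) ?_
          (LPath.base _ lE1)))
    · rw [List.append_assoc (K0 ++ _), tk _ _ (lc _ _ lK0)]
      exact edge (by simp only [List.toFinset_append]; ac_rfl) h1
    · rw [List.append_assoc (K1 ++ _), tk _ _ (lc _ _ lK1)]
      exact edge (by simp only [List.toFinset_append]; ac_rfl) h2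
    · rw [← lE1, List.take_length]
      exact edge (by simp only [List.toFinset_append]; ac_rfl) h3
  · refine ⟨P ++ (F0 ++ [a']) ++ ((K0 ++ [a]) ++ T2 ++ ((T1 ++ [u]) ++
      ([t] ++ F1) ++ ((K1 ++ [b]) ++ (F2 ++ [b']) ++ Q))), ?_, ?_, ?_, ?_⟩
    · refine lpath_of_edges (by simp only [List.length_append, List.length_singleton]; omega) ?_
        (lpath_of_edges (by simp only [List.length_append, List.length_singleton]; omega) ?_
          (lpath_of_edges (by simp only [List.length_append, List.length_singleton]; omega) ?_
            (lpath_of_edges (by simp only [List.length_append, List.length_singleton]; omega) ?_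
          (LPath.base _ lE1))))
      · rw [List.append_assoc (K0 ++ _), tk _ _ (lc _ _ lK0)]
        exact edge (by simp only [List.toFinset_append]; ac_rfl) h1
      · rw [List.append_assoc (T1 ++ _), tk _ _ (lc _ _ lT1)]
        exact edge (by simp only [List.toFinset_append]; ac_rfl) hf1
      · rw [List.append_assoc (K1 ++ _), tk _ _ (lc _ _ lK1)]
        exact edge (by simp only [List.toFinset_append]; ac_rfl) hf2
      · rw [← lE1, List.take_length]
        exact edge (by simp only [List.toFinset_append]; ac_rfl) h3
    · rw [List.perm_iff_count]
      intro v
      simp only [List.count_append]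
      ring
    · rw [List.append_assoc P, List.append_assoc P, tk _ _ lE0, tk _ _ lE0]
    · simp only [← List.append_assoc]
      rw [lst _ _ lE1, lst _ _ lE1]

open Classical in
/-- Every set of `m` vertices has a positive proportion of absorbers. -/
theorem exists_absorber_count (h c : ℕ) (hhc : 1 ≤ 2 * h + c) {d : ℝ} (hd0 : 0 < d)
    (hd1 : d ≤ 1) :
    ∃ (ι : Type) (_ : Fintype ι) (_ : DecidableEq ι) (pos : List ι), pos.Nodup ∧
    ∃ a > (0 : ℝ), ∃ n₀ : ℕ, ∀ (V : Type) [Fintype V] [DecidableEq V], n₀ ≤ Fintype.card V →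
      ∀ E : Finset (Finset V),
      (∀ S : Finset V, #S = 2 * h + c + 1 → d * (Fintype.card V : ℝ) ^ 2 ≤ pairDeg E S) →
      ∀ T : List V, T.Nodup → T.length = h + c + 2 →
      a * (Fintype.card V : ℝ) ^ Fintype.card ι ≤
        #{x : ι → V | IsAbsorber E (h + 1) (h + c + 2) pos T x} := by
  obtain ⟨a, ha, n₀, H⟩ := (absorber_fresh hhc).exists_count hd0 hd1
  let e0 : List (AbsPos h c) := List.ofFn fun i => Sum.inl (0, i)
  let e1 : List (AbsPos h c) := List.ofFn fun i => Sum.inl (1, i)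
  let f0 : List (AbsPos h c) := List.ofFn fun i => Sum.inr (Sum.inl (0, i))
  let f1 : List (AbsPos h c) := List.ofFn fun i => Sum.inr (Sum.inl (1, i))
  let f2 : List (AbsPos h c) := List.ofFn fun i => Sum.inr (Sum.inl (2, i))
  let k0 : List (AbsPos h c) := List.ofFn fun i => Sum.inr (Sum.inr (Sum.inl (0, i)))
  let k1 : List (AbsPos h c) := List.ofFn fun i => Sum.inr (Sum.inr (Sum.inl (1, i)))
  let pt : Fin 5 → AbsPos h c := fun u => Sum.inr (Sum.inr (Sum.inr u))
  refine ⟨AbsPos h c, inferInstance, inferInstance,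
    e0 ++ (f0 ++ [pt 0]) ++ ((k0 ++ [pt 1]) ++ ([pt 4] ++ f1) ++
      ((k1 ++ [pt 3]) ++ (f2 ++ [pt 2]) ++ e1)), ?_, a, ha, n₀, ?_⟩
  · simp [e0, e1, f0, f1, f2, k0, k1, pt, List.nodup_append, List.nodup_ofFn,
      Function.Injective]
    rintro - a (rfl | rfl) <;> decide
  intro V _ _ hV E hE T hT hTl
  let y : AbsRoot h c → V := Sum.elim (fun i => T[i.1])
    (Sum.elim (fun i => T[h + i.1]) (fun _ => T[h + c + 1]))
  have hy : Function.Injective y := by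
    have hTi : ∀ {i j : ℕ} (hi : i < T.length) (hj : j < T.length), T[i] = T[j] → i = j :=
      fun hi hj hij => (List.Nodup.getElem_inj_iff hT).mp hij
    rintro (i | i | i) (j | j | j) hij
    all_goals try rfl
    all_goals
      simp only [y, Sum.elim_inl, Sum.elim_inr] at hij
      have := hTi _ _ hij
      first
        | omega
        | (congr; apply Fin.ext; omega)
  refine (H V hV E hE y hy).trans ?_
  norm_cast
  refine Finset.card_le_card ?_
  intro x hx
  simp only [Finset.mem_filter, Finset.mem_univ, true_and, List.forall_mem_cons] at hx ⊢
  obtain ⟨hinj, h3, h1, h2, hf2, hf1, -⟩ := hx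
  have hxi : Function.Injective x := hinj.comp Sum.inl_injective
  obtain ⟨T1, hT1⟩ : ∃ T1 : List V, T1 = (absT1 (h := h) (c := c)).map (Sum.elim x y) := ⟨_, rfl⟩
  obtain ⟨T2, hT2⟩ : ∃ T2 : List V, T2 = (absT2 (h := h) (c := c)).map (Sum.elim x y) := ⟨_, rfl⟩
  obtain ⟨t, ht⟩ : ∃ t : V, t = Sum.elim x y (absT3 (h := h) (c := c)) := ⟨_, rfl⟩
  have hTT : T = T1 ++ T2 ++ [t] := by
    subst hT1 hT2 ht
    simp only [absT1, absT2, absT3, List.map_ofFn]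
    apply List.ext_getElem
    · simp only [List.length_append, List.length_ofFn, List.length_singleton]; omega
    · intro i h1 h2
      simp only [List.getElem_append, List.length_append, List.length_ofFn]
      split_ifs with h3 h4
      · simp [y]
      · simp only [List.getElem_ofFn, Function.comp, Sum.elim_inr, Sum.elim_inl, y]
        congr 1; omega
      · simp only [List.getElem_singleton, Sum.elim_inr, y]
        congr 1; omega
  have hE0 : (absEnd (h := h) (c := c) 0).map (Sum.elim x y) = e0.map x := by
    simp [absEnd, e0, List.map_ofFn, Function.comp_def]
  have hE1 : (absEnd (h := h) (c := c) 1).map (Sum.elim x y) = e1.map x := by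
    simp [absEnd, e1, List.map_ofFn, Function.comp_def]
  have hF0 : (absFill (h := h) (c := c) 0).map (Sum.elim x y) = f0.map x := by
    simp [absFill, f0, List.map_ofFn, Function.comp_def]
  have hF1 : (absFill (h := h) (c := c) 1).map (Sum.elim x y) = f1.map x := by
    simp [absFill, f1, List.map_ofFn, Function.comp_def]
  have hF2 : (absFill (h := h) (c := c) 2).map (Sum.elim x y) = f2.map x := by
    simp [absFill, f2, List.map_ofFn, Function.comp_def]
  have hK0 : (absKer (h := h) (c := c) 0).map (Sum.elim x y) = k0.map x := by
    simp [absKer, k0, List.map_ofFn, Function.comp_def]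
  have hK1 : (absKer (h := h) (c := c) 1).map (Sum.elim x y) = k1.map x := by
    simp [absKer, k1, List.map_ofFn, Function.comp_def]
  have hP : ∀ u, [absPt (h := h) (c := c) u].map (Sum.elim x y) = [x (pt u)] := fun u => rfl
  have hP3 : [absT3 (h := h) (c := c)].map (Sum.elim x y) = [t] := by rw [ht]; rfl
  simp only [List.map_append, hE0, hE1, hF0, hF1, hF2, hK0, hK1, hP, hP3, ← hT1, ← hT2]
    at h1 h2 h3 hf1 hf2
  have lE0 : (e0.map x).length = h + 1 := by simp [e0]
  have lE1 : (e1.map x).length = h + 1 := by simp [e1]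
  have lF0 : (f0.map x).length = c := by simp [f0]
  have lF1 : (f1.map x).length = c := by simp [f1]
  have lF2 : (f2.map x).length = c := by simp [f2]
  have lK0 : (k0.map x).length = h := by simp [k0]
  have lK1 : (k1.map x).length = h := by simp [k1]
  have lT1 : T1.length = h := by simp [hT1, absT1]
  have lT2 : T2.length = c + 1 := by simp [hT2, absT2]
  have hxT : ∀ i, x i ∉ T := by
    intro i hi
    rw [hTT, hT1, hT2, ht] at hi
    have : ∀ r, x i ≠ y r := fun r hr => by
      exact Sum.inl_ne_inr (@hinj (Sum.inl i) (Sum.inr r) hr)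
    simp only [List.mem_append, List.mem_map, List.mem_singleton, absT1, absT2, absT3,
      List.mem_ofFn] at hi
    rcases hi with (⟨_, ⟨r, rfl⟩, hr⟩ | ⟨_, ⟨r, rfl⟩, hr⟩) | hr
    · exact this (Sum.inl r) hr.symm
    · exact this (Sum.inr (Sum.inl r)) hr.symm
    · exact this (Sum.inr (Sum.inr ())) hr
  unfold IsAbsorber
  simp only [List.map_append, List.map_cons, List.map_nil]
  generalize e0.map x = P at *
  generalize e1.map x = Q at *
  generalize f0.map x = F0 at *
  generalize f1.map x = F1 at *
  generalize f2.map x = F2 at *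
  generalize k0.map x = K0 at *
  generalize k1.map x = K1 at *
  rw [hTT]
  exact ⟨hxi, hTT ▸ hxT, absorber_lists lE0 lE1 lF0 lF1 lF2 lK0 lK1 lT1 lT2 h3 h1 h2 hf2 hf1⟩

end Absorbers

section Copies

variable {ι V : Type*} [DecidableEq ι] [DecidableEq V]

/-- The `j`-th copies of the elements of a list. -/
def copies (t j : ℕ) (L : List ι) : List (ι × Fin (t + 1)) :=
  L.map fun p => (p, Fin.ofNat (t + 1) j)

theorem map_copies {t j : ℕ} (L : List ι) (z : ι × Fin (t + 1) → V) :
    (copies t j L).map z = L.map fun p => z (p, Fin.ofNat (t + 1) j) := by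
  simp [copies]

theorem zig_map {W : Type*} (f : V → W) (L I : ℕ → List V) (i T : ℕ) :
    (zig L I i T).map f = zig (fun j => (L j).map f) (fun j => (I j).map f) i T := by
  induction T generalizing i with
  | zero => rfl
  | succ T ih => simp [zig, ih]

theorem mem_zig {L I : ℕ → List V} {i T : ℕ} {v : V} (h : v ∈ zig L I i T) :
    ∃ j ≤ i + T, v ∈ L j ∨ v ∈ I j := by
  induction T generalizing i with
  | zero => exact ⟨i, le_rfl, Or.inl h⟩
  | succ T ih =>
    simp only [zig, List.mem_append] at h
    rcases h with (h | h) | h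
    · exact ⟨i, by omega, Or.inl h⟩
    · exact ⟨i, by omega, Or.inr h⟩
    · obtain ⟨j, hj, h⟩ := ih h
      exact ⟨j, by omega, h⟩

theorem exists_mixed {t : ℕ} {P : (ι → V) → Prop} {z : ι × Fin (t + 1) → V}
    (hz : ∀ σ : ι → Fin (t + 1), P fun i => z (i, σ i)) {L L' : List ι} (hL : L.Disjoint L')
    (j j' : ℕ) : ∃ x, P x ∧ L.map x = (copies t j L).map z ∧ L'.map x = (copies t j' L').map z := by
  refine ⟨_, hz fun i => if i ∈ L then Fin.ofNat (t + 1) j else Fin.ofNat (t + 1) j', ?_, ?_⟩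
  · rw [map_copies]
    refine List.map_congr_left fun p hp => ?_
    simp [hp]
  · rw [map_copies]
    refine List.map_congr_left fun p hp => ?_
    have : p ∉ L := fun h => hL h hp
    simp [this]

theorem blow_lpath {E : Finset (Finset V)} {l m t T : ℕ} {P : (ι → V) → Prop}
    {z : ι × Fin (t + 1) → V} (hz : ∀ σ : ι → Fin (t + 1), P fun i => z (i, σ i))
    {L I : ℕ → List ι} (hL : ∀ j, (L j).length = l) (hLI : ∀ j, (L j ++ I j).length = m)
    (hnd : ∀ j < T, (L j ++ I j ++ L (j + 1)).Nodup)
    (hE : ∀ j < T, ∀ x, P x → ((L j ++ I j ++ L (j + 1)).map x).toFinset ∈ E) :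
    LPath E l m ((zig (fun j => copies t j (L j)) (fun j => copies t j (I j)) 0 T).map z) := by
  rw [zig_map]
  refine zig_lpath _ _ _ _ ?_ ?_ ?_
  · intro j _ _
    simp [copies, hL]
  · intro j _ _
    have := hLI j
    simpa [copies] using this
  · intro j _ hj
    rw [Nat.zero_add] at hj
    obtain ⟨x, hx, h1, h2⟩ := exists_mixed hz (List.disjoint_of_nodup_append (hnd j hj)) j (j + 1)
    have := hE j hj x hx
    rw [List.map_append, h1, h2] at this
    rw [← List.map_append]
    have e : copies t j (L j) ++ copies t j (I j) = copies t j (L j ++ I j) := by simp [copies]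
    rwa [e]

theorem ofNat_inj {t i j : ℕ} (hi : i ≤ t) (hj : j ≤ t)
    (h : Fin.ofNat (t + 1) i = Fin.ofNat (t + 1) j) : i = j := by
  have := congrArg Fin.val h
  simp only [Fin.val_ofNat] at this
  rwa [Nat.mod_eq_of_lt (by omega), Nat.mod_eq_of_lt (by omega)] at this

theorem mem_copies {t j : ℕ} {L : List ι} {v : ι × Fin (t + 1)} :
    v ∈ copies t j L ↔ v.1 ∈ L ∧ v.2 = Fin.ofNat (t + 1) j := by
  rcases v with ⟨a, b⟩
  simp only [copies, List.mem_map, Prod.mk.injEq]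
  constructor
  · rintro ⟨p, hp, rfl, rfl⟩; exact ⟨hp, rfl⟩
  · rintro ⟨h1, h2⟩; exact ⟨a, h1, rfl, h2.symm⟩

theorem copies_nodup {t j : ℕ} {L : List ι} (h : L.Nodup) : (copies t j L).Nodup :=
  h.map fun _ _ hab => (Prod.mk.inj hab).1

theorem blow_nodup {t T : ℕ} (hT : T ≤ t) {L I : ℕ → List ι}
    (hnd : ∀ j < T, (L j ++ I j).Nodup) (hndT : (L T).Nodup) :
    (zig (fun j => copies t j (L j)) (fun j => copies t j (I j)) 0 T).Nodup := by
  have e : ∀ j, copies t j (L j) ++ copies t j (I j) = copies t j (L j ++ I j) := by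
    simp [copies]
  refine zig_nodup _ _ _ ?_ (copies_nodup hndT) ?_ ?_
  · intro j hj
    rw [e]
    exact copies_nodup (hnd j hj)
  · intro i j hij hj v hv hv'
    rw [e, mem_copies] at hv hv'
    have := ofNat_inj (by omega) (by omega) (hv.2.symm.trans hv'.2)
    omega
  · intro i hi v hv hv'
    rw [e, mem_copies] at hv
    rw [mem_copies] at hv'
    have := ofNat_inj (by omega) (by omega) (hv.2.symm.trans hv'.2)
    omega

end Copies

section Connectors

/-- The tuple `x`, listed along `pos`, connects `X` to `Y`. -/
def IsConnector {V ι : Type*} [DecidableEq V] (E : Finset (Finset V)) (l m : ℕ) (pos : List ι)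
    (X Y : List V) (x : ι → V) : Prop :=
  Function.Injective x ∧ (∀ i, x i ∉ X) ∧ (∀ i, x i ∉ Y) ∧ LPath E l m (X ++ pos.map x ++ Y)

/-- Free coordinates of the connector pattern. -/
abbrev ConPos (h c : ℕ) : Type :=
  (Fin 2 × Fin (h + 1)) ⊕ (Fin 2 × Fin (c + 1)) ⊕ (Fin (h + 1) × Fin (h + 1)) ⊕
    (Fin (h + 1) × Fin c)

/-- Roots of the connector pattern. -/
abbrev ConRoot (h : ℕ) : Type := Fin 2 × Fin (h + 1)

variable {h c : ℕ}

/-- The main blocks of the connector pattern. -/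
def conW (i : ℕ) : List (ConPos h c) :=
  List.ofFn fun j : Fin (h + 1) => Sum.inl (if j.1 < i then 1 else 0, j)

/-- The filling blocks at the two ends of the connector pattern. -/
def conZ (u : Fin 2) : List (ConPos h c) :=
  List.ofFn fun j : Fin (c + 1) => Sum.inr (Sum.inl (u, j))

/-- The intermediate blocks of the connector pattern. -/
def conD (i : Fin (h + 1)) : List (ConPos h c) :=
  List.ofFn fun j : Fin (h + 1) => Sum.inr (Sum.inr (Sum.inl (i, j)))

/-- The filling blocks of the connector pattern. -/
def conF (i : Fin (h + 1)) : List (ConPos h c) :=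
  List.ofFn fun j : Fin c => Sum.inr (Sum.inr (Sum.inr (i, j)))

/-- The root blocks of the connector pattern. -/
def conX (u : Fin 2) : List (ConPos h c ⊕ ConRoot h) :=
  List.ofFn fun j : Fin (h + 1) => Sum.inr (u, j)

/-- The inner edges of the connector pattern. -/
def conEdge (i : Fin (h + 1)) : List (ConPos h c) :=
  conW i ++ Sum.inl (1, i) :: conF i ++ conD i

theorem conEdge_nodup (i : Fin (h + 1)) : (conEdge (c := c) i).Nodup := by
  simp [conEdge, conW, conF, conD, List.nodup_append, List.nodup_ofFn, Function.Injective,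
    -List.ofFn_succ]
  intro j h1 h2
  subst h2
  simp at h1

theorem conEdge'_nodup (i : Fin (h + 1)) :
    (conD i ++ Sum.inl (0, i) :: conF i ++ conW (c := c) (i + 1)).Nodup := by
  simp [conW, conF, conD, List.nodup_append, List.nodup_ofFn, Function.Injective]
  intro j h1 h2
  subst h2
  omega

theorem conEdge'_toFinset (i : Fin (h + 1)) :
    (conD i ++ Sum.inl (0, i) :: conF i ++ conW (c := c) (i + 1)).toFinset =
      (conEdge i).toFinset := by
  ext v
  simp only [List.mem_toFinset, List.mem_append, conEdge, List.mem_cons]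
  have : (v = Sum.inl (0, i) ∨ v ∈ conW (c := c) (i + 1)) ↔
      (v = Sum.inl (1, i) ∨ v ∈ conW (c := c) i) := by
    rcases v with ⟨u, j⟩ | v
    · simp only [conW, List.mem_ofFn, Sum.inl.injEq, Prod.mk.injEq, exists_eq_right]
      have : u = 0 ∨ u = 1 := by omega
      rcases lt_trichotomy j i with h | h | h
      · have h1 : j.1 < i.1 := h
        have h2 : j.1 < i.1 + 1 := by omega
        have h3 : j ≠ i := h.ne
        simp [h1, h2, h3]
      · subst h
        simp
        tauto
      · have h1 : ¬ j.1 < i.1 := by have : i.1 < j.1 := h; omega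
        have h2 : ¬ j.1 < i.1 + 1 := by have : i.1 < j.1 := h; omega
        have h3 : j ≠ i := h.ne'
        simp [h1, h2, h3]
    · simp [conW]
  tauto

theorem connector_fresh (hhc : 1 ≤ 2 * h + c) :
    FreshList (2 * h + c + 1)
      ((List.finRange (h + 1)).map (fun i => (conEdge i).map Sum.inl) ++
        [(conW (h + 1)).map Sum.inl ++ (conZ 1).map Sum.inl ++ conX 1,
        (conX 0 ++ (conZ 0).map Sum.inl ++ (conW 0).map Sum.inl :
          List (ConPos h c ⊕ ConRoot h))]) := by
  have two : (∃ i j : Fin (h + 1), i ≠ j) ∨ 0 < c := by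
    rcases Nat.eq_zero_or_pos h with h0 | h0
    · right; omega
    · left; exact ⟨0, ⟨1, by omega⟩, by simp [Fin.ext_iff]⟩
  refine FreshList.map_append _ (List.nodup_finRange _) ⟨⟨?_, ?_, ?_⟩, ⟨?_, ?_, ?_⟩, trivial⟩ ?_
  · simp [conW, conZ, conX, List.nodup_append, List.nodup_ofFn, Function.Injective]
  · simp [conW, conZ, conX]; omega
  · exact ⟨Sum.inl (1, 0), Sum.inr (Sum.inl (1, 0)), by simp, by simp [conW],
      by simp only [conZ, List.mem_append, List.mem_map, List.mem_ofFn]; simp,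
      by simp [conX, conZ, conW, -List.ofFn_succ]⟩
  · simp [conW, conZ, conX, List.nodup_append, List.nodup_ofFn, Function.Injective]
  · simp [conW, conZ, conX]; omega
  · exact ⟨Sum.inl (0, 0), Sum.inr (Sum.inl (0, 0)), by simp, by simp [conW],
      by simp only [conZ, List.mem_append, List.mem_map, List.mem_ofFn]; simp, by simp⟩
  · intro i
    refine ⟨(conEdge_nodup i).map Sum.inl_injective, ?_, ?_⟩
    · simp [conEdge, conW, conF, conD]; omega
    · rcases two with ⟨a, b, hab⟩ | hc
      · refine ⟨Sum.inr (Sum.inr (Sum.inl (i, a))), Sum.inr (Sum.inr (Sum.inl (i, b))),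
          by simp [hab], ?_, ?_, ?_, ?_⟩
        · simp [conEdge, conD, -List.ofFn_succ]
        · simp [conEdge, conD, -List.ofFn_succ]
        · simp [conW, conZ, conX, -List.ofFn_succ]
        · intro j hj
          simp [conEdge, conW, conD, conF, hj, -List.ofFn_succ]
      · refine ⟨Sum.inr (Sum.inr (Sum.inl (i, 0))), Sum.inr (Sum.inr (Sum.inr (i, ⟨0, hc⟩))),
          by simp, ?_, ?_, ?_, ?_⟩
        · simp [conEdge, conD, -List.ofFn_succ]
        · simp [conEdge, conF, -List.ofFn_succ]
        · simp [conW, conZ, conX, -List.ofFn_succ]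
        · intro j hj
          simp [conEdge, conW, conD, conF, hj, -List.ofFn_succ]

/-- The blocks of the connector pattern. -/
def conL (j : ℕ) : List (ConPos h c) :=
  if j % 2 = 0 then conW (j / 2) else conD (Fin.ofNat (h + 1) (j / 2))

/-- The blocks between consecutive blocks of the connector pattern. -/
def conI (j : ℕ) : List (ConPos h c) :=
  Sum.inl (if j % 2 = 0 then 1 else 0, Fin.ofNat (h + 1) (j / 2)) ::
    conF (Fin.ofNat (h + 1) (j / 2))

theorem con_toFinset (j : ℕ) (hj : j < 2 * (h + 1)) :
    (conL (c := c) j ++ conI j ++ conL (j + 1) : List (ConPos h c)).Nodup ∧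
    (conL (c := c) j ++ conI j ++ conL (j + 1)).toFinset =
      (conEdge (Fin.ofNat (h + 1) (j / 2))).toFinset := by
  obtain ⟨i, hi⟩ : ∃ i : Fin (h + 1), Fin.ofNat (h + 1) (j / 2) = i := ⟨_, rfl⟩
  have hi2 : j / 2 = i.1 := by
    rw [← hi, Fin.val_ofNat, Nat.mod_eq_of_lt (by omega)]
  rcases Nat.mod_two_eq_zero_or_one j with h0 | h0
  · have h1 : (j + 1) % 2 = 1 := by omega
    have h2 : (j + 1) / 2 = j / 2 := by omega
    have e : (conL (c := c) j ++ conI j ++ conL (j + 1) : List (ConPos h c)) = conEdge i := by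
      simp only [conL, conI, h0, h1, h2, if_true, conEdge, hi2]
      simp
    rw [e, hi]
    exact ⟨conEdge_nodup i, rfl⟩
  · have h1 : (j + 1) % 2 = 0 := by omega
    have h2 : (j + 1) / 2 = i + 1 := by omega
    have e : (conL (c := c) j ++ conI j ++ conL (j + 1) : List (ConPos h c)) =
        conD i ++ Sum.inl (0, i) :: conF i ++ conW (c := c) (i + 1) := by
      simp only [conL, conI, h0, h1, h2, if_true, hi]
      simp
    rw [e, hi]
    exact ⟨conEdge'_nodup i, conEdge'_toFinset i⟩

theorem length_conL (j : ℕ) : (conL (h := h) (c := c) j).length = h + 1 := by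
  unfold conL
  split_ifs <;> simp [conW, conD, -List.ofFn_succ]

theorem not_mem_conZ_of_mem_conL {j : ℕ} {u : Fin 2} {p : ConPos h c}
    (hp : p ∈ conL j ∨ p ∈ conI j) : p ∉ conZ u := by
  rcases p with p | p | p
  · simp [conZ, -List.ofFn_succ]
  · exfalso
    revert hp
    simp only [conL, conI]
    split_ifs <;> simp [conW, conD, conF, -List.ofFn_succ]
  · simp [conZ, -List.ofFn_succ]

/-- The order in which a connector is traversed. -/
def conPos (h c : ℕ) : List (ConPos h c × Fin (2 * (h + 1) + 1)) :=
  copies _ 0 (conZ 0) ++ zig (fun j => copies _ j (conL j)) (fun j => copies _ j (conI j)) 0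
    (2 * (h + 1)) ++ copies _ 0 (conZ 1)

theorem conPos_nodup (h c : ℕ) : (conPos h c).Nodup := by
  have hz : ∀ u, (conZ (h := h) (c := c) u).Nodup := fun u => by
    simp [conZ, List.nodup_ofFn, Function.Injective, -List.ofFn_succ]
  have hL : ∀ j, (conL (h := h) (c := c) j).Nodup := fun j => by
    unfold conL
    split_ifs <;> simp [conW, conD, List.nodup_ofFn, Function.Injective, -List.ofFn_succ]
  have hd : ∀ u, ∀ v ∈ zig (fun j => copies (2 * (h + 1)) j (conL (h := h) (c := c) j))
      (fun j => copies _ j (conI j)) 0 (2 * (h + 1)), v ∉ copies _ 0 (conZ u) := by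
    intro u v hv hv'
    obtain ⟨j, -, hj⟩ := mem_zig hv
    rw [mem_copies] at hv'
    refine not_mem_conZ_of_mem_conL (j := j) ?_ hv'.1
    exact hj.imp (fun h => (mem_copies.mp h).1) (fun h => (mem_copies.mp h).1)
  unfold conPos
  rw [List.nodup_append', List.nodup_append']
  refine ⟨⟨copies_nodup (hz 0), ?_, ?_⟩, copies_nodup (hz 1), ?_⟩
  · exact blow_nodup le_rfl (fun j hj => (con_toFinset j hj).1.sublist (by simp)) (hL _)
  · intro v hv hv'
    exact hd 0 v hv' hv
  · intro v hv hv'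
    rcases List.mem_append.mp hv with hv | hv
    · rw [mem_copies] at hv hv'
      have h1 := hv.1
      have h2 := hv'.1
      simp only [conZ, List.mem_ofFn] at h1 h2
      obtain ⟨a, ha⟩ := h1
      obtain ⟨b, hb⟩ := h2
      rw [← hb] at ha
      simp at ha
    · exact hd 1 v hv hv'

open Classical in
/-- Any two disjoint ordered `(h + 1)`-tuples have a positive proportion of connectors. -/
theorem exists_connector_count (h c : ℕ) (hhc : 1 ≤ 2 * h + c) {d : ℝ} (hd0 : 0 < d)
    (hd1 : d ≤ 1) :
    ∃ (ι : Type) (_ : Fintype ι) (_ : DecidableEq ι) (pos : List ι), pos.Nodup ∧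
    ∃ a > (0 : ℝ), ∃ n₀ : ℕ, ∀ (V : Type) [Fintype V] [DecidableEq V], n₀ ≤ Fintype.card V →
      ∀ E : Finset (Finset V),
      (∀ S : Finset V, #S = 2 * h + c + 1 → d * (Fintype.card V : ℝ) ^ 2 ≤ pairDeg E S) →
      ∀ X Y : List V, X.length = h + 1 → Y.length = h + 1 → (X ++ Y).Nodup →
      a * (Fintype.card V : ℝ) ^ Fintype.card ι ≤
        #{x : ι → V | IsConnector E (h + 1) (h + c + 2) pos X Y x} := by
  obtain ⟨a, ha, n₁, H1⟩ := (connector_fresh hhc).exists_count hd0 hd1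
  obtain ⟨a', ha', n₂, H2⟩ := exists_blowup_count (ConPos h c) (2 * (h + 1)) ha
  refine ⟨_, inferInstance, inferInstance, conPos h c, conPos_nodup h c, a', ha', max n₁ n₂, ?_⟩
  intro V _ _ hV E hE X Y hX hY hXY
  obtain ⟨y, hyX, hyY, hy⟩ : ∃ y : ConRoot h → V, X = List.ofFn (fun j => y (0, j)) ∧
      Y = List.ofFn (fun j => y (1, j)) ∧ Function.Injective y := by
    refine ⟨fun r => if r.1 = 0 then X[r.2.1] else Y[r.2.1], ?_, ?_, ?_⟩
    · apply List.ext_getElem <;> simp [hX, -List.ofFn_succ]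
    · apply List.ext_getElem <;> simp [hY, -List.ofFn_succ]
    · rw [List.nodup_append] at hXY
      obtain ⟨h1, h2, h3⟩ := hXY
      have two : ∀ u : Fin 2, u = 0 ∨ u = 1 := by intro u; omega
      rintro ⟨u, i⟩ ⟨v, j⟩ hij
      rcases two u with rfl | rfl <;> rcases two v with rfl | rfl
      · simp only [if_true, h1.getElem_inj_iff] at hij
        rw [Fin.ext hij]
      · simp only [if_true, one_ne_zero, if_false] at hij
        exact absurd hij (h3 _ (List.getElem_mem _) _ (List.getElem_mem _))
      · simp only [if_true, one_ne_zero, if_false] at hij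
        exact absurd hij.symm (h3 _ (List.getElem_mem _) _ (List.getElem_mem _))
      · simp only [one_ne_zero, if_false, h2.getElem_inj_iff] at hij
        rw [Fin.ext hij]
  have h1 := H1 V (le_of_max_le_left hV) E hE y hy
  refine (H2 V (le_of_max_le_right hV) _ h1).trans ?_
  norm_cast
  refine Finset.card_le_card ?_
  intro z hz
  simp only [Finset.mem_filter, Finset.mem_univ, true_and] at hz ⊢
  obtain ⟨hinj, hz⟩ := hz
  have hne : ∀ i r, z i ≠ y r := fun i r hir =>
    Sum.inl_ne_inr (@(hz fun _ => i.2).1 (Sum.inl i.1) (Sum.inr r) hir)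
  have hrX : ∀ x : ConPos h c → V, (conX 0).map (Sum.elim x y) = X := by
    intro x; rw [hyX]; simp [conX, List.map_ofFn, Function.comp_def, -List.ofFn_succ]
  have hrY : ∀ x : ConPos h c → V, (conX 1).map (Sum.elim x y) = Y := by
    intro x; rw [hyY]; simp [conX, List.map_ofFn, Function.comp_def, -List.ofFn_succ]
  have hl : ∀ (x : ConPos h c → V) (L : List (ConPos h c)),
      (L.map Sum.inl).map (Sum.elim x y) = L.map x := by
    intro x L; simp
  refine ⟨hinj, ?_, ?_, ?_⟩
  · intro i hi
    rw [hyX, List.mem_ofFn] at hi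
    obtain ⟨j, hj⟩ := hi
    exact hne _ _ hj.symm
  · intro i hi
    rw [hyY, List.mem_ofFn] at hi
    obtain ⟨j, hj⟩ := hi
    exact hne _ _ hj.symm
  let P : (ConPos h c → V) → Prop := fun x => Function.Injective (Sum.elim x y) ∧
    ∀ L ∈ (List.finRange (h + 1)).map (fun i => (conEdge i).map Sum.inl) ++
      [(conW (h + 1)).map Sum.inl ++ (conZ 1).map Sum.inl ++ conX 1,
        conX 0 ++ (conZ 0).map Sum.inl ++ (conW 0).map Sum.inl],
      (L.map (Sum.elim x y)).toFinset ∈ E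
  replace hz : ∀ σ : ConPos h c → Fin (2 * (h + 1) + 1), P fun i => z (i, σ i) := hz
  have hM := blow_lpath (l := h + 1) (m := h + c + 2) (E := E) (T := 2 * (h + 1)) hz
    (L := conL (h := h) (c := c)) (I := conI) length_conL
    (fun j => by rw [List.length_append, length_conL]; simp [conI, conF]; omega)
    (fun j hj => (con_toFinset j hj).1) (by
      intro j hj x hx
      replace hx := hx.2
      have := hx ((conEdge (Fin.ofNat (h + 1) (j / 2))).map Sum.inl) (by
        refine List.mem_append_left _ (List.mem_map.mpr ⟨_, List.mem_finRange _, rfl⟩))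
      rw [hl] at this
      have e : ∀ L : List (ConPos h c), (L.map x).toFinset = L.toFinset.image x := by
        intro L; ext; simp
      rw [e] at this ⊢
      rwa [(con_toFinset j hj).2])
  have hdis : ∀ j (u : Fin 2), List.Disjoint (conZ u) (conL (h := h) (c := c) j) := by
    intro j u p hp hp'
    exact not_mem_conZ_of_mem_conL (Or.inl hp') hp
  have hT : conL (h := h) (c := c) (2 * (h + 1)) = conW (h + 1) := by
    simp [conL]
  have h0 : conL (h := h) (c := c) 0 = conW 0 := by
    simp [conL]
  obtain ⟨x, ⟨-, hx⟩, e1, e2⟩ := exists_mixed hz (hdis 0 0) 0 0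
  have E1 := hx (conX 0 ++ (conZ 0).map Sum.inl ++ (conW 0).map Sum.inl) (by simp)
  rw [List.map_append, List.map_append, hl, hl, hrX, e1, ← h0, e2] at E1
  clear e1 e2 hx x
  obtain ⟨x, ⟨-, hx⟩, e1, e2⟩ := exists_mixed hz (hdis (2 * (h + 1)) 1) 0 (2 * (h + 1))
  have E2 := hx ((conW (h + 1)).map Sum.inl ++ (conZ 1).map Sum.inl ++ conX 1) (by simp)
  rw [List.map_append, List.map_append, hl, hl, hrY, e1, ← hT, e2] at E2
  clear e1 e2 hx x
  have lZ : ∀ u, ((copies (2 * (h + 1)) 0 (conZ (h := h) (c := c) u)).map z).length = c + 1 := by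
    intro u; simp [copies, conZ, -List.ofFn_succ]
  have lL : ∀ j, ((copies (2 * (h + 1)) j (conL (h := h) (c := c) j)).map z).length = h + 1 := by
    intro u; simp [copies, length_conL]
  rw [conPos, List.map_append, List.map_append]
  have e : X ++ ((copies _ 0 (conZ 0)).map z ++ (zig (fun j => copies _ j (conL j))
      (fun j => copies _ j (conI j)) 0 (2 * (h + 1))).map z ++ (copies _ 0 (conZ 1)).map z) ++ Y =
      X ++ (copies _ 0 (conZ 0)).map z ++ ((zig (fun j => copies _ j (conL j))
      (fun j => copies _ j (conI j)) 0 (2 * (h + 1))).map z ++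
        ((copies _ 0 (conZ 1)).map z ++ Y)) := by simp
  rw [e]
  refine lpath_of_edges (by rw [hX, lZ]; omega) ?_ ?_
  · rw [List.take_append_of_le_length hM.le_length, zig_map, zig_take _ _ _ _ (lL _)]
    exact E1
  · rw [zig_eq, List.map_append, Nat.zero_add] at hM ⊢
    rw [← List.append_assoc]
    have := hM.glue (q := (copies _ 0 (conZ 1)).map z ++ Y) (lL _) (by
      rw [← List.append_assoc]
      refine lpath_of_edges (by rw [lL, lZ]; omega) ?_ (LPath.base _ hY)
      rwa [List.take_of_length_le hY.le])
    simpa only [List.append_assoc] using this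

end Connectors

section Matching

variable {α : Type*} [DecidableEq α] {R : α → α → Prop} [DecidableRel R]

/-- `M` is a matching of the relation `R` inside `A`. -/
def IsMatch (R : α → α → Prop) (A : Finset α) (M : List (α × α)) : Prop :=
  (∀ p ∈ M, R p.1 p.2 ∧ p.1 ∈ A ∧ p.2 ∈ A) ∧ (M.flatMap fun p => [p.1, p.2]).Nodup

theorem length_ends (M : List (α × α)) :
    (M.flatMap fun p => [p.1, p.2]).length = 2 * M.length := by
  induction M with
  | nil => rfl
  | cons p M ih => simp [List.flatMap_cons, ih]; ring

theorem IsMatch.cons {A : Finset α} {M : List (α × α)} (hM : IsMatch R A M) {a b : α}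
    (hab : R a b) (hne : a ≠ b) (ha : a ∈ A) (hb : b ∈ A)
    (ha' : a ∉ M.flatMap fun p => [p.1, p.2]) (hb' : b ∉ M.flatMap fun p => [p.1, p.2]) :
    IsMatch R A ((a, b) :: M) := by
  refine ⟨?_, ?_⟩
  · intro p hp
    rcases List.mem_cons.mp hp with rfl | hp
    · exact ⟨hab, ha, hb⟩
    · exact hM.1 p hp
  · rw [List.flatMap_cons]
    simp only [List.cons_append, List.nil_append, List.nodup_cons, List.mem_cons, not_or]
    exact ⟨⟨hne, ha'⟩, hb', hM.2⟩

theorem card_touch_le (hsymm : ∀ a b, R a b → R b a) (A S : Finset α) {Δ : ℕ}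
    (hΔ : ∀ v ∈ S, #{u ∈ A | R v u} ≤ Δ) :
    #{p ∈ A ×ˢ A | R p.1 p.2 ∧ (p.1 ∈ S ∨ p.2 ∈ S)} ≤ 2 * (#S * Δ) := by
  have h1 : #(S.biUnion fun v => ({u ∈ A | R v u} : Finset α).image fun u => (v, u)) ≤ #S * Δ :=
    Finset.card_biUnion_le_card_mul _ _ _ fun v hv => card_image_le.trans (hΔ v hv)
  have h2 : #(S.biUnion fun v => ({u ∈ A | R v u} : Finset α).image fun u => (u, v)) ≤ #S * Δ :=
    Finset.card_biUnion_le_card_mul _ _ _ fun v hv => card_image_le.trans (hΔ v hv)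
  have h3 := card_le_card (show ({p ∈ A ×ˢ A | R p.1 p.2 ∧ (p.1 ∈ S ∨ p.2 ∈ S)} : Finset _) ⊆
      (S.biUnion fun v => ({u ∈ A | R v u} : Finset α).image fun u => (v, u)) ∪
      (S.biUnion fun v => ({u ∈ A | R v u} : Finset α).image fun u => (u, v)) by
    rintro ⟨a, b⟩ hp
    simp only [mem_filter, mem_product, mem_union, mem_biUnion, mem_image, Prod.mk.injEq] at hp ⊢
    rcases hp.2.2 with h | h
    · exact Or.inl ⟨a, h, b, ⟨hp.1.2, hp.2.1⟩, rfl, rfl⟩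
    · exact Or.inr ⟨b, h, a, ⟨hp.1.1, hsymm _ _ hp.2.1⟩, rfl, rfl⟩)
  have h4 := card_union_le
    (S.biUnion fun v => ({u ∈ A | R v u} : Finset α).image fun u => (v, u))
    (S.biUnion fun v => ({u ∈ A | R v u} : Finset α).image fun u => (u, v))
  omega

theorem exists_match_of_degree_le (hsymm : ∀ a b, R a b → R b a) (hirr : ∀ a, ¬ R a a)
    (A : Finset α) {Δ N : ℕ} (hΔ : ∀ v ∈ A, #{u ∈ A | R v u} ≤ Δ)
    (hN : 4 * N * Δ < #{p ∈ A ×ˢ A | R p.1 p.2}) :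
    ∀ j ≤ N + 1, ∃ M, IsMatch R A M ∧ M.length = j := by
  intro j
  induction j with
  | zero => exact fun _ => ⟨[], ⟨by simp, by simp⟩, rfl⟩
  | succ j ih =>
    intro hj
    obtain ⟨M, hM, hMj⟩ := ih (by omega)
    set S := (M.flatMap fun p => [p.1, p.2]).toFinset with hS
    have hSA : ∀ v ∈ S, v ∈ A := by
      intro v hv
      simp only [hS, List.mem_toFinset, List.mem_flatMap] at hv
      obtain ⟨p, hp, hv⟩ := hv
      have := hM.1 p hp
      simp only [List.mem_cons, List.not_mem_nil, or_false] at hv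
      rcases hv with rfl | rfl
      exacts [this.2.1, this.2.2]
    have hScard : #S = 2 * j := by
      rw [hS, List.toFinset_card_of_nodup hM.2, length_ends, hMj]
    have h1 := card_touch_le hsymm A S fun v hv => hΔ v (hSA v hv)
    rw [hScard] at h1
    have h2 : 2 * (2 * j * Δ) ≤ 4 * N * Δ := by
      have : j ≤ N := by omega
      calc 2 * (2 * j * Δ) = 4 * j * Δ := by ring
        _ ≤ _ := by gcongr
    obtain ⟨p, hp, hp'⟩ := exists_mem_notMem_of_card_lt_card (h1.trans_lt (h2.trans_lt hN))
    simp only [mem_filter, mem_product, not_and, not_or] at hp hp'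
    have h3 := hp' hp.1 hp.2
    refine ⟨(p.1, p.2) :: M, hM.cons hp.2 ?_ hp.1.1 hp.1.2 ?_ ?_, by simp [hMj]⟩
    · intro h; exact hirr p.1 (by rw [← h] at hp; exact hp.2)
    · simpa [hS] using h3.1
    · simpa [hS] using h3.2

/-- A graph with sufficiently many edges has a matching of size `σ + 1`. -/
theorem exists_match (hsymm : ∀ a b, R a b → R b a) (hirr : ∀ a, ¬ R a a) (σ : ℕ) :
    ∀ A : Finset α, 5 * σ ≤ #A → 2 * σ * #A < #{p ∈ A ×ˢ A | R p.1 p.2} + σ * (σ + 1) →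
    ∃ M, IsMatch R A M ∧ M.length = σ + 1 := by
  induction σ with
  | zero =>
    intro A _ hA
    exact exists_match_of_degree_le hsymm hirr A (Δ := #A) (N := 0) (fun v _ => card_filter_le _ _)
      (by simpa using hA) 1 le_rfl
  | succ σ ih =>
    intro A h5 hA
    by_cases hdeg : ∃ v ∈ A, 2 * σ + 3 ≤ #{u ∈ A | R v u}
    · obtain ⟨v, hv, hdeg⟩ := hdeg
      have h1 : #(A.erase v) + 1 = #A := card_erase_add_one hv
      have h2 : #{u ∈ A | R v u} ≤ #(A.erase v) := by
        refine card_le_card fun u hu => ?_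
        rw [mem_filter] at hu
        refine mem_erase.mpr ⟨?_, hu.1⟩
        rintro rfl
        exact hirr _ hu.2
      have h3 := card_touch_le hsymm A {v} (Δ := #(A.erase v)) (by simpa using h2)
      have h4 : #{p ∈ A ×ˢ A | R p.1 p.2} ≤ #{p ∈ A.erase v ×ˢ A.erase v | R p.1 p.2} +
          #{p ∈ A ×ˢ A | R p.1 p.2 ∧ (p.1 ∈ ({v} : Finset α) ∨ p.2 ∈ ({v} : Finset α))} := by
        refine (card_le_card fun p hp => ?_).trans (card_union_le _ _)
        simp only [mem_filter, mem_product, mem_union, mem_singleton, mem_erase] at hp ⊢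
        tauto
      obtain ⟨M, hM, hMl⟩ := ih (A.erase v) (by omega) (by
        rw [card_singleton, one_mul] at h3
        rw [← h1] at hA
        nlinarith)
      have hM' : IsMatch R A M := ⟨fun p hp => by
        have := hM.1 p hp
        exact ⟨this.1, mem_of_mem_erase this.2.1, mem_of_mem_erase this.2.2⟩, hM.2⟩
      obtain ⟨u, hu, hu'⟩ := exists_mem_notMem_of_card_lt_card
        (s := (M.flatMap fun p => [p.1, p.2]).toFinset) (t := {u ∈ A | R v u}) (by
        rw [List.toFinset_card_of_nodup hM.2, length_ends, hMl]; omega)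
      rw [mem_filter] at hu
      refine ⟨(v, u) :: M, hM'.cons hu.2 ?_ hv hu.1 ?_ (by simpa using hu'), by simp [hMl]⟩
      · rintro rfl; exact hirr _ hu.2
      · intro h
        obtain ⟨p, hp, hvp⟩ := List.mem_flatMap.mp h
        have := hM.1 p hp
        simp only [List.mem_cons, List.not_mem_nil, or_false] at hvp
        rcases hvp with rfl | rfl
        · simp at this
        · simp at this
    · push Not at hdeg
      refine exists_match_of_degree_le hsymm hirr A (Δ := 2 * (σ + 1)) (N := σ + 1)
        (fun v hv => by have := hdeg v hv; omega) ?_ _ le_rfl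
      nlinarith [Nat.mul_le_mul_left (2 * (σ + 1)) h5]

end Matching

section Blocks

theorem IsMatch.exists_fun {α : Type*} [DecidableEq α] {R : α → α → Prop} {A : Finset α}
    {M : List (α × α)} (hM : IsMatch R A M) {N : ℕ} (hN : M.length = N) :
    ∃ f : Fin N → α × α, (∀ e, R (f e).1 (f e).2) ∧
      (∀ e e', (f e).1 = (f e').1 → e = e') ∧ (∀ e e', (f e).2 = (f e').2 → e = e') ∧
      ∀ e e', (f e).1 ≠ (f e').2 := by
  subst hN
  have hnd := List.nodup_flatMap.mp hM.2
  have h1 : ∀ e e' : Fin M.length, e ≠ e' →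
      List.Disjoint [M[e].1, M[e].2] [M[e'].1, M[e'].2] := by
    intro e e' hne
    rcases lt_or_gt_of_ne hne with h | h
    · exact (List.pairwise_iff_getElem.mp hnd.2) e e' e.2 e'.2 h
    · exact ((List.pairwise_iff_getElem.mp hnd.2) e' e e'.2 e.2 h).symm
  refine ⟨fun e => M[e], fun e => (hM.1 _ (List.getElem_mem _)).1, ?_, ?_, ?_⟩
  · intro e e' h
    by_contra hne
    exact h1 e e' hne (a := M[e].1) (by simp) (List.mem_cons.mpr (Or.inl h))
  · intro e e' h
    by_contra hne
    exact h1 e e' hne (a := M[e].2) (by simp) (List.mem_cons_of_mem _ (List.mem_singleton.mpr h))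
  · intro e e' h
    by_cases hne : e = e'
    · subst hne
      have := hnd.1 M[e] (List.getElem_mem _)
      simp at this
      exact this h
    · exact h1 e e' hne (a := M[e].1) (by simp) (List.mem_cons_of_mem _ (List.mem_singleton.mpr h))

variable {β V : Type*} [Fintype β] [DecidableEq β] [Fintype V] [DecidableEq V]

theorem sum_pair {r : ℕ} {i i' : Fin r} (hi : i ≠ i') (f : β → β → ℝ) :
    (Fintype.card β : ℝ) ^ 2 * ∑ J : Fin r → β, f (J i) (J i') =
      (Fintype.card β : ℝ) ^ r * ∑ u, ∑ v, f u v := by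
  have h1 := sum_update (fun J : Fin r → β => f (J i) (J i')) i
  have h2 := sum_update (fun J : Fin r → β => ∑ u, f u (J i')) i'
  simp only [Function.update_self, Function.update_of_ne hi.symm] at h1 h2
  rw [sum_const, card_univ, Fintype.card_fun, Fintype.card_fin, nsmul_eq_mul] at h2
  rw [sq, mul_assoc, ← h1, ← h2, sum_comm]
  push_cast
  rfl

/-- Two positions in different blocks that form an edge together with `S`. -/
def BlockRel {r s : ℕ} (E : Finset (Finset V)) (p : β × Fin s → V) (S : Finset V) (J : Fin r → β)
    (u v : Fin r × Fin s) : Prop :=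
  u.1 ≠ v.1 ∧ insert (p (J u.1, u.2)) (insert (p (J v.1, v.2)) S) ∈ E

instance {r s : ℕ} (E : Finset (Finset V)) (p : β × Fin s → V) (S : Finset V) (J : Fin r → β) :
    DecidableRel (BlockRel E p S J) := fun _ _ => by unfold BlockRel; infer_instance

theorem card_blockRel {r s : ℕ} (E : Finset (Finset V)) (p : β × Fin s → V) (S : Finset V)
    (J : Fin r → β) :
    (#{uv : (Fin r × Fin s) × (Fin r × Fin s) | BlockRel E p S J uv.1 uv.2} : ℝ) =
      ∑ i, ∑ i', if i = i' then 0 else ∑ q, ∑ q',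
        if insert (p (J i, q)) (insert (p (J i', q')) S) ∈ E then (1 : ℝ) else 0 := by
  rw [Finset.card_filter]
  push_cast
  simp only [BlockRel, Fintype.sum_prod_type]
  refine sum_congr rfl fun i _ => ?_
  rw [sum_comm]
  refine sum_congr rfl fun i' _ => ?_
  by_cases h : i = i'
  · simp [h]
  · simp [h]

theorem card_pairs_blocks {s : ℕ} (E : Finset (Finset V)) {p : β × Fin s → V}
    (hp : Function.Injective p) (S : Finset V) :
    (pairDeg E S : ℝ) ≤ (∑ j, ∑ j', ∑ q, ∑ q',
      if insert (p (j, q)) (insert (p (j', q')) S) ∈ E then (1 : ℝ) else 0) +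
      2 * (Fintype.card V - Fintype.card β * s) * Fintype.card V := by
  have e : (∑ j, ∑ j', ∑ q, ∑ q',
      if insert (p (j, q)) (insert (p (j', q')) S) ∈ E then (1 : ℝ) else 0) =
      #{z : (β × Fin s) × (β × Fin s) | insert (p z.1) (insert (p z.2) S) ∈ E} := by
    rw [Finset.card_filter]
    push_cast
    simp only [Fintype.sum_prod_type]
    refine sum_congr rfl fun i _ => ?_
    rw [sum_comm]
  have hP : #(univ.image p) = Fintype.card β * s := by
    rw [card_image_of_injective _ hp, card_univ, Fintype.card_prod, Fintype.card_fin]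
  have hPc : (#(univ.image p)ᶜ : ℝ) = Fintype.card V - Fintype.card β * s := by
    rw [card_compl, Nat.cast_sub (card_le_univ _), hP]; push_cast; rfl
  have h1 : pairDeg E S ≤ #{z : (β × Fin s) × (β × Fin s) |
      insert (p z.1) (insert (p z.2) S) ∈ E} +
      (#((univ.image p)ᶜ ×ˢ (univ : Finset V)) + #((univ : Finset V) ×ˢ (univ.image p)ᶜ)) := by
    have h2 := card_image_le (s := ({z : (β × Fin s) × (β × Fin s) |
      insert (p z.1) (insert (p z.2) S) ∈ E} : Finset _)) (f := fun z => (p z.1, p z.2))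
    refine le_trans ?_ (Nat.add_le_add h2 (card_union_le _ _))
    refine le_trans (card_le_card fun z hz => ?_) (card_union_le _ _)
    simp only [mem_filter, mem_univ, true_and] at hz
    simp only [mem_union, mem_image, mem_filter, mem_univ, true_and, mem_product, mem_compl,
      and_true]
    by_cases h1 : ∃ a, p a = z.1
    · by_cases h2 : ∃ a, p a = z.2
      · obtain ⟨a, ha⟩ := h1
        obtain ⟨b, hb⟩ := h2
        exact Or.inl ⟨(a, b), by simpa [ha, hb] using hz, by simp [ha, hb]⟩
      · exact Or.inr (Or.inr h2)
    · exact Or.inr (Or.inl h1)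
  rw [card_product, card_product, card_univ] at h1
  rw [e]
  have h2 : (pairDeg E S : ℝ) ≤ #{z : (β × Fin s) × (β × Fin s) |
      insert (p z.1) (insert (p z.2) S) ∈ E} +
      (#(univ.image p)ᶜ * Fintype.card V + Fintype.card V * #(univ.image p)ᶜ) := by
    exact_mod_cast h1
  rw [hPc] at h2
  linarith

/-- A positive proportion of the tuples of blocks span a dense graph. -/
theorem card_dense_tuples {r s : ℕ} {E : Finset (Finset V)} {p : β × Fin s → V}
    (hp : Function.Injective p) {S : Finset V} {τ γ : ℝ} (hτ0 : 0 ≤ τ) (hτ : τ ≤ 1)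
    (hγ : 0 < γ) (hγ1 : γ ≤ 1) (hr : 9 ≤ γ * r) (hβ : 0 < Fintype.card β) (hs : 0 < s)
    (hS : (τ + γ) * (Fintype.card V : ℝ) ^ 2 ≤ pairDeg E S)
    (hcov : (Fintype.card V : ℝ) - Fintype.card β * s ≤ γ / 4 * Fintype.card V) :
    γ / 12 * (Fintype.card β : ℝ) ^ r ≤
      #{J : Fin r → β | (τ + γ / 4) * (r * s : ℝ) ^ 2 ≤
        (#{uv : (Fin r × Fin s) × (Fin r × Fin s) | BlockRel E p S J uv.1 uv.2} : ℝ)} := by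
  set N : ℝ := (Fintype.card β : ℝ) with hN
  set n : ℝ := (Fintype.card V : ℝ) with hn
  have hN0 : 0 < N := Nat.cast_pos.mpr hβ
  have hs0 : (0 : ℝ) < s := by exact_mod_cast hs
  have hr0 : (0 : ℝ) < r := by
    by_contra h
    have : (r : ℝ) ≤ 0 := by linarith
    nlinarith
  let a : β → β → ℝ := fun j j' => ∑ q, ∑ q',
    if insert (p (j, q)) (insert (p (j', q')) S) ∈ E then (1 : ℝ) else 0
  let e : (Fin r → β) → ℝ := fun J =>
    (#{uv : (Fin r × Fin s) × (Fin r × Fin s) | BlockRel E p S J uv.1 uv.2} : ℝ)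
  have hNs : N * s ≤ n := by
    have := Fintype.card_le_of_injective p hp
    rw [Fintype.card_prod, Fintype.card_fin] at this
    rw [hN, hn]
    exact_mod_cast this
  have h1 : (τ + γ / 2) * (N * s) ^ 2 ≤ ∑ j, ∑ j', a j j' := by
    have h2 := card_pairs_blocks E hp S
    have h3 : 2 * (n - N * s) * n ≤ γ / 2 * n ^ 2 := by nlinarith
    have h4 : (N * s) ^ 2 ≤ n ^ 2 := by gcongr
    have h5 : (τ + γ / 2) * (N * s) ^ 2 ≤ (τ + γ / 2) * n ^ 2 := by gcongr
    have : (τ + γ) * n ^ 2 - γ / 2 * n ^ 2 = (τ + γ / 2) * n ^ 2 := by ring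
    linarith
  have h2 : N ^ 2 * ∑ J, e J = N ^ r * (r * (r - 1) * ∑ j, ∑ j', a j j') := by
    have : ∑ J, e J = ∑ i : Fin r, ∑ i' : Fin r,
        if i = i' then 0 else ∑ J : Fin r → β, a (J i) (J i') := by
      simp only [e, card_blockRel]
      rw [sum_comm]
      refine sum_congr rfl fun i _ => ?_
      rw [sum_comm]
      refine sum_congr rfl fun i' _ => ?_
      by_cases h : i = i'
      · simp [h]
      · simp [h, a]
    rw [this, mul_sum]
    have h3 : ∀ i : Fin r, N ^ 2 * ∑ i' : Fin r,
        (if i = i' then 0 else ∑ J : Fin r → β, a (J i) (J i')) =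
        (r - 1) * (N ^ r * ∑ j, ∑ j', a j j') := by
      intro i
      rw [mul_sum]
      have : ∀ i' : Fin r, N ^ 2 * (if i = i' then 0 else ∑ J : Fin r → β, a (J i) (J i')) =
          (N ^ r * ∑ j, ∑ j', a j j') - if i = i' then (N ^ r * ∑ j, ∑ j', a j j') else 0 := by
        intro i'
        by_cases h : i = i'
        · simp [h]
        · simp only [h, if_false, sub_zero]
          exact sum_pair h a
      simp only [this, sum_sub_distrib, sum_ite_eq, mem_univ, if_true, sum_const, card_univ,
        Fintype.card_fin, nsmul_eq_mul]
      ring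
    simp only [h3, sum_const, card_univ, Fintype.card_fin, nsmul_eq_mul]
    ring
  have h3 : (τ + γ / 3) * (r * s) ^ 2 * N ^ r ≤ ∑ J, e J := by
    have h4 : (τ + γ / 3) * r ^ 2 ≤ r * (r - 1) * (τ + γ / 2) := by
      have : (τ + γ / 3) * r ≤ (r - 1) * (τ + γ / 2) := by nlinarith
      nlinarith
    have hr1 : (1 : ℝ) ≤ r := by
      have : 0 < r := by exact_mod_cast hr0
      exact_mod_cast this
    have h5 : r * (r - 1) * ((τ + γ / 2) * (N * s) ^ 2) ≤
        r * (r - 1) * ∑ j, ∑ j', a j j' :=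
      mul_le_mul_of_nonneg_left h1 (mul_nonneg hr0.le (by linarith))
    have h6 : (τ + γ / 3) * r ^ 2 * (N * s) ^ 2 ≤ r * (r - 1) * (τ + γ / 2) * (N * s) ^ 2 := by
      gcongr
    have h7 : N ^ r * ((τ + γ / 3) * r ^ 2 * (N * s) ^ 2) ≤ N ^ 2 * ∑ J, e J := by
      rw [h2]
      refine mul_le_mul_of_nonneg_left ?_ (by positivity)
      linarith
    refine le_of_mul_le_mul_left (a := N ^ 2) ?_ (by positivity)
    calc _ = _ := by ring
      _ ≤ _ := h7
  have hup : ∀ J, e J ≤ (r * s) ^ 2 := by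
    intro J
    have := card_filter_le (univ : Finset ((Fin r × Fin s) × (Fin r × Fin s)))
      (fun uv => BlockRel E p S J uv.1 uv.2)
    rw [card_univ] at this
    simp only [Fintype.card_prod, Fintype.card_fin] at this
    have h : e J ≤ ((r * s * (r * s) : ℕ) : ℝ) := Nat.cast_le.mpr this
    push_cast at h
    rw [sq]
    exact h
  have h4 : ∑ J, e J ≤ ∑ J : Fin r → β, ((τ + γ / 4) * (r * s) ^ 2 +
      if (τ + γ / 4) * (r * s : ℝ) ^ 2 ≤ e J then (r * s : ℝ) ^ 2 else 0) := by
    refine sum_le_sum fun J _ => ?_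
    split_ifs with h
    · have := hup J
      have : 0 ≤ (τ + γ / 4) * (r * s : ℝ) ^ 2 := by positivity
      linarith [hup J]
    · push Not at h
      linarith
  rw [sum_add_distrib, sum_const, card_univ, Fintype.card_fun, Fintype.card_fin, nsmul_eq_mul,
    ← sum_filter, sum_const, nsmul_eq_mul] at h4
  push_cast at h4
  have h5 : (γ / 12 * N ^ r) * (r * s : ℝ) ^ 2 ≤
      #{J : Fin r → β | (τ + γ / 4) * (r * s : ℝ) ^ 2 ≤ e J} * (r * s : ℝ) ^ 2 := by
    have := h3.trans h4
    linarith
  exact le_of_mul_le_mul_right h5 (by positivity)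

end Blocks

section TilePath

/-- The classes of auxiliary vertices of a tile. -/
abbrev AuxPos (h c : ℕ) : Type := (Fin 2 × Fin h) ⊕ Fin (c + 1)

variable {h c : ℕ}

/-- The blocks of a tile. -/
def tileL (j : ℕ) : List (Fin 2 ⊕ AuxPos h c) :=
  Sum.inl (Fin.ofNat 2 j) :: List.ofFn fun q : Fin h => Sum.inr (Sum.inl (Fin.ofNat 2 j, q))

/-- The vertices of a tile between consecutive blocks. -/
def tileI : List (Fin 2 ⊕ AuxPos h c) := List.ofFn fun q : Fin (c + 1) => Sum.inr (Sum.inr q)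

/-- The order in which a tile is traversed. -/
def tileZig (h c T : ℕ) : List ((Fin 2 ⊕ AuxPos h c) × Fin (T + 1)) :=
  zig (fun j => copies T j (tileL j)) (fun j => copies T j tileI) 0 T

theorem tileL_ne (j : ℕ) : Fin.ofNat 2 (j + 1) ≠ Fin.ofNat 2 j := by
  simp only [ne_eq, Fin.ext_iff, Fin.val_ofNat]
  omega

theorem tile_nodup (j : ℕ) :
    (tileL j ++ tileI ++ tileL (j + 1) : List (Fin 2 ⊕ AuxPos h c)).Nodup := by
  have := tileL_ne j
  simp [tileL, tileI, List.nodup_append, List.nodup_ofFn, Function.Injective, -List.ofFn_succ,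
    this.symm, -Fin.ofNat_eq_cast]

theorem mem_tile (j : ℕ) (v : Fin 2 ⊕ AuxPos h c) :
    v ∈ (tileL j ++ tileI ++ tileL (j + 1) : List (Fin 2 ⊕ AuxPos h c)) := by
  have h2 : ∀ u : Fin 2, u = Fin.ofNat 2 j ∨ u = Fin.ofNat 2 (j + 1) := by
    intro u
    simp only [Fin.ext_iff, Fin.val_ofNat]
    omega
  rcases v with u | ⟨u, q⟩ | q
  · rcases h2 u with rfl | rfl <;> simp [tileL]
  · rcases h2 u with rfl | rfl <;> simp [tileL, -Fin.ofNat_eq_cast]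
  · simp [tileI, -List.ofFn_succ]

theorem tileZig_lpath {V : Type*} [DecidableEq V] {E : Finset (Finset V)} {T : ℕ}
    {z : (Fin 2 ⊕ AuxPos h c) × Fin (T + 1) → V}
    (hz : ∀ σ : Fin 2 ⊕ AuxPos h c → Fin (T + 1),
      insert (z (Sum.inl 0, σ (Sum.inl 0))) (insert (z (Sum.inl 1, σ (Sum.inl 1)))
        (univ.image fun κ => z (Sum.inr κ, σ (Sum.inr κ)))) ∈ E) :
    LPath E (h + 1) (h + c + 2) ((tileZig h c T).map z) := by
  let P : (Fin 2 ⊕ AuxPos h c → V) → Prop := fun x =>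
    insert (x (Sum.inl 0)) (insert (x (Sum.inl 1)) (univ.image fun κ => x (Sum.inr κ))) ∈ E
  have hz' : ∀ σ : Fin 2 ⊕ AuxPos h c → Fin (T + 1), P fun i => z (i, σ i) := hz
  refine blow_lpath hz' ?_ ?_ (fun j _ => tile_nodup j) ?_
  · intro j; simp [tileL]
  · intro j; simp [tileL, tileI, -List.ofFn_succ]; omega
  · intro j _ x hx
    convert hx using 1
    ext v
    simp only [List.mem_toFinset, List.mem_map, mem_insert, mem_image, mem_univ, true_and]
    constructor
    · rintro ⟨u | κ, -, rfl⟩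
      · have : u = 0 ∨ u = 1 := by omega
        rcases this with rfl | rfl <;> simp
      · exact Or.inr (Or.inr ⟨κ, rfl⟩)
    · rintro (rfl | rfl | ⟨κ, rfl⟩)
      · exact ⟨_, mem_tile j _, rfl⟩
      · exact ⟨_, mem_tile j _, rfl⟩
      · exact ⟨_, mem_tile j _, rfl⟩

theorem tileZig_nodup (T : ℕ) : (tileZig h c T).Nodup :=
  blow_nodup le_rfl (fun j _ => (tile_nodup j).sublist (by simp))
    ((tile_nodup T).sublist (by simp))

theorem length_tileZig (T : ℕ) : (tileZig h c T).length = (h + c + 2) * T + (h + 1) := by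
  unfold tileZig
  generalize 0 = i
  induction T generalizing i with
  | zero => simp [zig, copies, tileL]
  | succ T ih =>
    have : ∀ (T' : ℕ) (i : ℕ), (zig (fun j => copies T' j (tileL (h := h) (c := c) j))
        (fun j => copies T' j tileI) i T).length = (h + c + 2) * T + (h + 1) := by
      clear ih
      intro T'
      induction T with
      | zero => intro i; simp [zig, copies, tileL]
      | succ T ih =>
        intro i
        simp [zig, copies, tileL, tileI, -List.ofFn_succ] at ih ⊢
        rw [ih]
        ring
    simp [zig, copies, tileL, tileI, -List.ofFn_succ] at this ⊢
    rw [this]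
    ring

theorem mem_tileZig {T : ℕ} {u : Fin 2} {a : Fin (T + 1)}
    (hv : (Sum.inl u, a) ∈ tileZig h c T) : u = Fin.ofNat 2 a.1 := by
  obtain ⟨j, hj, hv⟩ := mem_zig hv
  rw [Nat.zero_add] at hj
  simp only [mem_copies] at hv
  rcases hv with ⟨h1, rfl⟩ | ⟨h1, -⟩
  · rw [Fin.val_ofNat, Nat.mod_eq_of_lt (by omega)]
    simpa [tileL, -Fin.ofNat_eq_cast] using h1
  · simp [tileI, -List.ofFn_succ] at h1

end TilePath

section Core

variable {β V : Type*} [Fintype β] [DecidableEq β] [Fintype V] [DecidableEq V]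

theorem exists_block_match {h c t r s : ℕ} (hhc : 1 ≤ 2 * h + c) (ht : 2 ≤ t) (hr : 0 < r)
    (hs : s + (c + 1) = 2 * (h + c + 2) * t) {γ : ℝ} (hγs : 4 ≤ γ * s)
    {E : Finset (Finset V)} {p : β × Fin s → V} {S : Finset V} {J : Fin r → β}
    (hJ : ((4 * ((h + c + 2 : ℕ) : ℝ) - 1) / (4 * ((h + c + 2 : ℕ) : ℝ) ^ 2) + γ / 4) *
      (r * s : ℝ) ^ 2 ≤
      (#{uv : (Fin r × Fin s) × (Fin r × Fin s) | BlockRel E p S J uv.1 uv.2} : ℝ)) :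
    ∃ f : Fin (r * t + 1) → (Fin r × Fin s) × (Fin r × Fin s),
      (∀ e, BlockRel E p S J (f e).1 (f e).2) ∧
      (∀ e e', (f e).1 = (f e').1 → e = e') ∧ (∀ e e', (f e).2 = (f e').2 → e = e') ∧
      ∀ e e', (f e).1 ≠ (f e').2 := by
  have h5 : 5 * t ≤ s := by
    have h6 : 6 * t + (c + 1) ≤ 2 * (h + c + 2) * t + t := by
      have e : 2 * (h + c + 2) * t + t = 4 * t + (2 * h + c) * t + (c + 1) * t := by ring
      have h7 : 1 * t ≤ (2 * h + c) * t := Nat.mul_le_mul_right _ hhc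
      have h8 : (c + 1) * 2 ≤ (c + 1) * t := Nat.mul_le_mul_left _ ht
      rcases Nat.eq_zero_or_pos c with rfl | hc
      · have : 2 * t ≤ (2 * h + 0) * t := Nat.mul_le_mul_right _ (by omega)
        omega
      · have h9 : (c + 1) * t = (c - 1) * t + 2 * t := by
          obtain ⟨d, rfl⟩ := Nat.exists_eq_add_of_le hc
          simp; ring
        have h10 : (c - 1) * 2 ≤ (c - 1) * t := Nat.mul_le_mul_left _ ht
        have h11 : c * t ≤ (2 * h + c) * t := Nat.mul_le_mul_right _ (by omega)
        have h12 : c * t = (c - 1) * t + t := by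
          obtain ⟨d, rfl⟩ := Nat.exists_eq_add_of_le hc
          simp; ring
        omega
    omega
  have hs0 : 0 < s := by omega
  obtain ⟨M, hM, hMl⟩ := exists_match (R := BlockRel E p S J)
    (fun a b hab => ⟨hab.1.symm, by rw [Finset.insert_comm]; exact hab.2⟩)
    (fun a ha => ha.1 rfl) (r * t) univ
    (by rw [card_univ, Fintype.card_prod, Fintype.card_fin, Fintype.card_fin]; nlinarith) (by
      have huniv : (univ ×ˢ univ : Finset ((Fin r × Fin s) × (Fin r × Fin s))) = univ := by simp
      rw [huniv, card_univ, Fintype.card_prod, Fintype.card_fin, Fintype.card_fin]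
      have hr' : (0 : ℝ) < r := by exact_mod_cast hr
      have ht' : (0 : ℝ) < t := by exact_mod_cast (by omega : 0 < t)
      have hs' : (s : ℝ) + (c + 1) = 2 * ((h + c + 2 : ℕ) : ℝ) * t := by exact_mod_cast hs
      have hs1 : (0 : ℝ) < s := by exact_mod_cast hs0
      have hcm : (c : ℝ) + 1 ≤ ((h + c + 2 : ℕ) : ℝ) := by
        push_cast
        linarith [h.cast_nonneg (α := ℝ)]
      have hm : (0 : ℝ) < ((h + c + 2 : ℕ) : ℝ) := by positivity
      generalize ((h + c + 2 : ℕ) : ℝ) = m at *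
      obtain ⟨b, hb⟩ : ∃ b : ℝ, 2 * m * b = 1 := ⟨1 / (2 * m), by field_simp⟩
      have hb0 : 0 < b := by
        by_contra hb'
        have : b ≤ 0 := by linarith
        nlinarith
      have hτ : (4 * m - 1) / (4 * m ^ 2) = 2 * b - b ^ 2 := by
        rw [div_eq_iff (by positivity)]
        have : b = 1 / (2 * m) := by field_simp; linarith
        rw [this]; field_simp; ring
      rw [hτ] at hJ
      have hx : (t : ℝ) - b * s = b * (c + 1) := by
        have : (t : ℝ) = (2 * m * b) * t := by rw [hb]; ring
        calc (t : ℝ) - b * s = b * (2 * m * t) - b * s := by rw [this]; ring_nf; nlinarith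
          _ = _ := by rw [← hs']; ring
      have hx1 : b * (c + 1) ≤ 1 / 2 := by nlinarith
      have hx0 : 0 ≤ b * (c + 1) := by positivity
      generalize b * ((c : ℝ) + 1) = x at *
      have hc0 := c.cast_nonneg (α := ℝ)
      have key : 2 * (t : ℝ) * s - t ^ 2 ≤ (2 * b - b ^ 2 + γ / 4) * s ^ 2 := by
        have ht2 : (t : ℝ) = b * s + x := by linarith
        rw [ht2]
        have h1 : 0 ≤ b * s * x := by positivity
        nlinarith [sq_nonneg x, mul_le_mul_of_nonneg_right hγs hs1.le,
          mul_le_mul_of_nonneg_right hx1 hs1.le]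
      have key2 : (2 * (r * t) * (r * s) : ℝ) ≤
          (2 * b - b ^ 2 + γ / 4) * (r * s) ^ 2 + (r * t) * (r * t) := by
        have : (r : ℝ) ^ 2 * (2 * t * s - t ^ 2) ≤ r ^ 2 * ((2 * b - b ^ 2 + γ / 4) * s ^ 2) := by
          gcongr
        nlinarith
      have key3 : ((2 * (r * t) * (r * s) : ℕ) : ℝ) <
          ((#{uv : (Fin r × Fin s) × (Fin r × Fin s) | BlockRel E p S J uv.1 uv.2} +
            r * t * (r * t + 1) : ℕ) : ℝ) := by
        push_cast
        have : (0 : ℝ) < r * t := by positivity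
        linarith
      exact_mod_cast key3)
  obtain ⟨f, hf⟩ := hM.exists_fun hMl
  exact ⟨f, hf⟩

end Core

section Tiles

variable {β V : Type*} [Fintype β] [DecidableEq β] [Fintype V] [DecidableEq V]

theorem tiles_of_blowup {h c t T w r s : ℕ} (hT : T + 1 = 2 * t)
    {f : Fin (w + 1) → (Fin r × Fin s) × (Fin r × Fin s)}
    (hf1 : ∀ e e', (f e).1 = (f e').1 → e = e') (hf2 : ∀ e e', (f e).2 = (f e').2 → e = e')
    (hf3 : ∀ e e', (f e).1 ≠ (f e').2) {E : Finset (Finset V)} {p : β × Fin s → V}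
    (hp : Function.Injective p) {Z : Finset V} (hZ : ∀ j, p j ∉ Z) (q₀ : Fin s) {ζ : Type*}
    {g : Fin (w + 1) × Fin (T + 1) → ζ} (hg : Function.Injective g)
    {b : Fin t → ζ} (hb : Function.Injective b)
    {y : (Fin r ⊕ AuxPos h c) × ζ → V} (hy : Function.Injective y)
    (hyF : ∀ σ : Fin r ⊕ AuxPos h c → ζ, ∃ J : Fin r → β,
      (∀ i, y (Sum.inl i, σ (Sum.inl i)) = p (J i, q₀)) ∧
      (∀ κ, y (Sum.inr κ, σ (Sum.inr κ)) ∈ Z) ∧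
      ∀ e, BlockRel E p (univ.image fun κ => y (Sum.inr κ, σ (Sum.inr κ))) J (f e).1 (f e).2) :
    ∃ Rel : Finset β, #Rel ≤ r * t ∧ ∃ Q : Fin (w + 1) → List V,
      (∀ e, LPath E (h + 1) (h + c + 2) (Q e) ∧ (Q e).length = (h + c + 2) * T + (h + 1) ∧
        (Q e).Nodup) ∧ (∀ e e', e ≠ e' → List.Disjoint (Q e) (Q e')) ∧
      ∀ e, ∀ v ∈ Q e, v ∈ Z ∨ ∃ j ∈ Rel, ∃ q, v = p (j, q) := by
  have hB : ∀ i a, ∃ j, y (Sum.inl i, a) = p (j, q₀) := fun i a => by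
    obtain ⟨J, hJ, -⟩ := hyF fun _ => a
    exact ⟨J i, hJ i⟩
  choose B hB using hB
  have hZ' : ∀ κ a, y (Sum.inr κ, a) ∈ Z := fun κ a => by
    obtain ⟨J, -, hJ, -⟩ := hyF fun _ => a
    exact hJ κ
  have hBinj : ∀ i a i' a', B i a = B i' a' → i = i' ∧ a = a' := by
    intro i a i' a' h
    have h1 : y (Sum.inl i, a) = y (Sum.inl i', a') := by rw [hB, hB, h]
    have := hy h1
    simpa using this
  let half : Fin (T + 1) → Fin t := fun a => ⟨a.1 / 2, by omega⟩
  let side : Fin (w + 1) → Fin 2 → Fin r × Fin s := fun e u => if u = 0 then (f e).1 else (f e).2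
  let z : Fin (w + 1) → (Fin 2 ⊕ AuxPos h c) × Fin (T + 1) → V := fun e x =>
    Sum.elim (fun u => p (B (side e u).1 (b (half x.2)), (side e u).2))
      (fun κ => y (Sum.inr κ, g (e, x.2))) x.1
  have hside : ∀ e u e' u', side e u = side e' u' → e = e' ∧ u = u' := by
    intro e u e' u' he
    have hu : ∀ u : Fin 2, u = 0 ∨ u = 1 := by omega
    rcases hu u with rfl | rfl <;> rcases hu u' with rfl | rfl <;> simp [side] at he ⊢
    · exact hf1 _ _ he
    · exact hf3 _ _ he
    · exact hf3 _ _ he.symm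
    · exact hf2 _ _ he
  have hz : ∀ e x e' x', x ∈ tileZig h c T → x' ∈ tileZig h c T → z e x = z e' x' →
      e = e' ∧ x = x' := by
    rintro e ⟨u | κ, a⟩ e' ⟨u' | κ', a'⟩ hx hx' he
    · have h1 := Prod.mk.inj (hp he)
      have h2 := hBinj _ _ _ _ h1.1
      have h3 := hside e u e' u' (Prod.ext h2.1 h1.2)
      have h4 := hb h2.2
      have h5 := mem_tileZig hx
      have h6 := mem_tileZig hx'
      have h7 : a.1 / 2 = a'.1 / 2 := congrArg Fin.val h4
      have h8 : a.1 % 2 = a'.1 % 2 := by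
        have := h5.symm.trans (h3.2.trans h6)
        simpa [Fin.ext_iff] using this
      refine ⟨h3.1, ?_⟩
      rw [h3.2, Fin.ext (by omega : a.1 = a'.1)]
    · have h1 : z e (Sum.inl u, a) ∈ Z := by rw [he]; exact hZ' _ _
      exact absurd h1 (hZ _)
    · have h1 : z e' (Sum.inl u', a') ∈ Z := by rw [← he]; exact hZ' _ _
      exact absurd h1 (hZ _)
    · have h1 := hy he
      simp only [Prod.mk.injEq, Sum.inr.injEq] at h1
      have h2 := Prod.mk.inj (hg h1.2)
      exact ⟨h2.1, by rw [h1.1, h2.2]⟩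
  refine ⟨univ.image fun ia : Fin r × Fin t => B ia.1 (b ia.2), ?_,
    fun e => (tileZig h c T).map (z e), ?_, ?_, ?_⟩
  · refine card_image_le.trans ?_
    simp
  · intro e
    refine ⟨tileZig_lpath ?_, by rw [List.length_map, length_tileZig], ?_⟩
    · intro σ
      have hne : (f e).1.1 ≠ (f e).2.1 := by
        obtain ⟨J, -, -, hJ⟩ := hyF fun _ => g (e, 0)
        exact (hJ e).1
      obtain ⟨J, hJ1, -, hJ3⟩ := hyF (Sum.elim
        (fun i => if i = (f e).1.1 then b (half (σ (Sum.inl 0))) else b (half (σ (Sum.inl 1))))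
        (fun κ => g (e, σ (Sum.inr κ))))
      have hJB : ∀ i, J i = B i (if i = (f e).1.1 then b (half (σ (Sum.inl 0)))
          else b (half (σ (Sum.inl 1)))) := by
        intro i
        have h1 := hJ1 i
        rw [hB] at h1
        exact (Prod.mk.inj (hp h1)).1.symm
      have h2 := (hJ3 e).2
      rw [hJB, hJB, if_pos rfl, if_neg hne.symm] at h2
      exact h2
    · refine List.Nodup.map_on ?_ (tileZig_nodup T)
      intro x hx x' hx' he
      exact (hz e x e x' hx hx' he).2
  · intro e e' hne v hv hv'
    rw [List.mem_map] at hv hv'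
    obtain ⟨x, hx, rfl⟩ := hv
    obtain ⟨x', hx', he⟩ := hv'
    exact hne (hz e' x' e x hx' hx he).1.symm
  · intro e v hv
    rw [List.mem_map] at hv
    obtain ⟨⟨u | κ, a⟩, hx, rfl⟩ := hv
    · exact Or.inr ⟨_, mem_image.mpr ⟨((side e u).1, half a), mem_univ _, rfl⟩, _, rfl⟩
    · exact Or.inl (hZ' _ _)

theorem card_injective_into (κ : Type*) [Fintype κ] [DecidableEq κ] (Z : Finset V) {x : ℝ}
    (hx0 : 0 ≤ x) (hx : x + Fintype.card κ ≤ #Z) :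
    x ^ Fintype.card κ ≤ #{S : κ → V | Function.Injective S ∧ ∀ i, S i ∈ Z} := by
  have h1 : Fintype.card (κ ↪ Z) ≤ #{S : κ → V | Function.Injective S ∧ ∀ i, S i ∈ Z} := by
    rw [← card_univ]
    refine card_le_card_of_injOn (fun φ i => (φ i : V)) ?_ ?_
    · intro φ _
      simp only [coe_filter, mem_univ, true_and, Set.mem_ofPred_eq]
      exact ⟨fun i j hij => φ.injective (Subtype.ext hij), fun i => (φ i).2⟩
    · intro φ _ ψ _ he
      ext i
      exact congrFun he i
  rw [Fintype.card_embedding_eq, Fintype.card_coe] at h1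
  have h2 := (Nat.pow_sub_le_descFactorial #Z (Fintype.card κ)).trans h1
  have h3 : ((#Z + 1 - Fintype.card κ : ℕ) : ℝ) ^ Fintype.card κ ≤
      #{S : κ → V | Function.Injective S ∧ ∀ i, S i ∈ Z} := by exact_mod_cast h2
  refine le_trans (pow_le_pow_left₀ hx0 ?_ _) h3
  have h4 : Fintype.card κ ≤ #Z := by
    have : (Fintype.card κ : ℝ) ≤ #Z := by linarith
    exact_mod_cast this
  rw [Nat.cast_sub (by omega)]
  push_cast
  linarith

open Classical in
theorem card_tile_patterns {h c t r s : ℕ} (hhc : 1 ≤ 2 * h + c) (ht : 2 ≤ t) (hr0 : 0 < r)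
    (hs0 : 0 < s) (hs : s + (c + 1) = 2 * (h + c + 2) * t) {γ δ : ℝ} (hγ : 0 < γ) (hγ1 : γ ≤ 1)
    (hγs : 4 ≤ γ * s) (hr : 9 ≤ γ * r) (hδ : 0 < δ)
    (hn0 : 0 < Fintype.card V) (hn : 2 * (Fintype.card (AuxPos h c) : ℝ) ≤ δ * Fintype.card V)
    {E : Finset (Finset V)}
    (hE : ∀ S : Finset V, #S = 2 * h + c + 1 →
      ((4 * ((h + c + 2 : ℕ) : ℝ) - 1) / (4 * ((h + c + 2 : ℕ) : ℝ) ^ 2) + γ) *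
        (Fintype.card V : ℝ) ^ 2 ≤ pairDeg E S)
    {p : β × Fin s → V} (hp : Function.Injective p) {Z : Finset V} (hZ : δ * Fintype.card V ≤ #Z)
    (hcov : (Fintype.card V : ℝ) - Fintype.card β * s ≤ γ / 4 * Fintype.card V) :
    ∃ f : Fin (r * t + 1) → (Fin r × Fin s) × (Fin r × Fin s),
      ((∀ e e', (f e).1 = (f e').1 → e = e') ∧ (∀ e e', (f e).2 = (f e').2 → e = e') ∧
        ∀ e e', (f e).1 ≠ (f e').2) ∧
      (δ / 2) ^ Fintype.card (AuxPos h c) * (γ / 12 * (1 / (2 * s)) ^ r) /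
          Fintype.card (Fin (r * t + 1) → (Fin r × Fin s) × (Fin r × Fin s)) *
          (Fintype.card V : ℝ) ^ Fintype.card (Fin r ⊕ AuxPos h c) ≤
        #{x : Fin r ⊕ AuxPos h c → V | ∃ J : Fin r → β,
          (∀ i, x (Sum.inl i) = p (J i, ⟨0, hs0⟩)) ∧ (∀ κ, x (Sum.inr κ) ∈ Z) ∧
          ∀ e, BlockRel E p (univ.image fun κ => x (Sum.inr κ)) J (f e).1 (f e).2} := by
  set n : ℝ := (Fintype.card V : ℝ) with hnn
  set N : ℝ := (Fintype.card β : ℝ) with hN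
  set K := Fintype.card (AuxPos h c) with hK
  set τ : ℝ := (4 * ((h + c + 2 : ℕ) : ℝ) - 1) / (4 * ((h + c + 2 : ℕ) : ℝ) ^ 2) with hτ
  have hK' : K = 2 * h + c + 1 := by simp [hK, AuxPos]; ring
  have hnpos : 0 < n := Nat.cast_pos.mpr hn0
  have hspos : (0 : ℝ) < s := Nat.cast_pos.mpr hs0
  have hNn : 1 / (2 * s) * n ≤ N := by
    have h1 : n / 2 ≤ N * s := by nlinarith
    rw [div_mul_eq_mul_div, div_le_iff₀ (by positivity)]
    linarith
  have hNpos : 0 < N := lt_of_lt_of_le (by positivity) hNn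
  have hβ : 0 < Fintype.card β := Nat.cast_pos.mp hNpos
  have hm2 : (2 : ℝ) ≤ ((h + c + 2 : ℕ) : ℝ) := by
    have : 2 ≤ h + c + 2 := by omega
    exact_mod_cast this
  have hτ0 : 0 ≤ τ := div_nonneg (by linarith) (by positivity)
  have hτ1 : τ ≤ 1 := by
    rw [hτ, div_le_one (by positivity)]
    nlinarith
  let D : (AuxPos h c → V) → Finset (Fin r → β) := fun S =>
    {J : Fin r → β | (τ + γ / 4) * (r * s : ℝ) ^ 2 ≤ (#{uv : (Fin r × Fin s) × (Fin r × Fin s) |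
      BlockRel E p (univ.image S) J uv.1 uv.2} : ℝ)}
  let 𝒮 : Finset (AuxPos h c → V) := {S | Function.Injective S ∧ ∀ i, S i ∈ Z}
  have h𝒮 : (δ / 2 * n) ^ K ≤ #𝒮 := by
    refine card_injective_into _ Z (by positivity) ?_
    linarith
  have hD : ∀ S ∈ 𝒮, γ / 12 * N ^ r ≤ #(D S) := by
    intro S hS
    have hS' := (mem_filter.mp hS).2
    refine card_dense_tuples hp hτ0 hτ1 hγ hγ1 hr hβ hs0 (hE _ ?_) hcov
    rw [card_image_of_injective _ hS'.1, card_univ, ← hK, hK']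
  have hG : (δ / 2 * n) ^ K * (γ / 12 * N ^ r) ≤ #(𝒮.sigma D) := by
    rw [card_sigma, Nat.cast_sum]
    calc _ ≤ (#𝒮 : ℝ) * (γ / 12 * N ^ r) := by gcongr
      _ ≤ _ := by
        rw [← nsmul_eq_mul]
        exact card_nsmul_le_sum _ _ _ hD
  have hf : ∀ x : (Σ _ : AuxPos h c → V, Fin r → β),
      ∃ f : Fin (r * t + 1) → (Fin r × Fin s) × (Fin r × Fin s), x ∈ 𝒮.sigma D →
      (∀ e, BlockRel E p (univ.image x.1) x.2 (f e).1 (f e).2) ∧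
      (∀ e e', (f e).1 = (f e').1 → e = e') ∧ (∀ e e', (f e).2 = (f e').2 → e = e') ∧
      ∀ e e', (f e).1 ≠ (f e').2 := by
    intro x
    by_cases hx : x ∈ 𝒮.sigma D
    · obtain ⟨f, hf⟩ := exists_block_match hhc ht hr0 hs hγs
        (mem_filter.mp (mem_sigma.mp hx).2).2
      exact ⟨f, fun _ => hf⟩
    · exact ⟨fun _ => ((⟨0, hr0⟩, ⟨0, hs0⟩), (⟨0, hr0⟩, ⟨0, hs0⟩)), fun h => absurd h hx⟩
  choose F hF using hf
  have hΦ : (univ : Finset (Fin (r * t + 1) → (Fin r × Fin s) × (Fin r × Fin s))).Nonempty :=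
    ⟨fun _ => ((⟨0, hr0⟩, ⟨0, hs0⟩), (⟨0, hr0⟩, ⟨0, hs0⟩)), mem_univ _⟩
  set C : ℝ :=
    ((Fintype.card (Fin (r * t + 1) → (Fin r × Fin s) × (Fin r × Fin s)) : ℕ) : ℝ) with hC
  have hCpos : 0 < C := Nat.cast_pos.mpr (by rw [← card_univ]; exact hΦ.card_pos)
  obtain ⟨f, -, hfib⟩ := exists_le_card_fiber_of_nsmul_le_card_of_maps_to
    (s := 𝒮.sigma D) (f := F) (M := ℝ) (b := (δ / 2 * n) ^ K * (γ / 12 * N ^ r) / C)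
    (fun a _ => mem_univ _) hΦ (by
      rw [nsmul_eq_mul, card_univ, ← hC, mul_div_cancel₀ _ hCpos.ne']
      exact hG)
  have hpos : 0 < (δ / 2 * n) ^ K * (γ / 12 * N ^ r) / C := by positivity
  have hne : 0 < #{x ∈ 𝒮.sigma D | F x = f} := Nat.cast_pos.mp (hpos.trans_le hfib)
  obtain ⟨x₀, hx₀⟩ := card_pos.mp hne
  rw [mem_filter] at hx₀
  refine ⟨f, hx₀.2 ▸ (hF x₀ hx₀.1).2, ?_⟩
  have hle : #{x ∈ 𝒮.sigma D | F x = f} ≤ #{x : Fin r ⊕ AuxPos h c → V | ∃ J : Fin r → β,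
          (∀ i, x (Sum.inl i) = p (J i, ⟨0, hs0⟩)) ∧ (∀ κ, x (Sum.inr κ) ∈ Z) ∧
          ∀ e, BlockRel E p (univ.image fun κ => x (Sum.inr κ)) J (f e).1 (f e).2} := by
    refine card_le_card_of_injOn
      (fun x => Sum.elim (fun i => p (x.2 i, ⟨0, hs0⟩)) x.1) ?_ ?_
    · intro x hx
      have hx' := mem_filter.mp hx
      have h1 := (mem_filter.mp (mem_sigma.mp hx'.1).1).2
      have h2 := (hF x hx'.1).1
      rw [hx'.2] at h2
      simp only [coe_filter, mem_univ, true_and, Set.mem_ofPred_eq]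
      exact ⟨x.2, fun i => rfl, h1.2, h2⟩
    · rintro ⟨S, J⟩ _ ⟨S', J'⟩ _ he
      have h1 : S = S' := funext fun κ => congrFun he (Sum.inr κ)
      have h2 : J = J' := funext fun i => by
        have := hp (congrFun he (Sum.inl i))
        exact (Prod.mk.inj this).1
      rw [h1, h2]
  refine le_trans ?_ (hfib.trans (Nat.cast_le.mpr hle))
  have hcard : Fintype.card (Fin r ⊕ AuxPos h c) = r + K := by
    rw [Fintype.card_sum, Fintype.card_fin]
  rw [hcard]
  calc _ = (δ / 2 * n) ^ K * (γ / 12 * (1 / (2 * s) * n) ^ r) / C := by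
        rw [mul_pow, mul_pow, pow_add]; ring
    _ ≤ _ := by gcongr

/-- If a family of disjoint blocks of size `s` covers almost everything and misses a linear-sized
set `Z`, then `w` of the blocks can be replaced by `w + 1` tiles. -/
theorem exists_more_tiles (h c : ℕ) (hhc : 1 ≤ 2 * h + c) {γ δ : ℝ} (hγ : 0 < γ) (hγ1 : γ ≤ 1)
    (hδ : 0 < δ) (s₀ : ℕ) :
    ∃ s : ℕ, s₀ ≤ s ∧ 0 < s ∧ ∃ w : ℕ, ∃ n₀ : ℕ, ∀ (V : Type) [Fintype V] [DecidableEq V],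
      n₀ ≤ Fintype.card V → ∀ E : Finset (Finset V),
      (∀ S : Finset V, #S = 2 * h + c + 1 →
        ((4 * ((h + c + 2 : ℕ) : ℝ) - 1) / (4 * ((h + c + 2 : ℕ) : ℝ) ^ 2) + γ) *
          (Fintype.card V : ℝ) ^ 2 ≤ pairDeg E S) →
      ∀ (β : Type) [Fintype β] [DecidableEq β] (p : β × Fin s → V), Function.Injective p →
      ∀ Z : Finset V, (∀ j, p j ∉ Z) → δ * Fintype.card V ≤ #Z →
      (Fintype.card V : ℝ) - Fintype.card β * s ≤ γ / 4 * Fintype.card V →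
      ∃ Rel : Finset β, #Rel ≤ w ∧ ∃ Q : Fin (w + 1) → List V,
        (∀ e, LPath E (h + 1) (h + c + 2) (Q e) ∧ (Q e).length = s ∧ (Q e).Nodup) ∧
        (∀ e e', e ≠ e' → List.Disjoint (Q e) (Q e')) ∧
        ∀ e, ∀ v ∈ Q e, v ∈ Z ∨ ∃ j ∈ Rel, ∃ q, v = p (j, q) := by
  obtain ⟨t₁, ht₁⟩ := exists_nat_ge (4 / γ)
  obtain ⟨r, hr⟩ := exists_nat_ge (9 / γ)
  set t := t₁ + s₀ + 2 with ht
  obtain ⟨T, hT⟩ : ∃ T, T + 1 = 2 * t := ⟨2 * t - 1, by omega⟩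
  set s := (h + c + 2) * T + (h + 1) with hs
  have hTs : T ≤ s := by
    have : 1 * T ≤ (h + c + 2) * T := Nat.mul_le_mul_right _ (by omega)
    omega
  have hs0 : 0 < s := by omega
  have hs' : s + (c + 1) = 2 * (h + c + 2) * t := by
    have : 2 * (h + c + 2) * t = (h + c + 2) * (T + 1) := by rw [hT]; ring
    rw [this, hs]; ring
  have hγr : 9 ≤ γ * r := by
    rw [div_le_iff₀ hγ] at hr; linarith
  have hγs : 4 ≤ γ * s := by
    rw [div_le_iff₀ hγ] at ht₁
    have : (t₁ : ℝ) ≤ s := by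
      have : t₁ ≤ s := by omega
      exact_mod_cast this
    nlinarith
  have hr0 : 0 < r := by
    rcases Nat.eq_zero_or_pos r with h0 | h0
    · subst h0; norm_num at hγr
    · exact h0
  have hΦ : 0 < Fintype.card (Fin (r * t + 1) → (Fin r × Fin s) × (Fin r × Fin s)) :=
    Fintype.card_pos_iff.mpr ⟨fun _ => ((⟨0, hr0⟩, ⟨0, hs0⟩), (⟨0, hr0⟩, ⟨0, hs0⟩))⟩
  have hΦ' := (Nat.cast_pos (α := ℝ)).mpr hΦ
  have hspos : (0 : ℝ) < s := Nat.cast_pos.mpr hs0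
  have ha : 0 < (δ / 2) ^ Fintype.card (AuxPos h c) * (γ / 12 * (1 / (2 * s)) ^ r) /
      Fintype.card (Fin (r * t + 1) → (Fin r × Fin s) × (Fin r × Fin s)) := by positivity
  set t' := (r * t + 1) * (T + 1) with ht'
  obtain ⟨c', hc', n₁, hn₁⟩ := exists_blowup_count (Fin r ⊕ AuxPos h c) t' ha
  obtain ⟨n₂, hn₂⟩ := exists_nat_ge (2 * (Fintype.card (AuxPos h c) : ℝ) / δ)
  refine ⟨s, by omega, hs0, r * t, n₁ + n₂ + 1, ?_⟩
  intro V _ _ hV E hE β _ _ p hp Z hpZ hZ hcov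
  have hV0 : 0 < Fintype.card V := by omega
  have hn : 2 * (Fintype.card (AuxPos h c) : ℝ) ≤ δ * Fintype.card V := by
    have h1 : (n₂ : ℝ) ≤ Fintype.card V := Nat.cast_le.mpr (by omega)
    rw [div_le_iff₀ hδ] at hn₂
    nlinarith
  obtain ⟨f, ⟨hf1, hf2, hf3⟩, hcard⟩ := card_tile_patterns hhc (by omega) hr0 hs0 hs' hγ hγ1 hγs
    hγr hδ hV0 hn hE hp hZ hcov
  have hy := hn₁ V (by omega) _ hcard
  have hpos : 0 < c' * (Fintype.card V : ℝ) ^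
      Fintype.card ((Fin r ⊕ AuxPos h c) × Fin (t' + 1)) := by
    have := (Nat.cast_pos (α := ℝ)).mpr hV0
    positivity
  obtain ⟨y, hy⟩ := card_pos.mp (Nat.cast_pos.mp (hpos.trans_le hy))
  obtain ⟨hyi, hyF⟩ := (mem_filter.mp hy).2
  obtain ⟨g⟩ := Function.Embedding.nonempty_of_card_le
    (α := Fin (r * t + 1) × Fin (T + 1)) (β := Fin (t' + 1)) (by simp [ht'])
  obtain ⟨b⟩ := Function.Embedding.nonempty_of_card_le
    (α := Fin t) (β := Fin (t' + 1)) (by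
      simp only [Fintype.card_fin, ht', hT]
      nlinarith [Nat.zero_le (r * t)])
  exact tiles_of_blowup hT hf1 hf2 hf3 hp hpZ ⟨0, hs0⟩ g.injective b.injective hyi
    fun σ => (mem_filter.mp (hyF σ)).2

end Tiles

section Tiling

variable {V : Type*} [Fintype V] [DecidableEq V]

/-- A family of disjoint paths on `s` vertices avoiding `W`. -/
def IsTiling {ι : Type*} (E : Finset (Finset V)) (l m s : ℕ) (W : Finset V) (P : ι → List V) :
    Prop :=
  (∀ j, LPath E l m (P j) ∧ (P j).length = s ∧ (P j).Nodup ∧ ∀ v ∈ P j, v ∉ W) ∧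
    ∀ i j, i ≠ j → List.Disjoint (P i) (P j)

variable {ι : Type*} [Fintype ι] {E : Finset (Finset V)} {l m s : ℕ} {W : Finset V}
  {P : ι → List V}

theorem IsTiling.card_add (hP : IsTiling E l m s W P) :
    #(univ \ (W ∪ univ.biUnion fun j => (P j).toFinset)) + #W + Fintype.card ι * s =
      Fintype.card V := by
  classical
  have h1 : #(univ.biUnion fun j => (P j).toFinset) = Fintype.card ι * s := by
    rw [card_biUnion]
    · rw [sum_congr rfl fun j _ => (List.toFinset_card_of_nodup (hP.1 j).2.2.1).trans (hP.1 j).2.1,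
        sum_const, card_univ, smul_eq_mul]
    · intro i _ j _ hij
      refine Finset.disjoint_left.mpr ?_
      intro v hv hv'
      exact hP.2 i j hij (List.mem_toFinset.mp hv) (List.mem_toFinset.mp hv')
  have h2 : Disjoint W (univ.biUnion fun j => (P j).toFinset) := by
    rw [Finset.disjoint_left]
    intro v hv hv'
    simp only [mem_biUnion, mem_univ, true_and, List.mem_toFinset] at hv'
    obtain ⟨j, hj⟩ := hv'
    exact (hP.1 j).2.2.2 v hj hv
  rw [← h1, add_assoc, ← card_union_of_disjoint h2, card_sdiff_add_card_eq_card (subset_univ _),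
    card_univ]

theorem IsTiling.comp {κ : Type*} (hP : IsTiling E l m s W P) {e : κ → ι}
    (he : Function.Injective e) : IsTiling E l m s W (P ∘ e) :=
  ⟨fun j => hP.1 (e j), fun _ _ hij => hP.2 _ _ (he.ne hij)⟩

/-- Adding chunks of the uncovered part to a tiling gives a family of disjoint blocks. -/
theorem IsTiling.exists_blocks {M : ℕ} {P : Fin M → List V} (hP : IsTiling E l m s W P)
    {Z₁ : Finset V} (hZ : Z₁ ⊆ univ \ (W ∪ univ.biUnion fun j => (P j).toFinset)) (hs : 0 < s) :
    ∃ N : ℕ, Fintype.card V < (M + N) * s + #W + #Z₁ + s ∧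
      ∃ p : (Fin M ⊕ Fin N) × Fin s → V, Function.Injective p ∧ (∀ j, p j ∉ Z₁) ∧
        (∀ j q, p j = q → q ∉ W) ∧ ∀ j x, p x ∈ P j → x.1 = Sum.inl j := by
  have hcard := hP.card_add
  set Z := univ \ (W ∪ univ.biUnion fun j => (P j).toFinset) with hZd
  set R := Z \ Z₁ with hR
  have hRc : #R + #Z₁ = #Z := card_sdiff_add_card_eq_card hZ
  refine ⟨#R / s, ?_, ?_⟩
  · have h1 := Nat.div_add_mod #R s
    have h2 := Nat.mod_lt #R hs
    rw [Fintype.card_fin] at hcard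
    rw [add_mul, mul_comm (#R / s)]
    omega
  · obtain ⟨φ⟩ := Function.Embedding.nonempty_of_card_le
      (α := Fin (#R / s) × Fin s) (β := R) (by simpa using Nat.div_mul_le_self #R s)
    have hφ : ∀ x, (φ x : V) ∈ Z ∧ (φ x : V) ∉ Z₁ := fun x => mem_sdiff.mp (φ x).2
    have hmem : ∀ j v, v ∈ P j → v ∉ Z := by
      intro j v hv hv'
      rw [hZd, mem_sdiff, mem_union, mem_biUnion] at hv'
      exact hv'.2 (Or.inr ⟨j, mem_univ _, List.mem_toFinset.mpr hv⟩)
    have hlen : ∀ j (q : Fin s), q.1 < (P j).length := fun j q => by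
      rw [(hP.1 j).2.1]; exact q.2
    refine ⟨fun x => Sum.elim (fun j => (P j)[x.2.1]'(hlen j x.2)) (fun j => φ (j, x.2)) x.1,
      ?_, ?_, ?_, ?_⟩
    · rintro ⟨j | j, q⟩ ⟨j' | j', q'⟩ he
      · simp only [Sum.elim_inl] at he
        by_cases hj : j = j'
        · subst hj
          have := (List.Nodup.getElem_inj_iff (hP.1 j).2.2.1).mp he
          rw [Fin.ext this]
        · exact absurd (he ▸ List.getElem_mem (hlen j q) : (P j')[q'.1]'(hlen j' q') ∈ P j)
            fun h => hP.2 j j' hj h (List.getElem_mem _)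
      · simp only [Sum.elim_inl, Sum.elim_inr] at he
        exact absurd (hφ (j', q')).1 (hmem j _ (he ▸ List.getElem_mem _))
      · simp only [Sum.elim_inl, Sum.elim_inr] at he
        exact absurd (hφ (j, q)).1 (hmem j' _ (he ▸ List.getElem_mem _))
      · have := Prod.mk.inj (φ.injective (Subtype.ext he))
        rw [this.1, show q = q' from this.2]
    · rintro ⟨j | j, q⟩ hx
      · exact hmem j _ (List.getElem_mem _) (hZ hx)
      · exact (hφ (j, q)).2 hx
    · rintro ⟨j | j, q⟩ v rfl
      · exact (hP.1 j).2.2.2 _ (List.getElem_mem _)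
      · intro hW
        have := (hφ (j, q)).1
        rw [hZd, mem_sdiff, mem_union] at this
        exact this.2 (Or.inl hW)
    · rintro j ⟨i | i, q⟩ hx
      · by_contra hne
        exact hP.2 i j (fun h => hne (by rw [h])) (List.getElem_mem (hlen i q)) hx
      · exact absurd (hφ (i, q)).1 (hmem j _ hx)

theorem exists_tiling (h c : ℕ) (hhc : 1 ≤ 2 * h + c) {γ ε : ℝ} (hγ : 0 < γ) (hγ1 : γ ≤ 1)
    (hε : 0 < ε) (s₀ : ℕ) :
    ∃ s : ℕ, s₀ ≤ s ∧ 0 < s ∧ ∃ n₀ : ℕ, ∀ (V : Type) [Fintype V] [DecidableEq V],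
      n₀ ≤ Fintype.card V → ∀ E : Finset (Finset V),
      (∀ S : Finset V, #S = 2 * h + c + 1 →
        ((4 * ((h + c + 2 : ℕ) : ℝ) - 1) / (4 * ((h + c + 2 : ℕ) : ℝ) ^ 2) + γ) *
          (Fintype.card V : ℝ) ^ 2 ≤ pairDeg E S) →
      ∀ W : Finset V, (#W : ℝ) ≤ γ / 16 * Fintype.card V →
      ∃ (M : ℕ) (P : Fin M → List V), IsTiling E (h + 1) (h + c + 2) s W P ∧
        (#(univ \ (W ∪ univ.biUnion fun j => (P j).toFinset)) : ℝ) ≤ ε * Fintype.card V := by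
  classical
  set δ := min ε (γ / 16) with hδd
  have hδ : 0 < δ := lt_min hε (by positivity)
  obtain ⟨s, hs₀, hs, w, n₀, H⟩ := exists_more_tiles h c hhc hγ hγ1 hδ s₀
  obtain ⟨n₁, hn₁⟩ := exists_nat_ge ((1 + s) / (γ / 16))
  refine ⟨s, hs₀, hs, n₀ + n₁, ?_⟩
  intro V _ _ hV E hE W hW
  let good : ℕ → Prop := fun M => ∃ P : Fin M → List V, IsTiling E (h + 1) (h + c + 2) s W P
  have hgood : ∀ M, good M → M ≤ Fintype.card V := by
    rintro M ⟨P, hP⟩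
    have := hP.card_add
    rw [Fintype.card_fin] at this
    nlinarith
  have h0 : good 0 := ⟨fun i => i.elim0, fun i => i.elim0, fun i => i.elim0⟩
  set M := Nat.findGreatest good (Fintype.card V) with hM
  obtain ⟨P, hP⟩ : good M := Nat.findGreatest_spec (Nat.zero_le _) h0
  refine ⟨M, P, hP, ?_⟩
  by_contra hlt
  push Not at hlt
  set n : ℝ := (Fintype.card V : ℝ) with hn
  have hn0 : 0 ≤ n := Nat.cast_nonneg _
  have hδε : δ * n ≤ ε * n := by gcongr; exact min_le_left _ _
  have hδγ : δ * n ≤ γ / 16 * n := by gcongr; exact min_le_right _ _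
  obtain ⟨Z₁, hZ₁, hZ₁c⟩ := exists_subset_card_eq (Nat.ceil_le.mpr (hδε.trans hlt.le))
  obtain ⟨N, hN, p, hpi, hpZ, hpW, hpP⟩ := hP.exists_blocks hZ₁ hs
  have hceil := Nat.ceil_lt_add_one (show 0 ≤ δ * n by positivity)
  rw [← hZ₁c] at hceil
  have hlarge : (1 + s : ℝ) ≤ γ / 16 * n := by
    have h1 : (n₁ : ℝ) ≤ n := Nat.cast_le.mpr (by omega)
    rw [div_le_iff₀ (by positivity)] at hn₁
    nlinarith
  have hcov : n - Fintype.card (Fin M ⊕ Fin N) * s ≤ γ / 4 * n := by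
    have h1 : n ≤ (M + N) * s + #W + #Z₁ + s := by
      have : (Fintype.card V : ℝ) ≤ ((M + N) * s + #W + #Z₁ + s : ℕ) := Nat.cast_le.mpr hN.le
      push_cast at this
      exact this
    rw [Fintype.card_sum, Fintype.card_fin, Fintype.card_fin]
    push_cast
    linarith
  obtain ⟨Rel, hRel, Q, hQ1, hQ2, hQ3⟩ := H V (by omega) E hE _ p hpi Z₁ hpZ
    (by rw [hZ₁c]; exact Nat.le_ceil _) hcov
  have hQP : ∀ (j : {j : Fin M // Sum.inl j ∉ Rel}) e, List.Disjoint (P j.1) (Q e) := by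
    intro j e v hv hv'
    rcases hQ3 e v hv' with hvZ | ⟨b, hb, q, rfl⟩
    · have := hZ₁ hvZ
      rw [mem_sdiff, mem_union, mem_biUnion] at this
      exact this.2 (Or.inr ⟨_, mem_univ _, List.mem_toFinset.mpr hv⟩)
    · exact j.2 (hpP j.1 _ hv ▸ hb)
  let P' : {j : Fin M // Sum.inl j ∉ Rel} ⊕ Fin (w + 1) → List V := Sum.elim (fun j => P j.1) Q
  have hP' : IsTiling E (h + 1) (h + c + 2) s W P' := by
    refine ⟨?_, ?_⟩
    · rintro (j | e)
      · exact hP.1 j.1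
      · refine ⟨(hQ1 e).1, (hQ1 e).2.1, (hQ1 e).2.2, ?_⟩
        intro v hv hvW
        rcases hQ3 e v hv with hvZ | ⟨b, hb, q, rfl⟩
        · have := hZ₁ hvZ
          rw [mem_sdiff, mem_union] at this
          exact this.2 (Or.inl hvW)
        · exact hpW _ _ rfl hvW
    · rintro (i | e) (j | e') hne
      · exact hP.2 _ _ fun h => hne (by rw [Subtype.ext h])
      · exact hQP i e'
      · exact (hQP j e).symm
      · exact hQ2 _ _ fun h => hne (by rw [h])
  have hcard : M + 1 ≤ Fintype.card ({j : Fin M // Sum.inl j ∉ Rel} ⊕ Fin (w + 1)) := by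
    rw [Fintype.card_sum, Fintype.card_fin, Fintype.card_subtype]
    have h1 : #{j : Fin M | ¬ Sum.inl j ∈ Rel} + #{j : Fin M | Sum.inl j ∈ Rel} = M := by
      have := card_filter_add_card_filter_not (s := (univ : Finset (Fin M)))
        (fun j => (Sum.inl j : Fin M ⊕ Fin N) ∈ Rel)
      rw [card_univ, Fintype.card_fin] at this
      omega
    have h2 : #{j : Fin M | (Sum.inl j : Fin M ⊕ Fin N) ∈ Rel} ≤ #Rel :=
      card_le_card_of_injOn Sum.inl (fun j hj => (mem_filter.mp hj).2)
        (Sum.inl_injective.injOn)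
    omega
  obtain ⟨e⟩ := Function.Embedding.nonempty_of_card_le
    (α := Fin (M + 1)) (β := {j : Fin M // Sum.inl j ∉ Rel} ⊕ Fin (w + 1))
    (by rw [Fintype.card_fin]; exact hcard)
  have hg : good (M + 1) := ⟨_, hP'.comp e.injective⟩
  have := Nat.le_findGreatest (hgood _ hg) hg
  omega

end Tiling

section Cycles

variable {V : Type*} [DecidableEq V] {E : Finset (Finset V)} {l m : ℕ}

theorem LPath.exists_cycle {vs : List V} (h : LPath E l m (vs ++ vs.take l)) (hl : 0 < l)
    (hm : 0 < m) (hvs : m + l ≤ vs.length) : 1 ≤ vs.length / m ∧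
      ∀ i < vs.length / m, ((vs.rotate (i * m)).take (m + l)).toFinset ∈ E := by
  obtain ⟨T, hT⟩ := h.exists_length
  have hlen : vs.length = m * T := by
    rw [List.length_append, List.length_take] at hT
    omega
  have hdiv : vs.length / m = T := by rw [hlen, Nat.mul_div_cancel_left _ hm]
  refine ⟨?_, ?_⟩
  · rw [hdiv]
    rcases Nat.eq_zero_or_pos T with h0 | h0
    · subst h0; omega
    · exact h0
  · intro i hi
    rw [hdiv] at hi
    have hi' : i * m + m ≤ m * T := by
      have : m * (i + 1) ≤ m * T := Nat.mul_le_mul_left _ hi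
      linarith [mul_comm i m, mul_add m i 1]
    have hw := h.window i (by
      rw [List.length_append, List.length_take]; omega) hm
    rw [List.rotate_eq_drop_append_take (by omega)]
    rw [List.drop_append_of_le_length (by omega)] at hw
    have e : ∀ b : List V, (vs.drop (i * m) ++ b).take (m + l) =
        (vs.drop (i * m)).take (m + l) ++ b.take (m + l - (vs.drop (i * m)).length) :=
      fun b => List.take_append
    rw [e] at hw ⊢
    rw [List.take_take] at hw ⊢
    convert hw using 4
    rw [List.length_drop]
    omega

theorem flat_perm (bs : List (List V × List V)) :
    (flat bs).Perm ((bs.map Prod.fst).flatten ++ (bs.map Prod.snd).flatten) := by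
  induction bs with
  | nil => simp [flat]
  | cons b bs ih =>
    have : flat (b :: bs) = b.1 ++ (b.2 ++ flat bs) := by simp [flat]
    rw [this]
    simp only [List.map_cons, List.flatten_cons, List.append_assoc]
    refine List.Perm.append_left _ ?_
    refine (List.Perm.append_left _ ih).trans ?_
    rw [← List.append_assoc, ← List.append_assoc]
    exact List.Perm.append_right _ List.perm_append_comm

theorem start_sublist (l : ℕ) (bs : List (List V × List V)) (Y : List V) :
    (start l bs Y).Sublist ((bs.map Prod.fst).flatten ++ Y) := by
  cases bs with
  | nil => simp [start]
  | cons b bs =>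
    simp only [start, List.map_cons, List.flatten_cons, List.append_assoc]
    exact (List.take_sublist _ _).trans (List.sublist_append_left _ _)

/-- Paths can be connected greedily into a chain. -/
theorem exists_chain {Q : List V → Prop} {N : ℕ}
    (h : ∀ U : List (List V), U.length < N → (∀ u ∈ U, Q u) → ∀ X Y : List V, X.length = l →
      Y.length = l → (X ++ Y).Nodup →
      ∃ p, Q p ∧ LPath E l m (X ++ p ++ Y) ∧ ∀ u ∈ U, List.Disjoint p u)
    {Y : List V} (hY : Y.length = l) (qs : List (List V)) (hq : ∀ q ∈ qs, LPath E l m q)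
    (hnd : (qs.flatten ++ Y).Nodup) (hN : qs.length ≤ N) :
    ∃ bs : List (List V × List V), bs.map Prod.fst = qs ∧ Chain E l m bs Y ∧
      (∀ p ∈ bs.map Prod.snd, Q p) ∧ (bs.map Prod.snd).Pairwise List.Disjoint := by
  induction qs with
  | nil => exact ⟨[], by simp [Chain]⟩
  | cons q qs ih =>
    rw [List.flatten_cons, List.append_assoc] at hnd
    obtain ⟨bs, h1, h2, h3, h4⟩ := ih (fun q' hq' => hq q' (List.mem_cons_of_mem _ hq'))
      (hnd.sublist (List.sublist_append_right _ _)) (by rw [List.length_cons] at hN; omega)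
    have hlq := (hq q List.mem_cons_self).le_length
    obtain ⟨p, hp1, hp2, hp3⟩ := h (bs.map Prod.snd) (by
        have := congrArg List.length h1
        rw [List.length_map] at this ⊢
        rw [List.length_cons] at hN
        omega) h3 (last l q) (start l bs Y) (length_last hlq) (h2.length_start hY)
      (hnd.sublist (List.Sublist.append (last_sublist q) (h1 ▸ start_sublist l bs Y)))
    refine ⟨(q, p) :: bs, by simp [h1], ⟨hq q List.mem_cons_self, hp2, h2⟩, ?_, ?_⟩
    · intro p' hp'
      rw [List.map_cons, List.mem_cons] at hp'
      rcases hp' with rfl | hp'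
      · exact hp1
      · exact h3 p' hp'
    · rw [List.map_cons, List.pairwise_cons]
      exact ⟨hp3, h4⟩

variable {ι : Type*} [DecidableEq ι]

open Classical in
/-- A chain with sufficiently many absorbers can absorb a family of `m`-sets. -/
theorem absorb_all {pos : List ι} {Y : List V} (Ts : List (List V)) :
    ∀ (bs : List (List V × List V)) (L : List (ι → V)), Chain E l m bs Y →
    (L.map fun x => pos.map x).Subperm (bs.map Prod.fst) →
    (∀ T ∈ Ts, Ts.length ≤ L.countP fun x => IsAbsorber E l m pos T x) →
    ∃ bs', Chain E l m bs' Y ∧ start l bs' Y = start l bs Y ∧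
      (flat bs').Perm (flat bs ++ Ts.flatten) := by
  induction Ts with
  | nil => intro bs L h _ _; exact ⟨bs, h, rfl, by simp⟩
  | cons T Ts ih =>
    intro bs L hbs hL hT
    have h1 := hT T List.mem_cons_self
    rw [List.length_cons] at h1
    obtain ⟨x, hxL, hx⟩ := List.countP_pos_iff.mp (lt_of_lt_of_le (Nat.succ_pos _) h1)
    obtain ⟨-, -, -, q', hq1, hq2, hq3, hq4⟩ := of_decide_eq_true hx
    obtain ⟨⟨q, c⟩, hb, hbq⟩ := List.mem_map.mp
      (hL.subset (List.mem_map.mpr ⟨x, hxL, rfl⟩))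
    obtain ⟨bs₁, bs₂, rfl⟩ := List.append_of_mem hb
    simp only at hbq
    subst hbq
    have hperm := List.perm_cons_erase hxL
    have h2 : ((L.erase x).map fun x => pos.map x).Subperm ((bs₁ ++ bs₂).map Prod.fst) := by
      have e1 := hperm.map fun x => pos.map x
      have e2 : ((bs₁ ++ (pos.map x, c) :: bs₂).map Prod.fst).Perm
          (pos.map x :: (bs₁ ++ bs₂).map Prod.fst) := by
        exact (List.perm_middle.map Prod.fst)
      have := (e1.symm.subperm.trans hL).trans e2.subperm
      rw [List.map_cons] at this
      exact (List.subperm_cons _).mp this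
    obtain ⟨bs', h3, h4, h5⟩ := ih (bs₁ ++ (q', c) :: bs₂) (L.erase x)
      (chain_replace hbs hq1 hq3 hq4)
      (h2.trans (List.Sublist.subperm (List.Sublist.map _
        (List.Sublist.append_left (List.sublist_cons_self _ _) _)))) (by
        intro T' hT'
        have e1 := hT T' (List.mem_cons_of_mem _ hT')
        rw [hperm.countP_eq, List.countP_cons, List.length_cons] at e1
        split_ifs at e1 <;> omega)
    refine ⟨bs', h3, ?_, h5.trans ?_⟩
    · rw [h4, start_append, start_append]
      cases bs₁ with
      | nil => simpa [start] using hq3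
      | cons b bs₁ => rfl
    · rw [List.flatten_cons, flat_append, flat_append]
      have e1 : ∀ q, flat ((q, c) :: bs₂) = q ++ (c ++ flat bs₂) := by simp [flat]
      rw [e1, e1]
      have e2 : (T ++ (c ++ flat bs₂) ++ Ts.flatten).Perm (c ++ flat bs₂ ++ T ++ Ts.flatten) :=
        List.Perm.append_right _ List.perm_append_comm
      have e3 := List.Perm.append_right (c ++ (flat bs₂ ++ Ts.flatten)) hq2
      simp only [List.append_assoc] at e2 e3 ⊢
      exact List.Perm.append_left _ (e3.trans (List.Perm.append_left _ e2))

/-- Every list splits into chunks of a given size. -/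
theorem exists_chunks (m N : ℕ) : ∀ L : List V, L.length = m * N → L.Nodup →
    ∃ Ts : List (List V), Ts.length = N ∧ (∀ T ∈ Ts, T.length = m ∧ T.Nodup) ∧ Ts.flatten = L := by
  induction N with
  | zero =>
    intro L hL _
    have : L = [] := List.length_eq_zero_iff.mp (by simpa using hL)
    exact ⟨[], by simp [this]⟩
  | succ N ih =>
    intro L hL hnd
    have hL' : L.length = m * N + m := by rw [hL]; ring
    obtain ⟨Ts, h1, h2, h3⟩ := ih (L.drop m) (by rw [List.length_drop]; omega)
      (hnd.sublist (List.drop_sublist _ _))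
    refine ⟨L.take m :: Ts, by simp [h1], ?_, by simp [h3]⟩
    intro T hT
    rcases List.mem_cons.mp hT with rfl | hT
    · exact ⟨by rw [List.length_take]; omega, hnd.sublist (List.take_sublist _ _)⟩
    · exact h2 T hT

end Cycles

section Connecting

theorem length_flatten_le {α : Type*} {U : List (List α)} {κ : ℕ} (h : ∀ u ∈ U, u.length ≤ κ) :
    U.flatten.length ≤ U.length * κ := by
  induction U with
  | nil => simp
  | cons u U ih =>
    have h1 := h u List.mem_cons_self
    have h2 := ih fun u hu => h u (List.mem_cons_of_mem _ hu)
    rw [List.flatten_cons, List.length_append, List.length_cons]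
    linarith [add_mul U.length 1 κ]

theorem flat_nodup {V : Type*} [DecidableEq V] {bs : List (List V × List V)}
    (h1 : (bs.map Prod.fst).flatten.Nodup) (h2 : ∀ p ∈ bs.map Prod.snd, p.Nodup)
    (h3 : (bs.map Prod.snd).Pairwise List.Disjoint)
    (h4 : ∀ p ∈ bs.map Prod.snd, ∀ v ∈ p, v ∉ (bs.map Prod.fst).flatten) : (flat bs).Nodup := by
  rw [(flat_perm bs).nodup_iff, List.nodup_append']
  refine ⟨h1, List.nodup_flatten.mpr ⟨h2, h3⟩, ?_⟩
  intro v hv hv'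
  obtain ⟨p, hp, hvp⟩ := List.mem_flatten.mp hv'
  exact h4 p hp v hvp hv

/-- Two short sequences can be connected outside of any small set. -/
theorem exists_connection (h c : ℕ) (hhc : 1 ≤ 2 * h + c) {d : ℝ} (hd0 : 0 < d) (hd1 : d ≤ 1) :
    ∃ a > (0 : ℝ), ∃ κ n₀ : ℕ, ∀ (V : Type) [Fintype V] [DecidableEq V], n₀ ≤ Fintype.card V →
      ∀ E : Finset (Finset V),
      (∀ S : Finset V, #S = 2 * h + c + 1 → d * (Fintype.card V : ℝ) ^ 2 ≤ pairDeg E S) →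
      ∀ W : Finset V, (#W : ℝ) ≤ a * Fintype.card V → ∀ X Y : List V, X.length = h + 1 →
      Y.length = h + 1 → (X ++ Y).Nodup →
      ∃ p : List V, p.length = κ ∧ p.Nodup ∧ (∀ v ∈ p, v ∉ W) ∧
        LPath E (h + 1) (h + c + 2) (X ++ p ++ Y) := by
  classical
  obtain ⟨ι, _, _, pos, hpos, a, ha, n₀, H⟩ := exists_connector_count h c hhc hd0 hd1
  refine ⟨a / (2 * Fintype.card ι + 1), by positivity, pos.length, n₀ + 1, ?_⟩
  intro V _ _ hV E hE W hW X Y hX hY hXY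
  have hn : (0 : ℝ) ≤ Fintype.card V := Nat.cast_nonneg _
  obtain ⟨x, hx, hxW⟩ := exists_avoid ha (by omega) _ W (H V (by omega) E hE X Y hX hY hXY) (by
    rw [div_mul_eq_mul_div, le_div_iff₀ (by positivity)] at hW
    have : (0 : ℝ) ≤ #W := Nat.cast_nonneg _
    nlinarith)
  obtain ⟨hx1, -, -, hx4⟩ := (mem_filter.mp hx).2
  refine ⟨pos.map x, by simp, hpos.map hx1, ?_, hx4⟩
  intro v hv
  obtain ⟨i, -, rfl⟩ := List.mem_map.mp hv
  exact hxW i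

theorem exists_disjoint_map {ι V : Type*} [DecidableEq V] {pos : List ι}
    {L : List (ι → V)} (hL : L.Pairwise fun x y => ∀ i j, x i ≠ y j)
    {P : (ι → V) → Prop} [DecidablePred P] {U : List (List V)}
    (hU : ∀ u ∈ U, ∃ x ∈ L, u = pos.map x) (hc : U.length < L.countP P) :
    ∃ x ∈ L, P x ∧ ∀ u ∈ U, List.Disjoint (pos.map x) u := by
  classical
  have hL' : ∀ x ∈ L, ∀ x' ∈ L, ¬ List.Disjoint (pos.map x) (pos.map x') → x = x' := by
    intro x hx x' hx' hnd
    by_contra hne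
    refine hnd ?_
    intro v hv hv'
    obtain ⟨i, -, rfl⟩ := List.mem_map.mp hv
    obtain ⟨j, -, hj⟩ := List.mem_map.mp hv'
    have : Std.Symm fun x y : ι → V => ∀ i j, x i ≠ y j := ⟨fun _ _ hxy i j => (hxy j i).symm⟩
    exact hL.forall hx hx' hne i j hj.symm
  by_contra hcon
  push Not at hcon
  have h1 : ∀ x ∈ L, P x → pos.map x ∈ U ∧ pos ≠ [] := by
    intro x hx hPx
    obtain ⟨u, hu, hd⟩ := hcon x hx hPx
    obtain ⟨x', hx', rfl⟩ := hU u hu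
    rw [hL' x hx x' hx' hd]
    refine ⟨hu, ?_⟩
    rintro rfl
    exact hd (by simp)
  have h2 : (L.filter P).Nodup := by
    rcases eq_or_ne pos [] with h0 | h0
    · have : L.filter P = [] := List.filter_eq_nil_iff.mpr fun x hx hP =>
        (h1 x hx (of_decide_eq_true hP)).2 h0
      rw [this]
      exact List.nodup_nil
    · obtain ⟨i, hi⟩ := List.exists_mem_of_ne_nil pos h0
      refine List.Nodup.filter _ ?_
      exact hL.imp fun hxy he => hxy i i (by rw [he])
  have h3 : #(L.filter P).toFinset ≤ #U.toFinset := by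
    refine card_le_card_of_injOn (fun x => pos.map x) ?_ ?_
    · intro x hx
      have hx' := List.mem_filter.mp (List.mem_toFinset.mp hx)
      exact List.mem_toFinset.mpr (h1 x hx'.1 (of_decide_eq_true hx'.2)).1
    · intro x hx x' hx' he
      have hx := List.mem_filter.mp (List.mem_toFinset.mp hx)
      have hx' := List.mem_filter.mp (List.mem_toFinset.mp hx')
      refine hL' x hx.1 x' hx'.1 ?_
      intro hd
      obtain ⟨i, hi⟩ := List.exists_mem_of_ne_nil pos (h1 x hx.1 (of_decide_eq_true hx.2)).2
      have he : pos.map x = pos.map x' := he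
      rw [← he] at hd
      exact hd (List.mem_map.mpr ⟨i, hi, rfl⟩) (List.mem_map.mpr ⟨i, hi, rfl⟩)
  rw [List.toFinset_card_of_nodup h2, ← List.countP_eq_length_filter] at h3
  have := List.toFinset_card_le U
  omega

theorem card_nodup_vectors (V : Type) [Fintype V] (D : ℕ)
    [Fintype {v : List.Vector V D // v.toList.Nodup}] :
    (Fintype.card {v : List.Vector V D // v.toList.Nodup} : ℝ) ≤ (Fintype.card V : ℝ) ^ D := by
  have : Fintype.card {v : List.Vector V D // v.toList.Nodup} ≤ Fintype.card V ^ D := by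
    rw [← card_vector]
    exact Fintype.card_subtype_le _
  exact_mod_cast this

/-- There is a small set `R` that contains many disjoint connections between any two short
sequences. -/
theorem exists_reservoir (h c : ℕ) (hhc : 1 ≤ 2 * h + c) {d : ℝ} (hd0 : 0 < d) (hd1 : d ≤ 1) :
    ∃ a > (0 : ℝ), ∀ η > (0 : ℝ), ∃ β > (0 : ℝ), ∃ n₀ : ℕ,
      ∀ (V : Type) [Fintype V] [DecidableEq V], n₀ ≤ Fintype.card V →
      ∀ E : Finset (Finset V),
      (∀ S : Finset V, #S = 2 * h + c + 1 → d * (Fintype.card V : ℝ) ^ 2 ≤ pairDeg E S) →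
      ∀ W : Finset V, (#W : ℝ) ≤ a * Fintype.card V →
      ∃ R : Finset V, (∀ v ∈ R, v ∉ W) ∧ (#R : ℝ) ≤ η * Fintype.card V ∧
        ∃ Q : List V → Prop, (∀ p, Q p → p.Nodup ∧ ∀ v ∈ p, v ∈ R) ∧
          ∀ U : List (List V), (U.length : ℝ) < β * Fintype.card V → (∀ u ∈ U, Q u) →
          ∀ X Y : List V, X.length = h + 1 → Y.length = h + 1 → (X ++ Y).Nodup →
          ∃ p, Q p ∧ LPath E (h + 1) (h + c + 2) (X ++ p ++ Y) ∧
            ∀ u ∈ U, List.Disjoint p u := by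
  classical
  obtain ⟨ι, _, _, pos, hpos, a, ha, n₀, H⟩ := exists_connector_count h c hhc hd0 hd1
  set σ : ℝ := (Fintype.card ι : ℝ) with hσ
  have hσ0 : 0 ≤ σ := Nat.cast_nonneg _
  refine ⟨a / (4 * σ + 1), by positivity, ?_⟩
  intro η hη
  set α := min (η / (σ + 1)) (a / (4 * σ ^ 2 + 1)) with hα
  have hα0 : 0 < α := lt_min (by positivity) (by positivity)
  have hα1 : α * σ ≤ η := by
    have h1 : α ≤ η / (σ + 1) := min_le_left _ _
    rw [le_div_iff₀ (by positivity)] at h1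
    nlinarith
  have hα2 : α * σ ^ 2 * 4 ≤ a := by
    have h1 : α ≤ a / (4 * σ ^ 2 + 1) := min_le_right _ _
    rw [le_div_iff₀ (by positivity)] at h1
    nlinarith
  obtain ⟨n₁, H₁⟩ := exists_selection ι ((h + 1) + (h + 1)) ha hα0 hα2
  refine ⟨a * α / 8, by positivity, n₀ + n₁, ?_⟩
  intro V _ _ hV E hE W hW
  have hn : (0 : ℝ) ≤ Fintype.card V := Nat.cast_nonneg _
  let Γ := {v : List.Vector V ((h + 1) + (h + 1)) // v.toList.Nodup}
  let A : Γ → Finset (ι → V) := fun v => {x | IsConnector E (h + 1) (h + c + 2) pos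
    (v.1.toList.take (h + 1)) (v.1.toList.drop (h + 1)) x}
  obtain ⟨L, hL1, hL2, hL3, hL4, hL5⟩ := H₁ V (by omega) Γ (card_nodup_vectors V _) A (by
      intro v
      refine H V (by omega) E hE _ _ ?_ ?_ ?_
      · rw [List.length_take, List.Vector.toList_length]; omega
      · rw [List.length_drop, List.Vector.toList_length]; omega
      · rw [List.take_append_drop]; exact v.2) W (by
      rw [div_mul_eq_mul_div, le_div_iff₀ (by positivity)] at hW
      have : (0 : ℝ) ≤ #W := Nat.cast_nonneg _
      nlinarith)
  refine ⟨support L, ?_, ?_, fun p => ∃ x ∈ L, p = pos.map x, ?_, ?_⟩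
  · intro v hv
    obtain ⟨x, hx, i, rfl⟩ := mem_support.mp hv
    exact hL3 x hx i
  · have h1 : (#(support L) : ℝ) ≤ L.length * σ := by
      rw [hσ]
      exact_mod_cast card_support L
    nlinarith
  · rintro p ⟨x, hx, rfl⟩
    refine ⟨?_, ?_⟩
    · obtain ⟨v, hv⟩ := hL4 x hx
      exact hpos.map (mem_filter.mp hv).2.1
    · intro v hv
      obtain ⟨i, -, rfl⟩ := List.mem_map.mp hv
      exact mem_support.mpr ⟨x, hx, i, rfl⟩
  · intro U hU hUQ X Y hX hY hXY
    let v : Γ := ⟨⟨X ++ Y, by rw [List.length_append, hX, hY]⟩, hXY⟩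
    have h1 : U.length < L.countP (· ∈ A v) := by
      have := hU.trans_le (hL5 v)
      exact_mod_cast this
    obtain ⟨x, hx, hxA, hxU⟩ := exists_disjoint_map hL2 hUQ h1
    refine ⟨pos.map x, ⟨x, hx, rfl⟩, ?_, hxU⟩
    have h2 := (mem_filter.mp hxA).2.2.2.2
    have e1 : (v.1.toList).take (h + 1) = X := by
      change (X ++ Y).take (h + 1) = X
      rw [List.take_append_of_le_length hX.ge, ← hX, List.take_length]
    have e2 : (v.1.toList).drop (h + 1) = Y := by
      change (X ++ Y).drop (h + 1) = Y
      rw [← hX, List.drop_left]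
    rw [e1, e2] at h2
    exact h2

end Connecting

section Absorbing

/-- A short chain that can absorb every small family of `m`-sets. -/
theorem exists_absorbing_chain (h c : ℕ) (hhc : 1 ≤ 2 * h + c) {d : ℝ} (hd0 : 0 < d) (hd1 : d ≤ 1)
    {η : ℝ} (hη : 0 < η) :
    ∃ β > (0 : ℝ), ∃ n₀ : ℕ, ∀ (V : Type) [Fintype V] [DecidableEq V], n₀ ≤ Fintype.card V →
      ∀ E : Finset (Finset V),
      (∀ S : Finset V, #S = 2 * h + c + 1 → d * (Fintype.card V : ℝ) ^ 2 ≤ pairDeg E S) →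
      ∃ (bs : List (List V × List V)) (Y : List V), Y.length = h + 1 ∧ bs ≠ [] ∧
        Chain E (h + 1) (h + c + 2) bs Y ∧ (flat bs ++ Y).Nodup ∧
        ((flat bs ++ Y).length : ℝ) ≤ η * Fintype.card V ∧
        ∀ (bs₂ : List (List V × List V)) (Y₂ : List V) (Ts : List (List V)),
          Chain E (h + 1) (h + c + 2) (bs ++ bs₂) Y₂ →
          (∀ T ∈ Ts, T.length = h + c + 2 ∧ T.Nodup) → (Ts.length : ℝ) ≤ β * Fintype.card V →
          ∃ bs', Chain E (h + 1) (h + c + 2) bs' Y₂ ∧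
            start (h + 1) bs' Y₂ = start (h + 1) (bs ++ bs₂) Y₂ ∧
            (flat bs').Perm (flat (bs ++ bs₂) ++ Ts.flatten) := by
  classical
  obtain ⟨ι, _, _, pos, hpos, a, ha, n₁, H₁⟩ := exists_absorber_count h c hhc hd0 hd1
  obtain ⟨a', ha', κ, n₂, H₂⟩ := exists_connection h c hhc hd0 hd1
  set σ : ℝ := (Fintype.card ι : ℝ) with hσ
  have hσ0 : 0 ≤ σ := Nat.cast_nonneg _
  have hκ0 : (0 : ℝ) ≤ κ := Nat.cast_nonneg _
  set θ := min (min a' η) 1 with hθ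
  have hθ0 : 0 < θ := lt_min (lt_min ha' hη) one_pos
  have hθa : θ ≤ a' := (min_le_left _ _).trans (min_le_left _ _)
  have hθη : θ ≤ η := (min_le_left _ _).trans (min_le_right _ _)
  have hθ1 : θ ≤ 1 := min_le_right _ _
  set α := min (a / (4 * σ ^ 2 + 1)) (θ / (2 * (σ + κ + 1))) with hα
  have hα0 : 0 < α := lt_min (by positivity) (by positivity)
  have hα1 : α * (σ + κ) ≤ θ / 2 := by
    have h1 : α ≤ θ / (2 * (σ + κ + 1)) := min_le_right _ _
    rw [le_div_iff₀ (by positivity)] at h1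
    nlinarith
  have hα2 : α * σ ^ 2 * 4 ≤ a := by
    have h1 : α ≤ a / (4 * σ ^ 2 + 1) := min_le_left _ _
    rw [le_div_iff₀ (by positivity)] at h1
    nlinarith
  obtain ⟨n₃, H₃⟩ := exists_selection ι (h + c + 2) ha hα0 hα2
  obtain ⟨n₄, hn₄⟩ := exists_nat_ge (2 * ((h : ℝ) + 1) / θ)
  refine ⟨a * α / 8, by positivity, n₁ + n₂ + n₃ + n₄ + (h + c + 2), ?_⟩
  intro V _ _ hV E hE
  set n : ℝ := (Fintype.card V : ℝ) with hn
  have hn0 : 0 < n := Nat.cast_pos.mpr (by omega)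
  have hlarge : (h : ℝ) + 1 ≤ θ / 2 * n := by
    have h1 : (n₄ : ℝ) ≤ n := Nat.cast_le.mpr (by omega)
    rw [div_le_iff₀ hθ0] at hn₄
    nlinarith
  let Γ := {v : List.Vector V (h + c + 2) // v.toList.Nodup}
  let A : Γ → Finset (ι → V) := fun v => {x | IsAbsorber E (h + 1) (h + c + 2) pos v.1.toList x}
  obtain ⟨L, hL1, hL2, -, hL4, hL5⟩ := H₃ V (by omega) Γ (card_nodup_vectors V _) A
    (fun v => H₁ V (by omega) E hE _ v.2 (List.Vector.toList_length _)) ∅ (by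
      rw [card_empty, Nat.cast_zero, mul_zero]; positivity)
  have hLx : ∀ x ∈ L, Function.Injective x ∧ LPath E (h + 1) (h + c + 2) (pos.map x) := by
    intro x hx
    obtain ⟨v, hv⟩ := hL4 x hx
    have := (mem_filter.mp hv).2
    exact ⟨this.1, this.2.2.1⟩
  have hcount : ∀ T : List V, T.length = h + c + 2 → T.Nodup →
      a * α / 8 * n ≤ L.countP fun x => IsAbsorber E (h + 1) (h + c + 2) pos T x := by
    intro T hT hTn
    have h1 := hL5 ⟨⟨T, hT⟩, hTn⟩
    have h2 : (L.countP fun x => x ∈ A ⟨⟨T, hT⟩, hTn⟩) =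
        L.countP fun x => IsAbsorber E (h + 1) (h + c + 2) pos T x := by
      refine List.countP_congr fun x _ => ?_
      simp only [A, decide_eq_true_eq, mem_filter, mem_univ, true_and]
      rfl
    rw [← h2]
    exact h1
  have hsupp : (#(support L) : ℝ) ≤ L.length * σ := by
    rw [hσ]
    exact_mod_cast card_support L
  obtain ⟨Y, hYl, hYn, hYL⟩ : ∃ Y : List V, Y.length = h + 1 ∧
      Y.Nodup ∧ ∀ v ∈ Y, v ∉ support L := by
    have h1 : h + 1 ≤ #(univ \ support L) := by
      have h2 := card_sdiff_add_card_eq_card (subset_univ (support L))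
      rw [card_univ] at h2
      have h3 : (#(univ \ support L) : ℝ) + #(support L) = n := by
        rw [hn]
        exact_mod_cast h2
      have h4 : ((h + 1 : ℕ) : ℝ) ≤ #(univ \ support L) := by
        push_cast
        nlinarith
      exact_mod_cast h4
    obtain ⟨Z, hZ, hZc⟩ := exists_subset_card_eq h1
    refine ⟨Z.toList, by rw [length_toList, hZc], nodup_toList _, ?_⟩
    intro v hv
    exact (mem_sdiff.mp (hZ (mem_toList.mp hv))).2
  set B := support L ∪ Y.toFinset with hB
  have hBc : (#B : ℝ) ≤ L.length * σ + (h + 1) := by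
    have h1 := card_union_le (support L) Y.toFinset
    have h2 : #Y.toFinset ≤ h + 1 := hYl ▸ List.toFinset_card_le Y
    have h3 : (#B : ℝ) ≤ #(support L) + (h + 1) := by
      have : #B ≤ #(support L) + (h + 1) := h1.trans (Nat.add_le_add_left h2 _)
      exact_mod_cast this
    linarith
  have hmapL : ∀ q ∈ L.map (fun x => pos.map x), ∀ v ∈ q, v ∈ support L := by
    intro q hq v hv
    obtain ⟨x, hx, rfl⟩ := List.mem_map.mp hq
    obtain ⟨i, -, rfl⟩ := List.mem_map.mp hv
    exact mem_support.mpr ⟨x, hx, i, rfl⟩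
  have hflatL : (L.map fun x => pos.map x).flatten.Nodup := by
    rw [List.nodup_flatten]
    refine ⟨?_, ?_⟩
    · intro q hq
      obtain ⟨x, hx, rfl⟩ := List.mem_map.mp hq
      exact hpos.map (hLx x hx).1
    · rw [List.pairwise_map]
      refine hL2.imp ?_
      intro x y hxy v hv hv'
      obtain ⟨i, -, rfl⟩ := List.mem_map.mp hv
      obtain ⟨j, -, hj⟩ := List.mem_map.mp hv'
      exact hxy i j hj.symm
  have hdisjY : List.Disjoint (L.map fun x => pos.map x).flatten Y := by
    intro v hv hv'
    obtain ⟨q, hq, hvq⟩ := List.mem_flatten.mp hv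
    exact hYL v hv' (hmapL q hq v hvq)
  obtain ⟨bs, hb1, hb2, hb3, hb4⟩ := exists_chain (E := E) (l := h + 1) (m := h + c + 2)
    (Q := fun p => p.length = κ ∧ p.Nodup ∧ ∀ v ∈ p, v ∉ B) (N := L.length) (by
      intro U hU hUQ X Y' hX hY' hXY
      obtain ⟨p, hp1, hp2, hp3, hp4⟩ := H₂ V (by omega) E hE (B ∪ U.flatten.toFinset) (by
        have h1 := card_union_le B U.flatten.toFinset
        have h2 := List.toFinset_card_le U.flatten
        have h3 := length_flatten_le (U := U) (κ := κ) fun u hu => (hUQ u hu).1.le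
        have h4 : U.length * κ ≤ L.length * κ := Nat.mul_le_mul_right _ hU.le
        have h5 : (#(B ∪ U.flatten.toFinset) : ℝ) ≤ #B + L.length * κ := by
          have : #(B ∪ U.flatten.toFinset) ≤ #B + L.length * κ := by omega
          exact_mod_cast this
        calc (#(B ∪ U.flatten.toFinset) : ℝ) ≤ L.length * (σ + κ) + (h + 1) := by linarith
          _ ≤ α * n * (σ + κ) + θ / 2 * n := by gcongr
          _ = α * (σ + κ) * n + θ / 2 * n := by ring
          _ ≤ θ / 2 * n + θ / 2 * n := by gcongr
          _ = θ * n := by ring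
          _ ≤ a' * n := by gcongr) X Y' hX hY' hXY
      refine ⟨p, ⟨hp1, hp2, fun v hv hvB => hp3 v hv (mem_union_left _ hvB)⟩, hp4, ?_⟩
      intro u hu v hv hv'
      exact hp3 v hv (mem_union_right _ (List.mem_toFinset.mpr
        (List.mem_flatten.mpr ⟨u, hu, hv'⟩))))
    hYl (L.map fun x => pos.map x) (by
      intro q hq
      obtain ⟨x, hx, rfl⟩ := List.mem_map.mp hq
      exact (hLx x hx).2) (by
      rw [List.nodup_append']
      exact ⟨hflatL, hYn, hdisjY⟩) (by rw [List.length_map])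
  refine ⟨bs, Y, hYl, ?_, hb2, ?_, ?_, ?_⟩
  · rintro rfl
    have hL0 : L = [] := by simpa using hb1.symm
    obtain ⟨Z, -, hZ⟩ := exists_subset_card_eq (s := (univ : Finset V)) (n := h + c + 2)
      (by rw [card_univ]; omega)
    have h1 := hcount Z.toList (by rw [length_toList, hZ]) (nodup_toList _)
    rw [hL0, List.countP_nil, Nat.cast_zero] at h1
    have : 0 < a * α / 8 * n := by positivity
    linarith
  · rw [List.nodup_append']
    refine ⟨flat_nodup (hb1 ▸ hflatL) (fun p hp => (hb3 p hp).2.1) hb4 ?_, hYn, ?_⟩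
    · intro p hp v hv hv'
      rw [hb1] at hv'
      obtain ⟨q, hq, hvq⟩ := List.mem_flatten.mp hv'
      exact (hb3 p hp).2.2 v hv (mem_union_left _ (hmapL q hq v hvq))
    · intro v hv hv'
      rw [(flat_perm bs).mem_iff, hb1, List.mem_append] at hv
      rcases hv with hv | hv
      · exact hdisjY hv hv'
      · obtain ⟨p, hp, hvp⟩ := List.mem_flatten.mp hv
        exact (hb3 p hp).2.2 v hvp (mem_union_right _ (List.mem_toFinset.mpr hv'))
  · have h1 := (flat_perm bs).length_eq
    rw [hb1, List.length_append] at h1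
    have h2 := length_flatten_le (U := L.map fun x => pos.map x) (κ := Fintype.card ι) (by
      intro u hu
      obtain ⟨x, hx, rfl⟩ := List.mem_map.mp hu
      rw [List.length_map]
      exact hpos.length_le_card)
    have h3 := length_flatten_le (U := bs.map Prod.snd) (κ := κ) fun p hp => (hb3 p hp).1.le
    have h4 : (bs.map Prod.snd).length = L.length := by
      have := congrArg List.length hb1
      simpa using this
    rw [h4] at h3
    rw [List.length_map] at h2
    have h5 : ((flat bs ++ Y).length : ℝ) ≤ L.length * σ + L.length * κ + (h + 1) := by
      have : (flat bs ++ Y).length ≤ L.length * Fintype.card ι + L.length * κ + (h + 1) := by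
        rw [List.length_append, hYl]; omega
      rw [hσ]
      exact_mod_cast this
    calc ((flat bs ++ Y).length : ℝ) ≤ L.length * (σ + κ) + (h + 1) := by linarith
      _ ≤ α * n * (σ + κ) + θ / 2 * n := by gcongr
      _ = α * (σ + κ) * n + θ / 2 * n := by ring
      _ ≤ θ / 2 * n + θ / 2 * n := by gcongr
      _ = θ * n := by ring
      _ ≤ η * n := by gcongr
  · intro bs₂ Y₂ Ts hch hTs hlen
    refine absorb_all (pos := pos) Ts (bs ++ bs₂) L hch ?_ ?_
    · rw [List.map_append, hb1]
      exact (List.sublist_append_left _ _).subperm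
    · intro T hT
      have := hlen.trans (hcount T (hTs T hT).1 (hTs T hT).2)
      exact_mod_cast this

end Absorbing

section Hamilton

/-- A chain closing up to a cycle that can absorb all remaining vertices yields a Hamiltonian
cycle. -/
theorem exists_cycle_of_absorb {V : Type*} [Fintype V] [DecidableEq V] {E : Finset (Finset V)}
    {l m : ℕ} (hl : 0 < l) (hm : 0 < m) (hV : m + l ≤ Fintype.card V)
    (hdvd : m ∣ Fintype.card V) {bs : List (List V × List V)} {Y : List V} (hY : Y.length = l)
    (hbs : Chain E l m bs Y) (hnd : (flat bs).Nodup) (hstart : start l bs Y = Y)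
    (habs : ∀ Ts : List (List V), (∀ T ∈ Ts, T.length = m ∧ T.Nodup) →
      Ts.length ≤ #(univ \ (flat bs).toFinset) →
      ∃ bs', Chain E l m bs' Y ∧ start l bs' Y = start l bs Y ∧
        (flat bs').Perm (flat bs ++ Ts.flatten)) :
    ∃ vs : List V, vs.Nodup ∧ (∀ v, v ∈ vs) ∧ 1 ≤ vs.length / m ∧
      ∀ i < vs.length / m, ((vs.rotate (i * m)).take (m + l)).toFinset ∈ E := by
  set U := univ \ (flat bs).toFinset with hU
  have hUc : #U + (flat bs).length = Fintype.card V := by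
    have := card_sdiff_add_card_eq_card (subset_univ (flat bs).toFinset)
    rwa [List.toFinset_card_of_nodup hnd, card_univ] at this
  obtain ⟨T, hT⟩ := (hbs.lpath hY).exists_length
  have hdU : m ∣ #U := by
    rw [List.length_append, hY] at hT
    have h1 : m ∣ (flat bs).length := ⟨T, by omega⟩
    rw [← hUc] at hdvd
    exact (Nat.dvd_add_left h1).mp hdvd
  obtain ⟨N, hN⟩ := hdU
  obtain ⟨Ts, h1, h2, h3⟩ := exists_chunks m N U.toList (by rw [length_toList, hN]) (nodup_toList _)
  obtain ⟨bs', h4, h5, h6⟩ := habs Ts h2 (by rw [h1, hN]; exact Nat.le_mul_of_pos_left _ hm)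
  rw [h3] at h6
  have hnd' : (flat bs').Nodup := by
    rw [h6.nodup_iff, List.nodup_append']
    refine ⟨hnd, nodup_toList _, ?_⟩
    intro v hv hv'
    exact (mem_sdiff.mp (mem_toList.mp hv')).2 (List.mem_toFinset.mpr hv)
  have hmem : ∀ v, v ∈ flat bs' := by
    intro v
    rw [h6.mem_iff, List.mem_append]
    by_cases hv : v ∈ flat bs
    · exact Or.inl hv
    · exact Or.inr (mem_toList.mpr
        (mem_sdiff.mpr ⟨mem_univ _, fun h => hv (List.mem_toFinset.mp h)⟩))
  have hlen : (flat bs').length = Fintype.card V := by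
    rw [h6.length_eq, List.length_append, length_toList, ← hUc, add_comm]
  have htake : (flat bs').take l = Y := by
    obtain ⟨r, hr⟩ := exists_flat l bs' Y
    rw [h5, hstart] at hr
    have := congrArg (List.take l) hr
    rwa [List.take_append_of_le_length (by omega), ← hY, List.take_left, hY] at this
  refine ⟨flat bs', hnd', hmem, ?_⟩
  refine LPath.exists_cycle ?_ hl hm (by omega)
  rw [htake]
  exact h4.lpath hY

theorem start_sublist_flat {V : Type*} [DecidableEq V] (l : ℕ) {bs : List (List V × List V)}
    (Y : List V) (h : bs ≠ []) : (start l bs Y).Sublist (flat bs) := by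
  cases bs with
  | nil => exact absurd rfl h
  | cons b bs =>
    simp only [start, flat, List.flatMap_cons, List.append_assoc]
    exact (List.take_sublist _ _).trans (List.sublist_append_left _ _)

/-- The minimum pair degree condition yields a Hamiltonian cycle. -/
theorem exists_hamilton (h c : ℕ) (hhc : 1 ≤ 2 * h + c) {γ : ℝ} (hγ : 0 < γ) (hγ1 : γ ≤ 1) :
    ∃ n₀ : ℕ, ∀ (V : Type) [Fintype V] [DecidableEq V], n₀ ≤ Fintype.card V →
      (h + c + 2) ∣ Fintype.card V → ∀ E : Finset (Finset V),
      (∀ S : Finset V, #S = 2 * h + c + 1 →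
        ((4 * ((h + c + 2 : ℕ) : ℝ) - 1) / (4 * ((h + c + 2 : ℕ) : ℝ) ^ 2) + γ) *
          (Fintype.card V : ℝ) ^ 2 ≤ pairDeg E S) →
      ∃ vs : List V, vs.Nodup ∧ (∀ v, v ∈ vs) ∧ 1 ≤ vs.length / (h + c + 2) ∧
        ∀ i < vs.length / (h + c + 2),
          ((vs.rotate (i * (h + c + 2))).take (h + c + 2 + (h + 1))).toFinset ∈ E := by
  obtain ⟨a, ha, H₁⟩ := exists_reservoir h c hhc hγ hγ1
  obtain ⟨β₂, hβ₂, n₂, H₂⟩ := exists_absorbing_chain h c hhc hγ hγ1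
    (η := min a (γ / 32)) (lt_min ha (by positivity))
  obtain ⟨β₁, hβ₁, n₁, H₁⟩ := H₁ (min (β₂ / 2) (γ / 32)) (lt_min (by positivity) (by positivity))
  obtain ⟨s₀, hs₀⟩ := exists_nat_ge (2 / β₁)
  obtain ⟨s, hss, hs, n₃, H₃⟩ := exists_tiling h c hhc hγ hγ1 (half_pos hβ₂) s₀
  refine ⟨n₁ + n₂ + n₃ + (2 * h + c + 3), ?_⟩
  intro V _ _ hV hdvd E hE
  set n : ℝ := (Fintype.card V : ℝ) with hn
  have hn0 : 0 < n := by
    rw [hn]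
    exact Nat.cast_pos.mpr (by omega)
  have hE' : ∀ S : Finset V, #S = 2 * h + c + 1 → γ * n ^ 2 ≤ pairDeg E S := by
    intro S hS
    refine le_trans ?_ (hE S hS)
    refine mul_le_mul_of_nonneg_right ?_ (sq_nonneg n)
    have h1 : (1 : ℝ) ≤ ((h + c + 2 : ℕ) : ℝ) := Nat.one_le_cast.mpr (by omega)
    have h2 : 0 ≤ (4 * ((h + c + 2 : ℕ) : ℝ) - 1) / (4 * ((h + c + 2 : ℕ) : ℝ) ^ 2) :=
      div_nonneg (by linarith) (by positivity)
    linarith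
  obtain ⟨bA, YA, hYA, hbA, hcA, hndA, hlenA, habs⟩ := H₂ V (by omega) E hE'
  set W := (flat bA ++ YA).toFinset with hW
  have hWc : (#W : ℝ) ≤ min a (γ / 32) * n := by
    refine le_trans ?_ hlenA
    exact_mod_cast List.toFinset_card_le _
  obtain ⟨R, hRW, hRc, Q, hQ, hconn⟩ := H₁ V (by omega) E hE' W
    (hWc.trans (mul_le_mul_of_nonneg_right (min_le_left _ _) hn0.le))
  have hWR : (#(W ∪ R) : ℝ) ≤ γ / 16 * n := by
    have h1 : (#(W ∪ R) : ℝ) ≤ #W + #R := by exact_mod_cast card_union_le W R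
    have h2 := mul_le_mul_of_nonneg_right (min_le_right a (γ / 32)) hn0.le
    have h3 := mul_le_mul_of_nonneg_right (min_le_right (β₂ / 2) (γ / 32)) hn0.le
    linarith
  obtain ⟨M, P, hP, hPc⟩ := H₃ V (by omega) E hE (W ∪ R) hWR
  have hM : (M : ℝ) < β₁ * n := by
    have h1 := hP.card_add
    rw [Fintype.card_fin] at h1
    have h2 : (M : ℝ) * s ≤ n := by
      rw [hn]
      exact_mod_cast (by omega : M * s ≤ Fintype.card V)
    have h3 : 2 / β₁ ≤ s := hs₀.trans (Nat.cast_le.mpr hss)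
    rw [div_le_iff₀ hβ₁] at h3
    have h4 : (0 : ℝ) ≤ M := Nat.cast_nonneg _
    have h5 : (M : ℝ) * 2 ≤ M * (s * β₁) := mul_le_mul_of_nonneg_left h3 h4
    have h6 : (M : ℝ) * s * β₁ ≤ n * β₁ := mul_le_mul_of_nonneg_right h2 hβ₁.le
    nlinarith [mul_pos hn0 hβ₁]
  set Y := start (h + 1) bA YA with hYd
  have hY : Y.length = h + 1 := hcA.length_start hYA
  have hYs : Y.Sublist (flat bA) := start_sublist_flat _ _ hbA
  set tiles := List.ofFn P with htiles
  have hPW : ∀ v ∈ tiles.flatten, v ∉ W ∪ R := by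
    intro v hv
    obtain ⟨q, hq, hvq⟩ := List.mem_flatten.mp hv
    obtain ⟨j, rfl⟩ := (List.mem_ofFn' _ _).mp hq
    exact (hP.1 j).2.2.2 v hvq
  have hndT : tiles.flatten.Nodup := by
    rw [List.nodup_flatten]
    refine ⟨?_, ?_⟩
    · intro q hq
      obtain ⟨j, rfl⟩ := (List.mem_ofFn' _ _).mp hq
      exact (hP.1 j).2.2.1
    · rw [htiles, List.pairwise_ofFn]
      intro i j hij
      exact hP.2 i j hij.ne
  have hmemA : ∀ v ∈ flat bA, v ∈ W := fun v hv =>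
    List.mem_toFinset.mpr (List.mem_append_left _ hv)
  have hmemY : ∀ v ∈ YA, v ∈ W := fun v hv =>
    List.mem_toFinset.mpr (List.mem_append_right _ hv)
  obtain ⟨hndA1, hndA2, hdisA⟩ := List.nodup_append'.mp hndA
  have hndYT : (YA ++ tiles.flatten).Nodup := List.nodup_append'.mpr
    ⟨hndA2, hndT, fun v hv hv' => hPW v hv' (mem_union_left _ (hmemY v hv))⟩
  have hdisYT : List.Disjoint (flat bA) (YA ++ tiles.flatten) := by
    intro v hv hv'
    rcases List.mem_append.mp hv' with hv' | hv'
    · exact hdisA hv hv'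
    · exact hPW v hv' (mem_union_left _ (hmemA v hv))
  obtain ⟨bT, hT1, hT2, hT3, hT4⟩ := exists_chain (N := M + 1) (Q := Q)
    (fun U hU hUQ X Z hX hZ hXZ => hconn U (lt_of_le_of_lt
      (Nat.cast_le.mpr (Nat.lt_succ_iff.mp hU)) hM) hUQ X Z hX hZ hXZ) hY (YA :: tiles)
    (by
      intro q hq
      rcases List.mem_cons.mp hq with rfl | hq
      · exact LPath.base _ hYA
      · obtain ⟨j, rfl⟩ := (List.mem_ofFn' _ _).mp hq
        exact (hP.1 j).1)
    (by
      rw [List.flatten_cons]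
      refine List.nodup_append'.mpr ⟨hndYT, hndA1.sublist hYs, ?_⟩
      exact fun v hv hv' => hdisYT (hYs.subset hv') hv)
    (by rw [htiles, List.length_cons, List.length_ofFn])
  have hsT : start (h + 1) bT Y = YA := by
    cases bT with
    | nil => simp at hT1
    | cons b bT =>
      simp only [List.map_cons, List.cons.injEq] at hT1
      simp only [start, hT1.1, ← hYA, List.take_length]
  have hchain : Chain E (h + 1) (h + c + 2) (bA ++ bT) Y := by
    rw [chain_append, hsT]
    exact ⟨hcA, hT2⟩
  have hstart : start (h + 1) (bA ++ bT) Y = Y := by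
    rw [start_append, hsT]
  have hRflat : ∀ p ∈ bT.map Prod.snd, ∀ v ∈ p, v ∈ R := fun p hp => (hQ p (hT3 p hp)).2
  have hndflatT : (flat bT).Nodup := by
    refine flat_nodup ?_ (fun p hp => (hQ p (hT3 p hp)).1) hT4 ?_
    · rw [hT1]
      exact hndYT
    · intro p hp v hv hv'
      have hvR := hRflat p hp v hv
      rw [hT1, List.flatten_cons] at hv'
      rcases List.mem_append.mp hv' with hv' | hv'
      · exact hRW v hvR (hmemY v hv')
      · exact hPW v hv' (mem_union_right _ hvR)
  have hnd : (flat (bA ++ bT)).Nodup := by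
    rw [flat_append, List.nodup_append']
    refine ⟨hndA1, hndflatT, ?_⟩
    intro v hv hv'
    rw [(flat_perm bT).mem_iff, hT1, List.mem_append, List.flatten_cons] at hv'
    rcases hv' with hv' | hv'
    · exact hdisYT hv hv'
    · obtain ⟨p, hp, hvp⟩ := List.mem_flatten.mp hv'
      exact hRW v (hRflat p hp v hvp) (hmemA v hv)
  refine exists_cycle_of_absorb (Nat.succ_pos h) (by omega) (by omega) hdvd hY hchain hnd hstart ?_
  intro Ts hTs hTl
  refine habs bT Y Ts hchain hTs ?_
  have hsub : univ \ (flat (bA ++ bT)).toFinset ⊆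
      (univ \ ((W ∪ R) ∪ univ.biUnion fun j => (P j).toFinset)) ∪ R := by
    intro v hv
    by_contra hv'
    rw [mem_union, not_or] at hv'
    have hv₁ : v ∈ (W ∪ R) ∪ univ.biUnion fun j => (P j).toFinset := by
      by_contra h1
      exact hv'.1 (mem_sdiff.mpr ⟨mem_univ _, h1⟩)
    refine (mem_sdiff.mp hv).2 (List.mem_toFinset.mpr ?_)
    rw [flat_append, List.mem_append, (flat_perm bT).mem_iff, hT1, List.mem_append,
      List.flatten_cons, List.mem_append]
    rw [mem_union, mem_union, mem_biUnion] at hv₁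
    rcases hv₁ with (h1 | h1) | ⟨j, -, h1⟩
    · rcases List.mem_append.mp (List.mem_toFinset.mp h1) with h1 | h1
      · exact Or.inl h1
      · exact Or.inr (Or.inl (Or.inl h1))
    · exact absurd h1 hv'.2
    · exact Or.inr (Or.inl (Or.inr (List.mem_flatten.mpr
        ⟨P j, (List.mem_ofFn' _ _).mpr ⟨j, rfl⟩, List.mem_toFinset.mp h1⟩)))
  have h1 := (card_le_card hsub).trans (card_union_le _ _)
  have h2 : (Ts.length : ℝ) ≤ #(univ \ ((W ∪ R) ∪ univ.biUnion fun j => (P j).toFinset)) + #R := by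
    exact_mod_cast hTl.trans h1
  have h3 := mul_le_mul_of_nonneg_right (min_le_left (β₂ / 2) (γ / 32)) hn0.le
  linarith

end Hamilton

theorem two_mul_degH_le {n k : ℕ} {E : Finset (Finset (Fin n))} (hE : ∀ e ∈ E, #e = k + 2)
    {S : Finset (Fin n)} (hS : #S = k) : 2 * degH E S ≤ pairDeg E S := by
  have key : ∀ e ∈ E.filter fun e => S ⊆ e, ∀ p ∈ (e \ S).offDiag,
      insert p.1 (insert p.2 S) = e := by
    intro e he p hp
    rw [mem_filter] at he
    simp only [mem_offDiag, mem_sdiff] at hp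
    refine eq_of_subset_of_card_le (insert_subset hp.1.1 (insert_subset hp.2.1.1 he.2)) ?_
    rw [hE e he.1, card_insert_of_notMem, card_insert_of_notMem hp.2.1.2, hS]
    rw [mem_insert, not_or]
    exact ⟨hp.2.2, hp.1.2⟩
  have h1 : #((E.filter fun e => S ⊆ e).biUnion fun e => (e \ S).offDiag) = 2 * degH E S := by
    rw [card_biUnion]
    · have h2 : ∀ e ∈ E.filter fun e => S ⊆ e, #(e \ S).offDiag = 2 := by
        intro e he
        rw [mem_filter] at he
        rw [offDiag_card, card_sdiff_of_subset he.2, hE e he.1, hS, Nat.add_sub_cancel_left]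
      rw [sum_congr rfl h2, sum_const, smul_eq_mul, mul_comm, degH]
    · intro e he f hf hef
      refine Finset.disjoint_left.mpr fun p hp hq => hef ?_
      exact (key e he p hp).symm.trans (key f hf p hq)
  rw [← h1, pairDeg]
  refine card_le_card fun p hp => ?_
  obtain ⟨e, he, hp⟩ := mem_biUnion.mp hp
  rw [mem_filter, key e he p hp]
  exact ⟨mem_univ _, (mem_filter.mp he).1⟩

end HamCycle

theorem stmt0 (k l : ℕ) (hk : 4 ≤ k) (hl1 : 1 ≤ l) (hl2 : 2 * l < k)
    (γ : ℝ) (hγ : 0 < γ) :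
    ∃ n₀ : ℕ, ∀ n : ℕ, n₀ ≤ n → (k - l) ∣ n →
      ∀ E : Finset (Finset (Fin n)), (∀ e ∈ E, e.card = k) →
        (∀ S : Finset (Fin n), S.card = k - 2 →
          ((4 * ((k : ℝ) - l) - 1) / (4 * ((k : ℝ) - l) ^ 2) + γ) * (Nat.choose n 2) ≤
            (degH E S : ℝ)) →
        HasHamCycle k l E := by
  obtain ⟨h, rfl⟩ : ∃ h, l = h + 1 := ⟨l - 1, by omega⟩
  obtain ⟨c, rfl⟩ : ∃ c, k = h + c + 2 + (h + 1) := ⟨k - 2 * h - 3, by omega⟩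
  have hm : h + c + 2 + (h + 1) - (h + 1) = h + c + 2 := by omega
  have hm' : ((h + c + 2 + (h + 1) : ℕ) : ℝ) - ((h + 1 : ℕ) : ℝ) = ((h + c + 2 : ℕ) : ℝ) := by
    push_cast
    ring
  set τ : ℝ := (4 * ((h + c + 2 : ℕ) : ℝ) - 1) / (4 * ((h + c + 2 : ℕ) : ℝ) ^ 2) with hτ
  obtain ⟨n₁, H⟩ := HamCycle.exists_hamilton h c (by omega) (γ := min γ 1 / 2)
    (half_pos (lt_min hγ one_pos)) (by linarith [min_le_right γ 1])
  obtain ⟨n₂, hn₂⟩ := exists_nat_ge ((τ + γ) / (γ / 2))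
  refine ⟨n₁ + n₂, ?_⟩
  intro n hn hdvd E hE hdeg
  rw [hm] at hdvd
  rw [hm', ← hτ] at hdeg
  rw [HasHamCycle, hm]
  refine H (Fin n) (by rw [Fintype.card_fin]; omega) (by rwa [Fintype.card_fin]) E ?_
  intro S hS
  rw [Fintype.card_fin, ← hτ]
  have h1 := hdeg S (by omega)
  rw [Nat.cast_choose_two] at h1
  have h2 : (2 : ℝ) * degH E S ≤ HamCycle.pairDeg E S := by
    exact_mod_cast HamCycle.two_mul_degH_le (k := 2 * h + c + 1)
      (fun e he => (hE e he).trans (by omega)) hS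
  have h3 : (τ + γ) / (γ / 2) ≤ n := hn₂.trans (Nat.cast_le.mpr (by omega))
  rw [div_le_iff₀ (half_pos hγ)] at h3
  have h4 : (0 : ℝ) ≤ n := Nat.cast_nonneg n
  have h5 := mul_le_mul_of_nonneg_left h3 h4
  have h6 := mul_le_mul_of_nonneg_right (min_le_left γ 1) (sq_nonneg (n : ℝ))
  nlinarith
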